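/- For all γ > 0 and Δ ∈ ℕ there exist β > 0 and n₀ ∈ ℕ such that for all n ≥ n₀ the following holds: if G and H are balanced bipartite graphs on 2n vertices such that δ(G) ≥ (1/2 + γ)n, Δ(H) ≤ Δ, and H has bandwidth at most βn, then G contains a copy of H (i.e., H is isomorphic to a subgraph of G). -/

import Mathlib

open Finset

section
namespace BW
open Finset
open scoped Classical

/-- `P` is typical towards `Q`. -/
def Dns {W : Type*} (G : SimpleGraph W) (e d : ℝ) (P Q : Finset W) : Prop :=
  ∀ C ⊆ Q, e ≤ (#C : ℝ) →
    (#(P.filter fun w => (#(C.filter fun x => G.Adj w x) : ℝ) < d * #C) : ℝ) ≤ e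

/-- The data of a greedy embedding. -/
structure Ctx (V W ι : Type*) [Fintype V] [DecidableEq ι] where
  H : SimpleGraph V
  G : SimpleGraph W
  φ : V → ι
  cl : ι → Finset W
  old : V → Finset V
  base : V → ℝ
  d : ℝ
  e : ℝ
  Δ : ℕ
  hd0 : 0 < d
  hd1 : d ≤ 1
  he : 0 ≤ e
  hdeg : ∀ v, #(univ.filter fun u => H.Adj v u) ≤ Δ
  hdns : ∀ u v, H.Adj u v → Dns G e d (cl (φ u)) (cl (φ v))
  hcl : ∀ i j, i ≠ j → Disjoint (cl i) (cl j)
  hbase0 : ∀ u, 0 ≤ base u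
  hbase : ∀ u, e ≤ d ^ Δ * base u
  hold : ∀ u, base u + #((old u).filter fun v => φ v = φ u) ≤ #(cl (φ u))

variable {V W ι : Type*} [Fintype V] [DecidableEq ι]

namespace Ctx

variable (X : Ctx V W ι)

noncomputable def cand (f : V → W) (S : Finset V) (u : V) : Finset W :=
  (X.cl (X.φ u)).filter fun w => ∀ v ∈ S, X.H.Adj u v → X.G.Adj (f v) w

noncomputable def trk (f : V → W) (S : Finset V) (u : V) : Finset W :=
  X.cand f S u \ (S ∩ X.old u).image f

noncomputable def nb (S : Finset V) (u : V) : ℕ := #(S.filter fun v => X.H.Adj u v)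

structure Inv (f : V → W) (S : Finset V) : Prop where
  inj : Set.InjOn f S
  mem : ∀ v ∈ S, f v ∈ X.cl (X.φ v)
  adj : ∀ u ∈ S, ∀ v ∈ S, X.H.Adj u v → X.G.Adj (f u) (f v)
  big : ∀ u, u ∉ S → X.d ^ (X.nb S u) * X.base u ≤ #(X.trk f S u)

lemma nb_le (S : Finset V) (u : V) : X.nb S u ≤ X.Δ := by
  refine le_trans (card_le_card ?_) (X.hdeg u)
  intro x hx
  simp at hx ⊢
  exact hx.2

/-- tracked size is always at least `d^Δ base`. -/
lemma Inv.big' {X : Ctx V W ι} {f : V → W} {S : Finset V} (h : X.Inv f S) {u : V} (hu : u ∉ S) :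
    X.d ^ X.Δ * X.base u ≤ #(X.trk f S u) := by
  refine le_trans ?_ (h.big u hu)
  exact mul_le_mul_of_nonneg_right (pow_le_pow_of_le_one X.hd0.le X.hd1 (X.nb_le S u)) (X.hbase0 u)

/-- If no neighbour of `u` is embedded then the tracked set is big for trivial reasons. -/
lemma trk_of_no_nb {f : V → W} {S : Finset V} {u : V} (hinj : ∀ v ∈ S, f v ∈ X.cl (X.φ v))
    (hno : ∀ x ∈ S, ¬ X.H.Adj u x) : X.base u ≤ #(X.trk f S u) := by
  have h1 : X.cand f S u = X.cl (X.φ u) := by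
    unfold cand
    apply filter_true_of_mem
    intro w _ v hv huv
    exact absurd huv (hno v hv)
  have h2 : X.cl (X.φ u) \ (((X.old u).filter fun v => X.φ v = X.φ u).image f) ⊆ X.trk f S u := by
    intro w hw
    simp only [trk, h1, mem_sdiff, mem_image, mem_inter, mem_filter, not_exists] at hw ⊢
    refine ⟨hw.1, fun v hv => ?_⟩
    apply hw.2 v
    refine ⟨⟨hv.1.2, ?_⟩, hv.2⟩
    by_contra hne
    have h3 := hinj v hv.1.1
    rw [hv.2] at h3
    exact (disjoint_left.1 (X.hcl _ _ hne)) h3 hw.1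
  have h3 := card_le_card h2
  have h4 := le_card_sdiff (((X.old u).filter fun v => X.φ v = X.φ u).image f) (X.cl (X.φ u))
  have h5 : #(((X.old u).filter fun v => X.φ v = X.φ u).image f) ≤
    #((X.old u).filter fun v => X.φ v = X.φ u) := card_image_le
  have h6 := X.hold u
  have h7 : #(X.cl (X.φ u)) ≤ #(X.trk f S u) + #((X.old u).filter fun v => X.φ v = X.φ u) := by
    omega
  have h8 : (#(X.cl (X.φ u)) : ℝ) ≤ #(X.trk f S u) + #((X.old u).filter fun v => X.φ v = X.φ u) := by
    exact_mod_cast h7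
  linarith

lemma inv_empty (f : V → W) : X.Inv f ∅ := by
  refine ⟨by simp, by simp, by simp, ?_⟩
  intro u _
  have := X.trk_of_no_nb (f := f) (S := ∅) (u := u) (by simp) (by simp)
  simpa [nb] using this

noncomputable def bad (f : V → W) (S : Finset V) (v : V) : Finset W :=
  (univ.filter fun u => u ∉ S ∧ X.H.Adj v u).biUnion fun u =>
    (X.cl (X.φ v)).filter fun w =>
      (#((X.trk f S u).filter fun x => X.G.Adj w x) : ℝ) < X.d * #(X.trk f S u)

lemma trk_sub (f : V → W) (S : Finset V) (u : V) : X.trk f S u ⊆ X.cl (X.φ u) :=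
  sdiff_subset.trans (filter_subset _ _)

lemma bad_card {f : V → W} {S : Finset V} (h : X.Inv f S) (v : V) :
    (#(X.bad f S v) : ℝ) ≤ X.Δ * X.e := by
  have h1 : (#(X.bad f S v) : ℝ) ≤ ∑ u ∈ (univ.filter fun u => u ∉ S ∧ X.H.Adj v u), X.e := by
    refine le_trans (Nat.cast_le.2 card_biUnion_le) ?_
    push_cast
    apply sum_le_sum
    intro u hu
    simp at hu
    exact X.hdns v u hu.2 _ (X.trk_sub f S u) (le_trans (X.hbase u) (h.big' hu.1))
  refine h1.trans ?_
  rw [sum_const, nsmul_eq_mul]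
  apply mul_le_mul_of_nonneg_right _ X.he
  have : #(univ.filter fun u => u ∉ S ∧ X.H.Adj v u) ≤ X.Δ := by
    refine le_trans (card_le_card ?_) (X.hdeg v)
    intro u hu
    simp at hu ⊢
    exact hu.2
  exact_mod_cast this

lemma step {f : V → W} {S : Finset V} (h : X.Inv f S) {v : V} (hv : v ∉ S)
    (hold : ∀ u, u ∉ insert v S → v ∈ X.old u → ∀ x ∈ insert v S, ¬ X.H.Adj u x)
    {w : W} (hw : w ∈ X.cand f S v) (hwf : w ∉ S.image f) (hwb : w ∉ X.bad f S v) :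
    X.Inv (Function.update f v w) (insert v S) := by
  have hne : ∀ x ∈ S, x ≠ v := fun x hx hxv => hv (hxv ▸ hx)
  have hup : ∀ x ∈ S, Function.update f v w x = f x := fun x hx =>
    Function.update_of_ne (hne x hx) _ _
  have hwc : w ∈ X.cl (X.φ v) := (mem_filter.1 hw).1
  have hwa : ∀ x ∈ S, X.H.Adj v x → X.G.Adj (f x) w := (mem_filter.1 hw).2
  have hmem : ∀ x ∈ insert v S, Function.update f v w x ∈ X.cl (X.φ x) := by
    intro x hx
    rcases mem_insert.1 hx with rfl | hx
    · simpa using hwc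
    · rw [hup x hx]; exact h.mem x hx
  refine ⟨?_, hmem, ?_, ?_⟩
  · intro x hx y hy hxy
    simp only [coe_insert, Set.mem_insert_iff, mem_coe] at hx hy
    rcases hx with rfl | hx <;> rcases hy with rfl | hy
    · rfl
    · rw [hup y hy, Function.update_self] at hxy
      exact absurd (mem_image.2 ⟨y, hy, hxy.symm⟩) hwf
    · rw [hup x hx, Function.update_self] at hxy
      exact absurd (mem_image.2 ⟨x, hx, hxy⟩) hwf
    · rw [hup x hx, hup y hy] at hxy
      exact h.inj hx hy hxy
  · intro x hx y hy hxy
    rcases mem_insert.1 hx with hx' | hx' <;> rcases mem_insert.1 hy with hy' | hy'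
    · rw [hx', hy'] at hxy
      exact absurd hxy (X.H.irrefl)
    · rw [hup y hy', hx', Function.update_self]
      exact (hwa y hy' (hx' ▸ hxy)).symm
    · rw [hup x hx', hy', Function.update_self]
      exact hwa x hx' (hy' ▸ hxy.symm)
    · rw [hup x hx', hup y hy']
      exact h.adj x hx' y hy' hxy
  · intro u hu
    have huS : u ∉ S := fun h' => hu (mem_insert_of_mem h')
    by_cases hou : v ∈ X.old u
    · have hno := hold u hu hou
      have h1 := X.trk_of_no_nb hmem hno
      have h2 : X.nb (insert v S) u = 0 := by
        unfold nb
        rw [card_eq_zero]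
        apply filter_false_of_mem hno
      rw [h2, pow_zero, one_mul]
      exact h1
    · have himg : ((insert v S) ∩ X.old u).image (Function.update f v w) =
          (S ∩ X.old u).image f := by
        rw [insert_inter_of_notMem hou]
        apply image_congr
        intro x hx
        simp at hx
        exact hup x hx.1
      have hcand : X.cand (Function.update f v w) (insert v S) u =
          (X.cand f S u).filter fun x => X.H.Adj u v → X.G.Adj w x := by
        ext x
        simp only [cand, mem_filter, mem_insert, forall_eq_or_imp, Function.update_self]
        constructor
        · rintro ⟨h1, h2, h3⟩
          exact ⟨⟨h1, fun y hy => by rw [← hup y hy]; exact h3 y hy⟩, h2⟩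
        · rintro ⟨⟨h1, h3⟩, h2⟩
          exact ⟨h1, h2, fun y hy => by rw [hup y hy]; exact h3 y hy⟩
      have htrk : X.trk (Function.update f v w) (insert v S) u =
          (X.trk f S u).filter fun x => X.H.Adj u v → X.G.Adj w x := by
        unfold trk
        rw [himg, hcand]
        ext x
        simp only [mem_sdiff, mem_filter]
        tauto
      by_cases huv : X.H.Adj u v
      · have h1 : X.nb (insert v S) u = X.nb S u + 1 := by
          unfold nb
          rw [filter_insert, if_pos huv, card_insert_of_notMem]
          simp [hv]
        rw [htrk, h1]
        have h2 : ¬ ((#((X.trk f S u).filter fun x => X.G.Adj w x) : ℝ) < X.d * #(X.trk f S u)) := by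
          intro h3
          apply hwb
          unfold bad
          simp only [mem_biUnion, mem_filter, mem_univ, true_and]
          exact ⟨u, ⟨huS, huv.symm⟩, hwc, h3⟩
        simp only [huv, forall_true_left]
        push Not at h2
        refine le_trans ?_ h2
        rw [pow_succ, mul_comm _ X.d, mul_assoc]
        exact mul_le_mul_of_nonneg_left (h.big u huS) X.hd0.le
      · have h1 : X.nb (insert v S) u = X.nb S u := by
          unfold nb
          rw [filter_insert, if_neg huv]
        rw [htrk, h1]
        simp only [huv, false_imp_iff, filter_true]
        exact h.big u huS

/-- Stage 2: greedy extension in the order of `τ`. -/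
lemma stage2 (τ : V → ℕ) (b : ℕ) (M S₁ : Finset V)
    (hold : ∀ u v, v ∈ X.old u → τ v + b < τ u)
    (hedge : ∀ u v, X.H.Adj u v → τ u ≤ τ v + b)
    (hS₁ : ∀ u, ∀ x ∈ S₁, X.H.Adj u x → X.old u = ∅)
    (hrec : ∀ u ∈ M, X.Δ * X.e + #(M.filter fun v => v ∉ X.old u ∧ X.φ v = X.φ u ∧ v ≠ u ∧
        (v ∈ S₁ ∨ τ v ≤ τ u)) < X.d ^ X.Δ * X.base u)
    (f : V → W) (S : Finset V) (hS₁S : S₁ ⊆ S) (hSM : S ⊆ M) (h : X.Inv f S)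
    (hord : ∀ x ∈ S, x ∉ S₁ → ∀ y ∈ M, y ∉ S → τ x ≤ τ y) :
    ∃ f', X.Inv f' M ∧ ∀ x ∈ S, f' x = f x := by
  induction hk : #(M \ S) generalizing f S with
  | zero =>
    have : S = M := by
      apply Subset.antisymm hSM
      rw [card_eq_zero, sdiff_eq_empty_iff_subset] at hk
      exact hk
    subst this
    exact ⟨f, h, fun _ _ => rfl⟩
  | succ k ih =>
    have hne : (M \ S).Nonempty := by
      rw [← card_pos]; omega
    obtain ⟨v, hvMS, hmin⟩ := exists_min_image (M \ S) τ hne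
    have hvM : v ∈ M := (mem_sdiff.1 hvMS).1
    have hvS : v ∉ S := (mem_sdiff.1 hvMS).2
    have hSle : ∀ x ∈ S, x ∉ S₁ → τ x ≤ τ v := fun x hx hx1 => hord x hx hx1 v hvM hvS
    -- choose w
    have hex : ∃ w ∈ X.trk f S v, w ∉ (M.filter fun x => x ∈ S ∧ x ∉ X.old v ∧ X.φ x = X.φ v).image f ∧
        w ∉ X.bad f S v := by
      by_contra hcon
      push Not at hcon
      have h1 : X.trk f S v ⊆
          (M.filter fun x => x ∈ S ∧ x ∉ X.old v ∧ X.φ x = X.φ v).image f ∪ X.bad f S v := by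
        intro w hw
        rw [mem_union]
        by_cases hw2 : w ∈ (M.filter fun x => x ∈ S ∧ x ∉ X.old v ∧ X.φ x = X.φ v).image f
        · exact Or.inl hw2
        · exact Or.inr (hcon w hw hw2)
      have h2 := card_le_card h1
      have h3 := card_union_le
        ((M.filter fun x => x ∈ S ∧ x ∉ X.old v ∧ X.φ x = X.φ v).image f) (X.bad f S v)
      have h4 : #((M.filter fun x => x ∈ S ∧ x ∉ X.old v ∧ X.φ x = X.φ v).image f) ≤
          #(M.filter fun x => x ∉ X.old v ∧ X.φ x = X.φ v ∧ x ≠ v ∧ (x ∈ S₁ ∨ τ x ≤ τ v)) := by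
        refine card_image_le.trans (card_le_card ?_)
        intro x hx
        simp only [mem_filter] at hx ⊢
        refine ⟨hx.1, hx.2.2.1, hx.2.2.2, ?_, ?_⟩
        · rintro rfl; exact hvS hx.2.1
        · by_cases hx1 : x ∈ S₁
          · exact Or.inl hx1
          · exact Or.inr (hSle x hx.2.1 hx1)
      have h5 := X.bad_card h v
      have h6 := h.big' hvS
      have h7 := hrec v hvM
      have h8 : (#(X.trk f S v) : ℝ) ≤
          #(M.filter fun x => x ∉ X.old v ∧ X.φ x = X.φ v ∧ x ≠ v ∧ (x ∈ S₁ ∨ τ x ≤ τ v)) +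
          #(X.bad f S v) := by
        have h9 := h2.trans (h3.trans (Nat.add_le_add_right h4 _))
        exact_mod_cast h9
      linarith
    obtain ⟨w, hwt, hwi, hwb⟩ := hex
    have hwc : w ∈ X.cand f S v := (mem_sdiff.1 hwt).1
    have hwf : w ∉ S.image f := by
      intro hw
      obtain ⟨x, hx, hxw⟩ := mem_image.1 hw
      by_cases hxo : x ∈ X.old v
      · exact (mem_sdiff.1 hwt).2 (mem_image.2 ⟨x, mem_inter.2 ⟨hx, hxo⟩, hxw⟩)
      · apply hwi
        refine mem_image.2 ⟨x, mem_filter.2 ⟨hSM hx, hx, hxo, ?_⟩, hxw⟩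
        by_contra hne
        have h1 := h.mem x hx
        rw [hxw] at h1
        exact (disjoint_left.1 (X.hcl _ _ hne)) h1 (X.trk_sub f S v hwt)
    have hInv := X.step h hvS (by
      intro u hu hvu x hx hadj
      have h1 := hold u v hvu
      have h2 := hedge u x hadj
      rcases mem_insert.1 hx with rfl | hxS
      · omega
      · by_cases hx1 : x ∈ S₁
        · have := hS₁ u x hx1 hadj
          rw [this] at hvu
          simp at hvu
        · have := hSle x hxS hx1
          omega) hwc hwf hwb
    obtain ⟨f', hf', hag⟩ := ih (Function.update f v w) (insert v S)
      (hS₁S.trans (subset_insert _ _)) (insert_subset hvM hSM) hInv (by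
        intro x hx hx1 y hy hyS
        have hyS' : y ∉ S := fun h' => hyS (mem_insert_of_mem h')
        rcases mem_insert.1 hx with rfl | hxS
        · exact hmin y (mem_sdiff.2 ⟨hy, hyS'⟩)
        · exact hord x hxS hx1 y hy hyS') (by
        have : M \ insert v S = (M \ S).erase v := by
          ext x; simp; tauto
        rw [this, card_erase_of_mem hvMS]; omega)
    refine ⟨f', hf', fun x hx => ?_⟩
    rw [hag x (mem_insert_of_mem hx), Function.update_of_ne]
    rintro rfl; exact hvS hx

end Ctx
end BW
end

section
namespace BW
open Finset
open scoped Classical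

/-- one-step averaging -/
lemma avg1 {W κ : Type*} (O : Finset W) (hO : O.Nonempty) (K : Finset κ) (ω : κ → ℝ)
    (hω : ∀ k ∈ K, 0 ≤ ω k) (ρ : ℝ) (P : κ → W → Prop)
    (h : ∀ k ∈ K, ρ * #O ≤ #(O.filter fun w => P k w)) :
    ∃ w ∈ O, ρ * ∑ k ∈ K, ω k ≤ ∑ k ∈ K.filter (fun k => P k w), ω k := by
  apply exists_le_of_sum_le hO
  simp only [sum_filter]
  rw [sum_comm, sum_const, nsmul_eq_mul, mul_sum, mul_sum]
  apply sum_le_sum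
  intro k hk
  rw [← sum_filter, sum_const, nsmul_eq_mul]
  nlinarith [h k hk, hω k hk, mul_le_mul_of_nonneg_right (h k hk) (hω k hk)]

lemma avgIter {St W κ : Type*} (K : Finset κ) (ω : κ → ℝ)
    (hω : ∀ k ∈ K, 0 ≤ ω k) (ρ : ℝ) (hρ : 0 ≤ ρ) (N : ℕ) (P : ℕ → St → Prop) (Al : ℕ → St → κ → Prop)
    (h : ∀ i < N, ∀ s, P i s → ∃ (O : Finset W) (g : W → St), O.Nonempty ∧ (∀ w ∈ O, P (i+1) (g w)) ∧
      ∀ k ∈ K, Al i s k → ρ * #O ≤ #(O.filter fun w => Al (i+1) (g w) k))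
    (s₀ : St) (h0 : P 0 s₀) (hA : ∀ k ∈ K, Al 0 s₀ k) :
    ∃ s, P N s ∧ ρ ^ N * ∑ k ∈ K, ω k ≤ ∑ k ∈ K.filter (fun k => Al N s k), ω k := by
  induction N with
  | zero =>
    refine ⟨s₀, h0, ?_⟩
    rw [filter_true_of_mem hA]; simp
  | succ N ih =>
    obtain ⟨s, hs, hsum⟩ := ih (fun i hi => h i (by omega))
    obtain ⟨O, g, hO, hP, hK⟩ := h N (by omega) s hs
    obtain ⟨w, hw, hle⟩ := avg1 O hO (K.filter fun k => Al N s k) ω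
      (fun k hk => hω k (mem_filter.1 hk).1) ρ (fun k w => Al (N+1) (g w) k)
      (fun k hk => hK k (mem_filter.1 hk).1 (mem_filter.1 hk).2)
    refine ⟨g w, hP w hw, ?_⟩
    calc ρ ^ (N+1) * ∑ k ∈ K, ω k = ρ * (ρ ^ N * ∑ k ∈ K, ω k) := by ring
      _ ≤ ρ * ∑ k ∈ K.filter (fun k => Al N s k), ω k := mul_le_mul_of_nonneg_left hsum hρ
      _ ≤ _ := hle
      _ ≤ _ := by
        apply sum_le_sum_of_subset_of_nonneg
        · intro k hk
          simp only [mem_filter] at hk ⊢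
          exact ⟨hk.1.1, hk.2⟩
        · intro k hk _
          exact hω k (mem_filter.1 hk).1

lemma potential {κ C St : Type*} (K : Finset κ) (ρ : ℝ) (hρ0 : 0 < ρ) (hρ1 : ρ ≤ 1) (D : Finset C)
    (rel : C → κ → Prop) (good : C → κ → St → Prop) (P : Finset C → St → Prop)
    (h : ∀ D' ⊆ D, ∀ c ∈ D, c ∉ D' → ∀ s, P D' s → ∀ ω : κ → ℝ, (∀ k, 0 ≤ ω k) →
      ∃ s', P (insert c D') s' ∧ (∀ c' ∈ D', ∀ k, good c' k s → good c' k s') ∧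
        ρ * ∑ k ∈ K.filter (fun k => rel c k), ω k ≤
          ∑ k ∈ K.filter (fun k => rel c k ∧ good c k s'), ω k)
    (s₀ : St) (h0 : P ∅ s₀) :
    ∃ s, P D s ∧ ∀ k ∈ K, 1 ≤ (#K : ℝ) * 2 ^ #(D.filter fun c => good c k s) *
      (1 - ρ / 2) ^ #(D.filter fun c => rel c k) := by
  have hq : 0 < 1 - ρ / 2 := by linarith
  let wt : Finset C → St → κ → ℝ := fun D' s k =>
    (1/2 : ℝ) ^ #(D'.filter fun c => good c k s) * ((1 - ρ/2)⁻¹) ^ #(D'.filter fun c => rel c k)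
  have hwt : ∀ D' s k, 0 < wt D' s k := fun D' s k => by positivity
  have key : ∀ D' ⊆ D, ∃ s, P D' s ∧ ∑ k ∈ K, wt D' s k ≤ #K := by
    intro D' hD'
    induction D' using Finset.induction_on with
    | empty => exact ⟨s₀, h0, by simp [wt]⟩
    | insert c D' hc ih =>
      have hD'' : D' ⊆ D := (subset_insert _ _).trans hD'
      obtain ⟨s, hs, hle⟩ := ih hD''
      obtain ⟨s', hs', hmono, hgain⟩ := h D' hD'' c (hD' (mem_insert_self _ _)) hc s hs (wt D' s)
        (fun k => (hwt _ _ _).le)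
      refine ⟨s', hs', le_trans ?_ hle⟩
      have hstep : ∀ k, wt (insert c D') s' k ≤
          wt D' s k * (if rel c k then (1 - ρ/2)⁻¹ * (if good c k s' then 1/2 else 1) else 1) := by
        intro k
        have hg : #(D'.filter fun c => good c k s) + (if good c k s' then 1 else 0) ≤
            #((insert c D').filter fun c => good c k s') := by
          rw [filter_insert]
          have : #(D'.filter fun c => good c k s) ≤ #(D'.filter fun c => good c k s') := by
            apply card_le_card
            intro x hx
            simp only [mem_filter] at hx ⊢
            exact ⟨hx.1, hmono x hx.1 k hx.2⟩
          split_ifs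
          · rw [card_insert_of_notMem (by simp [hc])]; omega
          · omega
        have hr : #((insert c D').filter fun c => rel c k) =
            #(D'.filter fun c => rel c k) + (if rel c k then 1 else 0) := by
          rw [filter_insert]
          split_ifs
          · rw [card_insert_of_notMem (by simp [hc])]
          · omega
        have hg2 := pow_le_pow_of_le_one (by norm_num : (0:ℝ) ≤ 1/2) (by norm_num) hg
        simp only [wt]
        rw [hr]
        refine le_trans (mul_le_mul_of_nonneg_right hg2 (by positivity)) ?_
        rw [pow_add, pow_add]
        have hp1 : (0:ℝ) ≤ (1/2 : ℝ) ^ #(D'.filter fun c => good c k s) := by positivity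
        have hp2 : (0:ℝ) ≤ ((1 - ρ/2)⁻¹) ^ #(D'.filter fun c => rel c k) := by positivity
        have hp3 := mul_nonneg hp1 hp2
        generalize ((1:ℝ)/2) ^ #(D'.filter fun c => good c k s) = a at *
        generalize ((1 - ρ/2)⁻¹) ^ #(D'.filter fun c => rel c k) = b at *
        by_cases h1 : rel c k <;> by_cases h2 : good c k s' <;> simp only [h1, h2, if_true, if_false]
        · apply le_of_eq; ring
        · apply le_of_eq; ring
        · simp only [pow_one, pow_zero, mul_one]
          nlinarith
        · apply le_of_eq; ring
      refine le_trans (sum_le_sum fun k _ => hstep k) ?_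
      have e1 : ∑ k ∈ K, wt D' s k * (if rel c k then (1 - ρ/2)⁻¹ * (if good c k s' then 1/2 else 1) else 1)
          = ∑ k ∈ K, wt D' s k + ((1 - ρ/2)⁻¹ - 1) * ∑ k ∈ K.filter (fun k => rel c k), wt D' s k
            - (1 - ρ/2)⁻¹ / 2 * ∑ k ∈ K.filter (fun k => rel c k ∧ good c k s'), wt D' s k := by
        simp only [sum_filter, mul_sum]
        rw [← sum_add_distrib, ← sum_sub_distrib]
        apply sum_congr rfl
        intro k _
        by_cases h1 : rel c k <;> by_cases h2 : good c k s' <;> simp [h1, h2] <;> ring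
      rw [e1]
      have e2 : ((1 - ρ/2)⁻¹ - 1) = (1 - ρ/2)⁻¹ / 2 * ρ := by
        have := inv_mul_cancel₀ hq.ne'
        linear_combination this
      rw [e2, mul_assoc]
      have := mul_le_mul_of_nonneg_left hgain (by positivity : (0:ℝ) ≤ (1 - ρ/2)⁻¹ / 2)
      linarith
  obtain ⟨s, hs, hle⟩ := key D (Subset.refl _)
  refine ⟨s, hs, fun k hk => ?_⟩
  have h1 : wt D s k ≤ #K := le_trans (single_le_sum (fun k _ => (hwt D s k).le) hk) hle
  have h2 : wt D s k * (2 ^ #(D.filter fun c => good c k s) *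
      (1 - ρ / 2) ^ #(D.filter fun c => rel c k)) = 1 := by
    simp only [wt]
    have a1 : ((1:ℝ)/2) ^ #(D.filter fun c => good c k s) * 2 ^ #(D.filter fun c => good c k s) = 1 := by
      rw [← mul_pow]; norm_num
    have a2 : ((1 - ρ/2)⁻¹) ^ #(D.filter fun c => rel c k) * (1 - ρ / 2) ^ #(D.filter fun c => rel c k) = 1 := by
      rw [← mul_pow, inv_mul_cancel₀ hq.ne', one_pow]
    linear_combination ((1 - ρ/2)⁻¹) ^ #(D.filter fun c => rel c k) * (1 - ρ / 2) ^ #(D.filter fun c => rel c k) * a1 + a2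
  calc (1:ℝ) = _ := h2.symm
    _ ≤ (#K : ℝ) * (2 ^ #(D.filter fun c => good c k s) *
      (1 - ρ / 2) ^ #(D.filter fun c => rel c k)) := mul_le_mul_of_nonneg_right h1 (by positivity)
    _ = _ := by ring

end BW
end

section
namespace BW
open Finset
open scoped Classical
variable {V W ι : Type*} [Fintype V] [DecidableEq ι]
namespace Ctx
variable (X : Ctx V W ι)

structure St1 (S₁ : Finset V) (m E : ℝ) : Prop where
  old : ∀ u, ∀ x ∈ S₁, X.H.Adj u x → X.old u = ∅
  load : ∀ i, (#(S₁.filter fun v => X.φ v = i) : ℝ) ≤ E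
  base : ∀ x ∈ S₁, m ≤ X.base x
  size : ∀ i, (#(X.cl i) : ℝ) ≤ m
  pos : 0 < X.d ^ X.Δ * m - E - X.Δ * X.e

noncomputable def opt (f : V → W) (S : Finset V) (v : V) : Finset W :=
  (X.cand f S v \ S.image f) \ X.bad f S v

variable {X} {S₁ : Finset V} {m E : ℝ}

lemma opt_sub (f : V → W) (S : Finset V) (v : V) : X.opt f S v ⊆ X.cl (X.φ v) :=
  (sdiff_subset.trans sdiff_subset).trans (filter_subset _ _)

lemma St1.opt_card (h : X.St1 S₁ m E) {f : V → W} {S : Finset V} (hI : X.Inv f S) (hS : S ⊆ S₁)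
    {v : V} (C : Finset W) (hC : C ⊆ X.cand f S v) :
    #C - E - X.Δ * X.e ≤ #((X.opt f S v).filter fun w => w ∈ C) := by
  have h1 : C ⊆ (X.opt f S v).filter (fun w => w ∈ C) ∪
      ((S.filter fun x => X.φ x = X.φ v).image f ∪ X.bad f S v) := by
    intro w hw
    by_cases h1 : w ∈ X.bad f S v
    · simp [h1]
    by_cases h2 : w ∈ S.image f
    · obtain ⟨x, hx, hxw⟩ := mem_image.1 h2
      have h3 : X.φ x = X.φ v := by
        by_contra hne
        have h4 := hI.mem x hx
        rw [hxw] at h4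
        exact (disjoint_left.1 (X.hcl _ _ hne)) h4 (mem_filter.1 (hC hw)).1
      rw [mem_union, mem_union]
      right; left
      exact mem_image.2 ⟨x, mem_filter.2 ⟨hx, h3⟩, hxw⟩
    · rw [mem_union]
      left
      unfold opt
      simp only [mem_filter, mem_sdiff]
      exact ⟨⟨⟨hC hw, h2⟩, h1⟩, hw⟩
  have h2 := (card_le_card h1).trans ((card_union_le _ _).trans
    (Nat.add_le_add_left (card_union_le _ _) _))
  have h3 : #((S.filter fun x => X.φ x = X.φ v).image f) ≤ #(S₁.filter fun x => X.φ x = X.φ v) :=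
    card_image_le.trans (card_le_card (filter_subset_filter _ hS))
  have h4 := h.load (X.φ v)
  have h5 := X.bad_card hI v
  have h6 : (#C : ℝ) ≤ #((X.opt f S v).filter (fun w => w ∈ C)) +
      (#(S₁.filter fun x => X.φ x = X.φ v) + #(X.bad f S v)) := by
    have : #C ≤ #((X.opt f S v).filter (fun w => w ∈ C)) +
      (#(S₁.filter fun x => X.φ x = X.φ v) + #(X.bad f S v)) := by omega
    exact_mod_cast this
  linarith

lemma St1.opt_big (h : X.St1 S₁ m E) {f : V → W} {S : Finset V} (hI : X.Inv f S) (hS : S ⊆ S₁)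
    {v : V} (hv : v ∈ S₁) (hvS : v ∉ S) :
    X.d ^ X.Δ * m - E - X.Δ * X.e ≤ #(X.opt f S v) := by
  have h1 := h.opt_card hI hS (X.cand f S v) (v := v) (Subset.refl _)
  have h2 : #((X.opt f S v).filter fun w => w ∈ X.cand f S v) ≤ #(X.opt f S v) :=
    card_le_card (filter_subset _ _)
  have h3 := hI.big' hvS
  have h4 : #(X.trk f S v) ≤ #(X.cand f S v) := card_le_card sdiff_subset
  have h5 : X.d ^ X.Δ * m ≤ X.d ^ X.Δ * X.base v :=
    mul_le_mul_of_nonneg_left (h.base v hv) (pow_nonneg X.hd0.le _)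
  have h2' : (#((X.opt f S v).filter fun w => w ∈ X.cand f S v) : ℝ) ≤ #(X.opt f S v) := by
    exact_mod_cast h2
  have h4' : (#(X.trk f S v) : ℝ) ≤ #(X.cand f S v) := by exact_mod_cast h4
  linarith

lemma St1.opt_ne (h : X.St1 S₁ m E) {f : V → W} {S : Finset V} (hI : X.Inv f S) (hS : S ⊆ S₁)
    {v : V} (hv : v ∈ S₁) (hvS : v ∉ S) : (X.opt f S v).Nonempty := by
  rw [← card_pos]
  have := lt_of_lt_of_le h.pos (h.opt_big hI hS hv hvS)
  exact_mod_cast this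

lemma St1.opt_inv (h : X.St1 S₁ m E) {f : V → W} {S : Finset V} (hI : X.Inv f S) (hS : S ⊆ S₁)
    {v : V} (hv : v ∈ S₁) (hvS : v ∉ S) {w : W} (hw : w ∈ X.opt f S v) :
    X.Inv (Function.update f v w) (insert v S) := by
  unfold opt at hw
  simp only [mem_sdiff] at hw
  refine X.step hI hvS ?_ hw.1.1 hw.1.2 hw.2
  intro u _ hvu x hx hadj
  have := h.old u x (insert_subset hv hS hx) hadj
  rw [this] at hvu
  simp at hvu

/-- few atypical -/
lemma dns_opt {f : V → W} {S : Finset V} {x : V} {Q : Finset W}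
    (hd : Dns X.G X.e X.d (X.cl (X.φ x)) Q) (C : Finset W) (hC : C ⊆ Q) (he : X.e ≤ #C)
    (T : Finset W) (hT : T ⊆ X.opt f S x) :
    #T - X.e ≤ #(T.filter fun w => X.d * #C ≤ #(C.filter fun y => X.G.Adj w y)) := by
  have h1 := hd C hC he
  have h2 : T ⊆ (T.filter fun w => X.d * #C ≤ #(C.filter fun y => X.G.Adj w y)) ∪
      ((X.cl (X.φ x)).filter fun w => (#(C.filter fun y => X.G.Adj w y) : ℝ) < X.d * #C) := by
    intro w hw
    simp only [mem_union, mem_filter]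
    by_cases h3 : X.d * #C ≤ #(C.filter fun y => X.G.Adj w y)
    · exact Or.inl ⟨hw, h3⟩
    · exact Or.inr ⟨opt_sub f S x (hT hw), not_le.1 h3⟩
  have h3 := (card_le_card h2).trans (card_union_le _ _)
  have h4 : (#T : ℝ) ≤ #(T.filter fun w => X.d * #C ≤ #(C.filter fun y => X.G.Adj w y)) +
      #((X.cl (X.φ x)).filter fun w => (#(C.filter fun y => X.G.Adj w y) : ℝ) < X.d * #C) := by
    exact_mod_cast h3
  linarith

lemma St1.zgadget (h : X.St1 S₁ m E) {f : V → W} {S : Finset V} (hI : X.Inv f S) (hS : S ⊆ S₁)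
    (xs : Finset V) (hxs : xs ⊆ S₁) (hdisj : Disjoint xs S) (hxc : #xs ≤ X.Δ) (hm : 0 ≤ m)
    (Q : Finset ι) (hQ : ∀ q ∈ Q, ∀ x ∈ xs, Dns X.G X.e X.d (X.cl (X.φ x)) (X.cl q))
    (hQm : ∀ q ∈ Q, m ≤ #(X.cl q)) (θ : ℝ) (hθ1 : θ ≤ 1)
    (hθ : X.e ≤ θ * (X.d ^ X.Δ * m - E - X.Δ * X.e)) (hθ0 : 0 ≤ θ) (hem : X.e ≤ X.d ^ X.Δ * m) :
    ∃ f', X.Inv f' (S ∪ xs) ∧ (∀ x ∈ S, f' x = f x) ∧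
      (1 - θ) ^ #xs * #Q ≤ #(Q.filter fun q => X.d ^ X.Δ * m ≤
        #((X.cl q).filter fun w => ∀ x ∈ xs, X.G.Adj (f' x) w)) := by
  obtain ⟨⟨f', T⟩, ⟨hT1, hT2, hT3, hT4⟩, hle⟩ := avgIter (St := (V → W) × Finset V) (W := W) Q (fun _ => 1)
    (fun _ _ => zero_le_one) (1 - θ) (by linarith) #xs
    (fun i s => s.2 ⊆ xs ∧ #s.2 = i ∧ X.Inv s.1 (S ∪ s.2) ∧ ∀ x ∈ S, s.1 x = f x)
    (fun i s q => X.d ^ i * m ≤ #((X.cl q).filter fun w => ∀ x ∈ s.2, X.G.Adj (s.1 x) w))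
    (by
      rintro i hi ⟨f', T⟩ ⟨hT1, hT2, hT3, hT4⟩
      simp only at hT1 hT2 hT3 hT4
      obtain ⟨x, hx, hxT⟩ : ∃ x ∈ xs, x ∉ T := by
        by_contra hcon
        push Not at hcon
        have := card_le_card (show xs ⊆ T from hcon)
        omega
      have hxS : x ∉ S := fun h' => disjoint_left.1 hdisj hx h'
      have hx2 : x ∉ S ∪ T := by simp [hxS, hxT]
      have hST : S ∪ T ⊆ S₁ := union_subset hS (hT1.trans hxs)
      have hup : ∀ y ∈ T, ∀ w, Function.update f' x w y = f' y := fun y hy w => by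
        rw [Function.update_of_ne]; rintro rfl; exact hxT hy
      refine ⟨X.opt f' (S ∪ T) x, fun w => (Function.update f' x w, insert x T),
        h.opt_ne hT3 hST (hxs hx) hx2, ?_, ?_⟩
      · intro w hw
        refine ⟨insert_subset hx hT1, by simp [card_insert_of_notMem hxT, hT2], ?_, ?_⟩
        · have := h.opt_inv hT3 hST (hxs hx) hx2 hw
          simpa [union_insert] using this
        · intro y hy
          simp only
          rw [Function.update_of_ne, hT4 y hy]
          rintro rfl; exact hxS hy
      · intro q hq hal
        simp only at hal
        set C := (X.cl q).filter fun w => ∀ x ∈ T, X.G.Adj (f' x) w with hCdef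
        have hiΔ : i ≤ X.Δ := by omega
        have hCe : X.e ≤ #C := hem.trans (le_trans (mul_le_mul_of_nonneg_right
          (pow_le_pow_of_le_one X.hd0.le X.hd1 hiΔ) hm) hal)
        have h1 := dns_opt (hQ q hq x hx) C (filter_subset _ _) hCe
          (X.opt f' (S ∪ T) x) (Subset.refl _)
        have h2 := h.opt_big hT3 hST (hxs hx) hx2
        have h3 : (#((X.opt f' (S ∪ T) x).filter fun w => X.d * #C ≤ #(C.filter fun y => X.G.Adj w y)) : ℝ)
          ≤ #((X.opt f' (S ∪ T) x).filter fun w => X.d ^ (i+1) * m ≤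
            #((X.cl q).filter fun y => ∀ x' ∈ insert x T, X.G.Adj (Function.update f' x w x') y)) := by
          norm_cast
          apply card_le_card
          intro w hw
          simp only [mem_filter] at hw ⊢
          refine ⟨hw.1, le_trans ?_ (hw.2.trans ?_)⟩
          · rw [pow_succ, mul_comm _ X.d, mul_assoc]
            exact mul_le_mul_of_nonneg_left hal X.hd0.le
          · norm_cast
            apply card_le_card
            intro y hy
            simp only [hCdef, mem_filter] at hy
            refine mem_filter.2 ⟨hy.1.1, ?_⟩
            intro x' hx'
            rcases mem_insert.1 hx' with rfl | hx'
            · simpa using hy.2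
            · rw [hup x' hx']; exact hy.1.2 x' hx'
        refine le_trans ?_ h3
        have h4 : θ * (X.d ^ X.Δ * m - E - X.Δ * X.e) ≤ θ * #(X.opt f' (S ∪ T) x) :=
          mul_le_mul_of_nonneg_left h2 hθ0
        linarith)
    (f, ∅) ⟨by simp, by simp, by simpa using hI, by simp⟩ (by
      intro q hq
      simpa using hQm q hq)
  simp only at hT1 hT2 hT3 hT4
  have hTx : T = xs := eq_of_subset_of_card_le hT1 hT2.ge
  subst hTx
  refine ⟨f', hT3, hT4, ?_⟩
  simp only [sum_const, nsmul_eq_mul, mul_one] at hle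
  refine hle.trans ?_
  norm_cast
  apply card_le_card
  intro q hq
  simp only [mem_filter] at hq ⊢
  exact ⟨hq.1, le_trans (mul_le_mul_of_nonneg_right
          (pow_le_pow_of_le_one X.hd0.le X.hd1 hxc) hm) hq.2⟩

lemma St1.dgadget (h : X.St1 S₁ m E) {f : V → W} {S : Finset V} (hI : X.Inv f S) (hS : S ⊆ S₁)
    (c : V) (xs : Finset V) (hN : ∀ x, x ∈ xs ↔ X.H.Adj c x) (hc : c ∈ S₁) (hcS : c ∉ S)
    (hxs : xs ⊆ S₁) (hdisj : Disjoint xs S) (hm : 0 ≤ m)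
    (hind : ∀ x ∈ xs, ∀ y ∈ S ∪ xs, ¬ X.H.Adj x y)
    {κ : Type*} (K : Finset κ) (ω : κ → ℝ) (hω : ∀ k, 0 ≤ ω k) (nz : κ → Finset W) (nh : κ → W)
    (γ' ρ : ℝ) (hnz : ∀ k ∈ K, nz k ⊆ X.cl (X.φ c)) (hnz2 : ∀ k ∈ K, X.d ^ X.Δ * m ≤ #(nz k))
    (hnh : ∀ k ∈ K, ∀ x ∈ xs, γ' * m ≤ #((X.cl (X.φ x)).filter fun w => X.G.Adj (nh k) w))
    (hρ0 : 0 ≤ ρ) (hρ1 : ρ ≤ 1) (hρa : ρ * m ≤ γ' * m - E - X.Δ * X.e - X.e)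
    (hρb : ρ * m ≤ X.d ^ X.Δ * (X.d ^ X.Δ * m) - E - X.Δ * X.e)
    (hem : X.e ≤ X.d ^ X.Δ * (X.d ^ X.Δ * m)) :
    ∃ f', X.Inv f' (insert c (S ∪ xs)) ∧ (∀ x ∈ S, f' x = f x) ∧
      ρ ^ (X.Δ + 1) * ∑ k ∈ K, ω k ≤
        ∑ k ∈ K.filter (fun k => (∀ x ∈ xs, X.G.Adj (nh k) (f' x)) ∧ f' c ∈ nz k), ω k := by
  have hxc : #xs ≤ X.Δ := by
    refine le_trans (card_le_card ?_) (X.hdeg c)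
    intro x hx
    simpa using (hN x).1 hx
  have hcx : c ∉ xs := fun h' => X.H.irrefl ((hN c).1 h')
  have hdp : 0 ≤ X.d ^ X.Δ := pow_nonneg X.hd0.le _
  obtain ⟨⟨f', T⟩, ⟨hT1, hT2, hT3, hT4⟩, hle⟩ := avgIter (St := (V → W) × Finset V) (W := W) K ω
    (fun k _ => hω k) ρ hρ0 #xs
    (fun i s => s.2 ⊆ xs ∧ #s.2 = i ∧ X.Inv s.1 (S ∪ s.2) ∧ ∀ x ∈ S, s.1 x = f x)
    (fun i s k => (∀ x ∈ s.2, X.G.Adj (nh k) (s.1 x)) ∧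
      X.d ^ i * (X.d ^ X.Δ * m) ≤ #((nz k).filter fun w => ∀ x ∈ s.2, X.G.Adj (s.1 x) w))
    (by
      rintro i hi ⟨f', T⟩ ⟨hT1, hT2, hT3, hT4⟩
      simp only at hT1 hT2 hT3 hT4
      obtain ⟨x, hx, hxT⟩ : ∃ x ∈ xs, x ∉ T := by
        by_contra hcon
        push Not at hcon
        have := card_le_card (show xs ⊆ T from hcon)
        omega
      have hxS : x ∉ S := fun h' => disjoint_left.1 hdisj hx h'
      have hx2 : x ∉ S ∪ T := by simp [hxS, hxT]
      have hST : S ∪ T ⊆ S₁ := union_subset hS (hT1.trans hxs)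
      have hup : ∀ y ∈ T, ∀ w, Function.update f' x w y = f' y := fun y hy w => by
        rw [Function.update_of_ne]; rintro rfl; exact hxT hy
      refine ⟨X.opt f' (S ∪ T) x, fun w => (Function.update f' x w, insert x T),
        h.opt_ne hT3 hST (hxs hx) hx2, ?_, ?_⟩
      · intro w hw
        refine ⟨insert_subset hx hT1, by simp [card_insert_of_notMem hxT, hT2], ?_, ?_⟩
        · have := h.opt_inv hT3 hST (hxs hx) hx2 hw
          simpa [union_insert] using this
        · intro y hy
          simp only
          rw [Function.update_of_ne, hT4 y hy]
          rintro rfl; exact hxS hy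
      · rintro k hk ⟨hal1, hal⟩
        simp only at hal1 hal
        set C := (nz k).filter fun w => ∀ x ∈ T, X.G.Adj (f' x) w with hCdef
        have hiΔ : i ≤ X.Δ := by omega
        have hCe : X.e ≤ #C := hem.trans (le_trans (mul_le_mul_of_nonneg_right
          (pow_le_pow_of_le_one X.hd0.le X.hd1 hiΔ) (mul_nonneg hdp hm)) hal)
        have hcand : X.cand f' (S ∪ T) x = X.cl (X.φ x) := by
          unfold cand
          apply filter_true_of_mem
          intro w _ v hv hxv
          exact absurd hxv (hind x hx v (union_subset_union_right hT1 hv))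
        have h0 := h.opt_card hT3 hST (v := x) ((X.cl (X.φ x)).filter fun w => X.G.Adj (nh k) w)
          (by rw [hcand]; exact filter_subset _ _)
        have h1 := dns_opt (X.hdns x c ((hN x).1 hx).symm) C ((filter_subset _ _).trans (hnz k hk)) hCe
          ((X.opt f' (S ∪ T) x).filter fun w => w ∈ ((X.cl (X.φ x)).filter fun w => X.G.Adj (nh k) w))
          (filter_subset _ _)
        refine le_trans ?_ (le_trans h1 ?_)
        · have h2 := hnh k hk x hx
          have h3 : (#(X.opt f' (S ∪ T) x) : ℝ) ≤ m := by
            refine le_trans ?_ (h.size (X.φ x))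
            exact_mod_cast card_le_card (opt_sub _ _ _)
          have h4 := mul_le_mul_of_nonneg_left h3 hρ0
          linarith
        · norm_cast
          apply card_le_card
          intro w hw
          simp only [mem_filter] at hw ⊢
          refine ⟨hw.1.1, ?_, le_trans ?_ (hw.2.trans ?_)⟩
          · intro x' hx'
            rcases mem_insert.1 hx' with rfl | hx'
            · simpa using hw.1.2.2
            · rw [hup x' hx']; exact hal1 x' hx'
          · rw [pow_succ, mul_comm _ X.d, mul_assoc]
            exact mul_le_mul_of_nonneg_left hal X.hd0.le
          · norm_cast
            apply card_le_card
            intro y hy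
            simp only [hCdef, mem_filter] at hy
            refine mem_filter.2 ⟨hy.1.1, ?_⟩
            intro x' hx'
            rcases mem_insert.1 hx' with rfl | hx'
            · simpa using hy.2
            · rw [hup x' hx']; exact hy.1.2 x' hx')
    (f, ∅) ⟨by simp, by simp, by simpa using hI, by simp⟩ (by
      intro k hk
      simpa using hnz2 k hk)
  simp only at hT1 hT2 hT3 hT4
  have hTx : T = xs := eq_of_subset_of_card_le hT1 hT2.ge
  subst hTx
  have hST : S ∪ T ⊆ S₁ := union_subset hS hxs
  have hcST : c ∉ S ∪ T := by simp [hcS, hcx]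
  set K' := K.filter (fun k => (∀ x ∈ T, X.G.Adj (nh k) (f' x)) ∧
      X.d ^ #T * (X.d ^ X.Δ * m) ≤ #((nz k).filter fun w => ∀ x ∈ T, X.G.Adj (f' x) w)) with hK'
  have hle' : ρ ^ #T * ∑ k ∈ K, ω k ≤ ∑ k ∈ K', ω k := by
    convert hle
  obtain ⟨w, hw, hle2⟩ := avg1 (X.opt f' (S ∪ T) c) (h.opt_ne hT3 hST hc hcST) K' ω
    (fun k _ => hω k) ρ (fun k w => w ∈ nz k) (by
      intro k hk
      simp only [hK', mem_filter] at hk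
      have h0 := h.opt_card hT3 hST (v := c) ((nz k).filter fun w => ∀ x ∈ T, X.G.Adj (f' x) w) (by
        intro w hw
        simp only [mem_filter] at hw
        refine mem_filter.2 ⟨hnz k hk.1 hw.1, ?_⟩
        intro v hv hcv
        exact hw.2 v ((hN v).2 hcv))
      have h3 : (#(X.opt f' (S ∪ T) c) : ℝ) ≤ m := by
        refine le_trans ?_ (h.size (X.φ c))
        exact_mod_cast card_le_card (opt_sub _ _ _)
      have h4 := mul_le_mul_of_nonneg_left h3 hρ0
      have h5 : X.d ^ X.Δ * (X.d ^ X.Δ * m) ≤ X.d ^ #T * (X.d ^ X.Δ * m) :=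
        mul_le_mul_of_nonneg_right (pow_le_pow_of_le_one X.hd0.le X.hd1 hxc) (mul_nonneg hdp hm)
      have h6 : (#((X.opt f' (S ∪ T) c).filter fun w' => w' ∈ (nz k).filter fun w => ∀ x ∈ T, X.G.Adj (f' x) w) : ℝ)
          ≤ #((X.opt f' (S ∪ T) c).filter fun w => w ∈ nz k) := by
        norm_cast
        apply card_le_card
        intro w hw
        simp only [mem_filter] at hw ⊢
        exact ⟨hw.1, hw.2.1⟩
      have h7 : X.d ^ #T * (X.d ^ X.Δ * m) ≤ #((nz k).filter fun w => ∀ x ∈ T, X.G.Adj (f' x) w) := by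
        convert hk.2.2
      have h9 := h5.trans h7
      have h10 := (le_trans (by linarith) h0 : ρ * m ≤ _).trans (by convert h6)
      refine h4.trans (h10.trans (le_of_eq ?_))
      congr!)
  have hup : ∀ y ∈ S ∪ T, Function.update f' c w y = f' y := fun y hy => by
    rw [Function.update_of_ne]; rintro rfl; exact hcST hy
  refine ⟨Function.update f' c w, h.opt_inv hT3 hST hc hcST hw, ?_, ?_⟩
  · intro x hx
    rw [hup x (mem_union_left _ hx), hT4 x hx]
  · have hsn : 0 ≤ ∑ k ∈ K, ω k := sum_nonneg fun k _ => hω k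
    calc ρ ^ (X.Δ + 1) * ∑ k ∈ K, ω k ≤ ρ ^ (#T + 1) * ∑ k ∈ K, ω k :=
          mul_le_mul_of_nonneg_right (pow_le_pow_of_le_one hρ0 hρ1 (by omega)) hsn
      _ = ρ * (ρ ^ #T * ∑ k ∈ K, ω k) := by ring
      _ ≤ ρ * ∑ k ∈ K', ω k := mul_le_mul_of_nonneg_left hle' hρ0
      _ ≤ _ := hle2
      _ ≤ _ := by
        apply sum_le_sum_of_subset_of_nonneg
        · intro k hk
          simp only [hK', mem_filter] at hk
          refine mem_filter.2 ⟨hk.1.1, ?_, by simpa using hk.2⟩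
          intro x hx
          rw [hup x (mem_union_right _ hx)]
          exact hk.1.2.1 x hx
        · intro k _ _
          exact hω k

end Ctx
end BW
end

section
namespace BW
open Finset
open scoped Classical
variable {V W ι : Type*} [Fintype V] [DecidableEq ι]
namespace Ctx
variable (X : Ctx V W ι)

noncomputable def N (c : V) : Finset V := univ.filter fun x => X.H.Adj c x

lemma mem_N (c x : V) : x ∈ X.N c ↔ X.H.Adj c x := by simp [N]

lemma Inv.congr {X : Ctx V W ι} {f f' : V → W} {S S' : Finset V} (h : X.Inv f S) (hS : S = S') (hf : f = f') :
    X.Inv f' S' := by subst hS; subst hf; exact h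

/-- closed neighbourhoods of distinct centres are disjoint and non adjacent -/
def Far (H : SimpleGraph V) (F : Finset V) : Prop :=
  ∀ c ∈ F, ∀ c' ∈ F, c ≠ c' → ∀ x y, (x = c ∨ H.Adj c x) → (y = c' ∨ H.Adj c' y) →
    x ≠ y ∧ ¬ H.Adj x y

variable {X} {m E : ℝ}

lemma St1.stage1 {Z D : Finset V} (hZD : Disjoint Z D)
    (h : X.St1 (Z.biUnion X.N ∪ D.biUnion fun c => insert c (X.N c)) m E) (hm : 0 ≤ m)
    (hfar : Far X.H (Z ∪ D)) (htri : ∀ c x y, X.H.Adj c x → X.H.Adj c y → ¬ X.H.Adj x y)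
    (Q : V → Finset ι)
    (hQ : ∀ z ∈ Z, ∀ q ∈ Q z, ∀ x ∈ X.N z, Dns X.G X.e X.d (X.cl (X.φ x)) (X.cl q))
    (hQm : ∀ i, m ≤ #(X.cl i)) (θ : ℝ) (hθ1 : θ ≤ 1)
    (hθ : X.e ≤ θ * (X.d ^ X.Δ * m - E - X.Δ * X.e)) (hθ0 : 0 ≤ θ)
    (γ' ρ : ℝ) (hρ0 : 0 < ρ) (hρ1 : ρ ≤ 1) (hρa : ρ * m ≤ γ' * m - E - X.Δ * X.e - X.e)
    (hρb : ρ * m ≤ X.d ^ X.Δ * (X.d ^ X.Δ * m) - E - X.Δ * X.e)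
    (hem : X.e ≤ X.d ^ X.Δ * (X.d ^ X.Δ * m))
    (K : Finset (W × V)) (hK : ∀ k ∈ K, k.2 ∈ Z) (f₀ : V → W) :
    ∃ f, X.Inv f (Z.biUnion X.N ∪ D.biUnion fun c => insert c (X.N c)) ∧ ∃ al : V → Finset ι,
      (∀ z ∈ Z, al z ⊆ Q z ∧ (1 - θ) ^ X.Δ * #(Q z) ≤ #(al z)) ∧
      ∀ k ∈ K, 1 ≤ (#K : ℝ) * 2 ^ #(D.filter fun c => (∀ x ∈ X.N c, X.G.Adj k.1 (f x)) ∧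
          ∀ x ∈ X.N k.2, X.G.Adj (f x) (f c)) *
        (1 - ρ ^ (X.Δ + 1) / 2) ^ #(D.filter fun c => X.φ c ∈ al k.2 ∧
          ∀ x ∈ X.N c, γ' * m ≤ #((X.cl (X.φ x)).filter fun w => X.G.Adj k.1 w)) := by
  have hNc : ∀ v, #(X.N v) ≤ X.Δ := fun v => X.hdeg v
  have hem' : X.e ≤ X.d ^ X.Δ * m := hem.trans (mul_le_of_le_one_left
    (mul_nonneg (pow_nonneg X.hd0.le _) hm) (pow_le_one₀ X.hd0.le X.hd1))
  -- phase 1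
  have ph1 : ∀ Z' ⊆ Z, ∃ f, X.Inv f (Z'.biUnion X.N) ∧ ∀ z ∈ Z', (1 - θ) ^ X.Δ * #(Q z) ≤
      #((Q z).filter fun q => X.d ^ X.Δ * m ≤
        #((X.cl q).filter fun w => ∀ x ∈ X.N z, X.G.Adj (f x) w)) := by
    intro Z' hZ'
    induction Z' using Finset.induction_on with
    | empty => exact ⟨f₀, by simpa using X.inv_empty f₀, by simp⟩
    | insert z Z' hz ih =>
      obtain ⟨f, hf, hal⟩ := ih ((subset_insert _ _).trans hZ')
      have hzZ : z ∈ Z := hZ' (mem_insert_self _ _)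
      have hsub : Z'.biUnion X.N ⊆ (Z.biUnion X.N ∪ D.biUnion fun c => insert c (X.N c)) :=
        (biUnion_subset_biUnion_of_subset_left _ ((subset_insert _ _).trans hZ')).trans subset_union_left
      obtain ⟨f', hf', hag, hc⟩ := h.zgadget hf hsub (X.N z)
        ((subset_biUnion_of_mem X.N hzZ).trans subset_union_left) (by
          rw [disjoint_left]
          intro x hx hx2
          obtain ⟨z', hz', hxz'⟩ := mem_biUnion.1 hx2
          have hne : z ≠ z' := by rintro rfl; exact hz hz'
          exact (hfar z (mem_union_left _ hzZ) z' (mem_union_left _ (hZ' (mem_insert_of_mem hz'))) hne x x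
            (Or.inr ((X.mem_N _ _).1 hx)) (Or.inr ((X.mem_N _ _).1 hxz'))).1 rfl)
        (hNc z) hm (Q z) (hQ z hzZ) (fun q _ => hQm q) θ hθ1 hθ hθ0 hem'
      refine ⟨f', hf'.congr (by rw [biUnion_insert, union_comm]) rfl, ?_⟩
      intro z' hz'
      rcases mem_insert.1 hz' with rfl | hz'
      · refine le_trans ?_ hc
        exact mul_le_mul_of_nonneg_right (pow_le_pow_of_le_one (by linarith) (by linarith) (hNc z'))
          (Nat.cast_nonneg _)
      · have hfe : ∀ x ∈ X.N z', f' x = f x := fun x hx => hag x (mem_biUnion.2 ⟨z', hz', hx⟩)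
        refine (hal z' hz').trans (le_of_eq ?_)
        congr 2
        apply filter_congr
        intro q _
        have : ((X.cl q).filter fun w => ∀ x ∈ X.N z', X.G.Adj (f x) w) =
            ((X.cl q).filter fun w => ∀ x ∈ X.N z', X.G.Adj (f' x) w) := by
          apply filter_congr
          intro w _
          constructor
          · intro h1 x hx; rw [hfe x hx]; exact h1 x hx
          · intro h1 x hx; rw [← hfe x hx]; exact h1 x hx
        rw [this]
  obtain ⟨fz, hfz, hal⟩ := ph1 Z (Subset.refl _)
  set al : V → Finset ι := fun z => (Q z).filter fun q => X.d ^ X.Δ * m ≤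
        #((X.cl q).filter fun w => ∀ x ∈ X.N z, X.G.Adj (fz x) w) with haldef
  obtain ⟨f, ⟨hf, _⟩, hpot⟩ := potential (St := V → W) K (ρ ^ (X.Δ + 1)) (by positivity) (pow_le_one₀ hρ0.le hρ1) D
    (fun c k => X.φ c ∈ al k.2 ∧
          ∀ x ∈ X.N c, γ' * m ≤ #((X.cl (X.φ x)).filter fun w => X.G.Adj k.1 w))
    (fun c k f => ((∀ x ∈ X.N c, X.G.Adj k.1 (f x)) ∧ ∀ x ∈ X.N k.2, X.G.Adj (f x) (f c)) ∧ k ∈ K)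
    (fun D' f => X.Inv f (Z.biUnion X.N ∪ D'.biUnion fun c => insert c (X.N c)) ∧
      ∀ x ∈ Z.biUnion X.N, f x = fz x)
    (by
      rintro D' hD' c hc hcD' f ⟨hf, hfz'⟩ ω hω
      have hsub : (Z.biUnion X.N ∪ D'.biUnion fun c => insert c (X.N c)) ⊆
        (Z.biUnion X.N ∪ D.biUnion fun c => insert c (X.N c)) :=
        union_subset_union_right (biUnion_subset_biUnion_of_subset_left _ hD')
      have hcF : c ∈ Z ∪ D := mem_union_right _ hc
      have hfarS : ∀ x, (x = c ∨ X.H.Adj c x) → ∀ y ∈ (Z.biUnion X.N ∪ D'.biUnion fun c => insert c (X.N c)),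
          x ≠ y ∧ ¬ X.H.Adj x y := by
        intro x hx y hy
        rcases mem_union.1 hy with hy | hy
        · obtain ⟨z, hz, hyz⟩ := mem_biUnion.1 hy
          exact hfar c hcF z (mem_union_left _ hz) (by rintro rfl; exact disjoint_left.1 hZD hz hc) x y hx
            (Or.inr ((X.mem_N _ _).1 hyz))
        · obtain ⟨z, hz, hyz⟩ := mem_biUnion.1 hy
          refine hfar c hcF z (mem_union_right _ (hD' hz)) (by rintro rfl; exact hcD' hz) x y hx ?_
          rcases mem_insert.1 hyz with h1 | h1
          · exact Or.inl h1
          · exact Or.inr ((X.mem_N _ _).1 h1)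
      have hcS₁ : insert c (X.N c) ⊆ (Z.biUnion X.N ∪ D.biUnion fun c => insert c (X.N c)) :=
        (subset_biUnion_of_mem (fun c => insert c (X.N c)) hc).trans subset_union_right
      obtain ⟨f', hf', hag, hle⟩ := h.dgadget hf hsub c (X.N c) (X.mem_N c)
        (hcS₁ (mem_insert_self _ _)) (fun h' => (hfarS c (Or.inl rfl) c h').1 rfl)
        ((subset_insert _ _).trans hcS₁)
        (by
          rw [disjoint_left]
          intro x hx hx2
          exact (hfarS x (Or.inr ((X.mem_N _ _).1 hx)) x hx2).1 rfl) hm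
        (by
          intro x hx y hy
          rcases mem_union.1 hy with hy | hy
          · exact (hfarS x (Or.inr ((X.mem_N _ _).1 hx)) y hy).2
          · exact htri c x y ((X.mem_N _ _).1 hx) ((X.mem_N _ _).1 hy))
        (K.filter fun k => X.φ c ∈ al k.2 ∧
          ∀ x ∈ X.N c, γ' * m ≤ #((X.cl (X.φ x)).filter fun w => X.G.Adj k.1 w)) ω hω
        (fun k => (X.cl (X.φ c)).filter fun w => ∀ x ∈ X.N k.2, X.G.Adj (fz x) w) (fun k => k.1) γ' ρ
        (fun k _ => filter_subset _ _)
        (by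
          intro k hk
          have h1 := (mem_filter.1 hk).2.1
          simp only [haldef, mem_filter] at h1
          exact h1.2)
        (fun k hk => (mem_filter.1 hk).2.2) hρ0.le hρ1 hρa hρb hem
      have hagz : ∀ x ∈ Z.biUnion X.N, f' x = fz x := fun x hx => by
        rw [hag x (mem_union_left _ hx), hfz' x hx]
      refine ⟨f', ⟨hf'.congr ?_ rfl, hagz⟩, ?_, ?_⟩
      · rw [biUnion_insert]
        ext y; simp only [mem_insert, mem_union]; tauto
      · rintro c' hc' k ⟨⟨h1, h2⟩, hkK⟩
        have hcc : ∀ x ∈ insert c' (X.N c'), f' x = f x := fun x hx =>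
          hag x (mem_union_right _ (mem_biUnion.2 ⟨c', hc', hx⟩))
        refine ⟨⟨fun x hx => ?_, fun x hx => ?_⟩, hkK⟩
        · rw [hcc x (mem_insert_of_mem hx)]; exact h1 x hx
        · rw [hcc c' (mem_insert_self _ _), hag x (mem_union_left _ (mem_biUnion.2 ⟨k.2, hK k hkK, hx⟩))]
          exact h2 x hx
      · refine le_trans (le_of_eq (by congr!)) (hle.trans ?_)
        apply sum_le_sum_of_subset_of_nonneg
        · intro k hk
          simp only [mem_filter] at hk ⊢
          refine ⟨hk.1.1, hk.1.2, ⟨hk.2.1, ?_⟩, hk.1.1⟩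
          intro x hx
          rw [hagz x (mem_biUnion.2 ⟨k.2, hK k hk.1.1, hx⟩)]
          exact hk.2.2.2 x hx
        · intro k _ _; exact hω k)
    fz ⟨by simpa using hfz, fun _ _ => rfl⟩
  refine ⟨f, hf, al, fun z hz => ⟨filter_subset _ _, hal z hz⟩, fun k hk => ?_⟩
  have h1 := hpot k hk
  simp only [hk, and_true] at h1
  convert h1

end Ctx

lemma finish {V W : Type*} [Fintype V] (H : SimpleGraph V) (G : SimpleGraph W) (Z D : Finset V)
    (hZD : Disjoint Z D) (hfar : Ctx.Far H (Z ∪ D)) (f : V → W)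
    (hinj : ∀ u v, u ∉ Z → v ∉ Z → f u = f v → u = v)
    (hadj : ∀ u v, u ∉ Z → v ∉ Z → H.Adj u v → G.Adj (f u) (f v))
    (π : V → W) (hπ : ∀ u ∈ Z, ∀ v ∈ Z, π u = π v → u = v) (hπf : ∀ z ∈ Z, ∀ v, v ∉ Z → f v ≠ π z)
    (hgood : ∀ z ∈ Z, #Z ≤ #(D.filter fun c => (∀ x, H.Adj c x → G.Adj (π z) (f x)) ∧
      ∀ x, H.Adj z x → G.Adj (f x) (f c))) :
    ∃ g : H →g G, Function.Injective g := by
  obtain ⟨c, hcinj, hc⟩ : ∃ c : Z → V, Function.Injective c ∧ ∀ z : Z, c z ∈ D.filter fun c =>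
      (∀ x, H.Adj c x → G.Adj (π z) (f x)) ∧ ∀ x, H.Adj z x → G.Adj (f x) (f c) := by
    apply (Finset.all_card_le_biUnion_card_iff_exists_injective _).1
    intro s
    rcases s.eq_empty_or_nonempty with rfl | ⟨z, hz⟩
    · simp
    · refine le_trans ?_ (le_trans (hgood z z.2) (card_le_card (subset_biUnion_of_mem
        (fun z : Z => D.filter fun c => (∀ x, H.Adj c x → G.Adj (π z) (f x)) ∧
          ∀ x, H.Adj z x → G.Adj (f x) (f c)) hz)))
      have := card_le_univ s
      simpa using this
  have hcD : ∀ z, c z ∈ D := fun z => (mem_filter.1 (hc z)).1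
  have hcZ : ∀ z, c z ∉ Z := fun z h => disjoint_left.1 hZD h (hcD z)
  have hc1 : ∀ z : Z, ∀ x, H.Adj (c z) x → G.Adj (π z) (f x) := fun z => (mem_filter.1 (hc z)).2.1
  have hc2 : ∀ z : Z, ∀ x, H.Adj z x → G.Adj (f x) (f (c z)) := fun z => (mem_filter.1 (hc z)).2.2
  -- far facts
  have hF : ∀ a ∈ Z ∪ D, ∀ b ∈ Z ∪ D, ¬ H.Adj a b := by
    intro a ha b hb hab
    exact (hfar a ha b hb hab.ne a b (Or.inl rfl) (Or.inl rfl)).2 hab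
  set g : V → W := fun v => if hv : v ∈ Z then f (c ⟨v, hv⟩) else
    if hd : ∃ z : Z, c z = v then π hd.choose else f v with hg
  have gZ : ∀ z : Z, g z = f (c z) := fun z => by simp [hg]
  have gD : ∀ z : Z, g (c z) = π z := fun z => by
    have hd : ∃ z' : Z, c z' = c z := ⟨z, rfl⟩
    have : hd.choose = z := hcinj hd.choose_spec
    simp only [hg, hcZ z, dif_neg, not_false_eq_true]
    rw [dif_pos hd, this]
  have gO : ∀ v, v ∉ Z → (¬ ∃ z : Z, c z = v) → g v = f v := fun v h1 h2 => by
    simp only [hg, h1, h2, dif_neg, not_false_eq_true]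
  have tri : ∀ v : V, (∃ z : Z, v = z) ∨ (∃ z : Z, v = c z) ∨ (v ∉ Z ∧ ¬ ∃ z : Z, c z = v) := by
    intro v
    by_cases h1 : v ∈ Z
    · exact Or.inl ⟨⟨v, h1⟩, rfl⟩
    · by_cases h2 : ∃ z : Z, c z = v
      · obtain ⟨z, hz⟩ := h2
        exact Or.inr (Or.inl ⟨z, hz.symm⟩)
      · exact Or.inr (Or.inr ⟨h1, h2⟩)
  have zF : ∀ z : Z, (z : V) ∈ Z ∪ D := fun z => mem_union_left _ z.2
  have cF : ∀ z : Z, c z ∈ Z ∪ D := fun z => mem_union_right _ (hcD z)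
  have gadj : ∀ u v, H.Adj u v → G.Adj (g u) (g v) := by
    have half : ∀ u v, H.Adj u v → (u ∈ Z ∨ ∃ z : Z, c z = u) → G.Adj (g u) (g v) := by
      intro u v huv hu
      have hvo : v ∉ Z ∧ ¬ ∃ z : Z, c z = v := by
        constructor
        · intro hv
          rcases hu with hu | ⟨z, rfl⟩
          · exact hF u (mem_union_left _ hu) v (mem_union_left _ hv) huv
          · exact hF _ (cF z) v (mem_union_left _ hv) huv
        · rintro ⟨z', rfl⟩
          rcases hu with hu | ⟨z, rfl⟩
          · exact hF u (mem_union_left _ hu) _ (cF z') huv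
          · exact hF _ (cF z) _ (cF z') huv
      rw [gO v hvo.1 hvo.2]
      rcases hu with hu | ⟨z, rfl⟩
      · have := gZ ⟨u, hu⟩
        simp only at this
        rw [this]
        exact (hc2 ⟨u, hu⟩ v huv).symm
      · rw [gD z]
        exact hc1 z v huv
    intro u v huv
    by_cases hu : u ∈ Z ∨ ∃ z : Z, c z = u
    · exact half u v huv hu
    by_cases hv : v ∈ Z ∨ ∃ z : Z, c z = v
    · exact (half v u huv.symm hv).symm
    push Not at hu hv
    rw [gO u hu.1 (by push Not; exact hu.2), gO v hv.1 (by push Not; exact hv.2)]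
    exact hadj u v hu.1 hv.1 huv
  refine ⟨⟨g, fun {u v} => gadj u v⟩, ?_⟩
  intro u v huv
  change g u = g v at huv
  rcases tri u with ⟨z, rfl⟩ | ⟨z, rfl⟩ | ⟨h1, h2⟩ <;> rcases tri v with ⟨z', rfl⟩ | ⟨z', rfl⟩ | ⟨h1', h2'⟩
  · rw [gZ, gZ] at huv
    rw [hcinj (hinj _ _ (hcZ z) (hcZ z') huv)]
  · rw [gZ, gD] at huv
    exact absurd huv (hπf z' z'.2 _ (hcZ z))
  · rw [gZ, gO v h1' h2'] at huv
    exact absurd ⟨z, hinj _ _ (hcZ z) h1' huv⟩ h2'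
  · rw [gZ, gD] at huv
    exact absurd huv.symm (hπf z z.2 _ (hcZ z'))
  · rw [gD, gD] at huv
    rw [Subtype.ext (hπ z z.2 z' z'.2 huv)]
  · rw [gD, gO v h1' h2'] at huv
    exact absurd huv.symm (hπf z z.2 _ h1')
  · rw [gZ, gO u h1 h2] at huv
    exact absurd ⟨z', (hinj _ _ h1 (hcZ z') huv).symm⟩ h2
  · rw [gD, gO u h1 h2] at huv
    exact absurd huv (hπf z' z'.2 _ h1)
  · rw [gO u h1 h2, gO v h1' h2'] at huv
    exact hinj _ _ h1 h1' huv

/-- the leftover bijection -/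
lemma leftover {V W : Type*} [Fintype V] [Fintype W] (sV : V → Bool) (sW : W → Bool)
    (hcard : ∀ s, #(univ.filter fun v => sV v = s) = #(univ.filter fun w => sW w = s))
    (Z : Finset V) (f : V → W) (hinj : ∀ u v, u ∉ Z → v ∉ Z → f u = f v → u = v)
    (hs : ∀ v, v ∉ Z → sW (f v) = sV v) :
    ∃ π : V → W, (∀ u ∈ Z, ∀ v ∈ Z, π u = π v → u = v) ∧ (∀ z ∈ Z, ∀ v, v ∉ Z → f v ≠ π z) ∧
      ∀ z ∈ Z, sW (π z) = sV z := by
  let ZZ : Bool → Finset V := fun s => Z.filter fun v => sV v = s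
  let MM : Bool → Finset V := fun s => univ.filter fun v => v ∉ Z ∧ sV v = s
  let LL : Bool → Finset W := fun s => (univ.filter fun w => sW w = s) \ (MM s).image f
  have hc : ∀ s, #(ZZ s) = #(LL s) := by
    intro s
    have h1 : #((MM s).image f) = #(MM s) := by
      apply card_image_of_injOn
      intro u hu v hv huv
      simp only [MM, coe_filter, mem_univ, true_and, Set.mem_ofPred_eq] at hu hv
      exact hinj u v hu.1 hv.1 huv
    have h2 : (MM s).image f ⊆ (univ.filter fun w => sW w = s) := by
      intro w hw
      obtain ⟨v, hv, rfl⟩ := mem_image.1 hw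
      simp only [MM, mem_filter, mem_univ, true_and] at hv ⊢
      rw [hs v hv.1, hv.2]
    have h3 : #(LL s) = #(univ.filter fun w => sW w = s) - #((MM s).image f) :=
      card_sdiff_of_subset h2
    have h4 : #(univ.filter fun v => sV v = s) = #(ZZ s) + #(MM s) := by
      rw [← card_union_of_disjoint]
      · congr 1
        ext v
        simp only [ZZ, MM, mem_filter, mem_univ, true_and, mem_union]
        tauto
      · rw [disjoint_left]
        intro v hv hv2
        simp only [ZZ, MM, mem_filter, mem_univ, true_and] at hv hv2
        exact hv2.1 hv.1
    have h5 := hcard s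
    omega
  let eq : ∀ s, ZZ s ≃ LL s := fun s => Finset.equivOfCardEq (hc s)
  have hmem : ∀ v ∈ Z, v ∈ ZZ (sV v) := fun v hv => mem_filter.2 ⟨hv, rfl⟩
  have hsp : ∀ s (x : LL s), sW x = s := fun s x => (mem_filter.1 (mem_sdiff.1 x.2).1).2
  let π : V → W := fun v => if hv : v ∈ Z then (eq (sV v) ⟨v, hmem v hv⟩ : W) else f v
  have hπ : ∀ v (hv : v ∈ Z), π v = eq (sV v) ⟨v, hmem v hv⟩ := fun v hv => by simp only [π, hv, dif_pos]
  refine ⟨π, ?_, ?_, ?_⟩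
  · intro u hu v hv huv
    rw [hπ u hu, hπ v hv] at huv
    have h1 : sV u = sV v := by
      rw [← hsp _ (eq (sV u) ⟨u, hmem u hu⟩), huv, hsp]
    have key : ∀ s t (a : ZZ s) (b : ZZ t), s = t → (eq s a : W) = eq t b → (a : V) = b := by
      rintro s t a b rfl hab
      rw [(eq s).injective (Subtype.ext hab)]
    exact key _ _ ⟨u, hmem u hu⟩ ⟨v, hmem v hv⟩ h1 huv
  · intro z hz v hv hfv
    rw [hπ z hz] at hfv
    have h1 := (mem_sdiff.1 (eq (sV z) ⟨z, hmem z hz⟩).2).2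
    apply h1
    refine mem_image.2 ⟨v, mem_filter.2 ⟨mem_univ _, hv, ?_⟩, hfv⟩
    rw [← hs v hv, hfv, hsp]
  · intro z hz
    rw [hπ z hz, hsp]

end BW
end

section
namespace BW
open Finset
open scoped Classical
variable {V W ι : Type*} [Fintype V] [Fintype W] [DecidableEq ι]

lemma core (X : Ctx V W ι) (sV : V → Bool) (sW : W → Bool) (sι : ι → Bool)
    (hcard : ∀ s, #(univ.filter fun v => sV v = s) = #(univ.filter fun w => sW w = s))
    (hsφ : ∀ v, sι (X.φ v) = sV v) (hscl : ∀ i, ∀ w ∈ X.cl i, sW w = sι i)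
    (hbip : ∀ u v, X.H.Adj u v → sV u ≠ sV v)
    {Z D : Finset V} (hZD : Disjoint Z D) {m E : ℝ}
    (h : X.St1 (Z.biUnion X.N ∪ D.biUnion fun c => insert c (X.N c)) m E) (hm : 0 ≤ m)
    (hfar : Ctx.Far X.H (Z ∪ D))
    (Q : V → Finset ι)
    (hQ : ∀ z ∈ Z, ∀ q ∈ Q z, ∀ x ∈ X.N z, Dns X.G X.e X.d (X.cl (X.φ x)) (X.cl q))
    (hQm : ∀ i, m ≤ #(X.cl i)) (θ : ℝ) (hθ1 : θ ≤ 1)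
    (hθ : X.e ≤ θ * (X.d ^ X.Δ * m - E - X.Δ * X.e)) (hθ0 : 0 ≤ θ)
    (γ' ρ : ℝ) (hρ0 : 0 < ρ) (hρ1 : ρ ≤ 1) (hρa : ρ * m ≤ γ' * m - E - X.Δ * X.e - X.e)
    (hρb : ρ * m ≤ X.d ^ X.Δ * (X.d ^ X.Δ * m) - E - X.Δ * X.e)
    (hem : X.e ≤ X.d ^ X.Δ * (X.d ^ X.Δ * m)) (f₀ : V → W)
    (τ : V → ℕ) (b : ℕ)
    (hold : ∀ u v, v ∈ X.old u → τ v + b < τ u)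
    (hedge : ∀ u v, X.H.Adj u v → τ u ≤ τ v + b)
    (hrec : ∀ u, u ∉ Z → X.Δ * X.e + #((univ \ Z).filter fun v => v ∉ X.old u ∧ X.φ v = X.φ u ∧ v ≠ u ∧
        (v ∈ (Z.biUnion X.N ∪ D.biUnion fun c => insert c (X.N c)) ∨ τ v ≤ τ u)) < X.d ^ X.Δ * X.base u)
    (r₀ : ℕ) (hr : ∀ hh : W, ∀ z ∈ Z, sW hh = sV z → ∀ al ⊆ Q z, (1 - θ) ^ X.Δ * #(Q z) ≤ #al →
      r₀ ≤ #(D.filter fun c => X.φ c ∈ al ∧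
          ∀ x ∈ X.N c, γ' * m ≤ #((X.cl (X.φ x)).filter fun w => X.G.Adj hh w)))
    (hnum : (Fintype.card W * Fintype.card V : ℝ) * 2 ^ #Z * (1 - ρ ^ (X.Δ + 1) / 2) ^ r₀ < 1) :
    ∃ g : X.H →g X.G, Function.Injective g := by
  have htri : ∀ c x y, X.H.Adj c x → X.H.Adj c y → ¬ X.H.Adj x y := by
    intro c x y h1 h2 h3
    have a1 := hbip _ _ h1
    have a2 := hbip _ _ h2
    have a3 := hbip _ _ h3
    cases hc : sV c <;> cases hx : sV x <;> cases hy : sV y <;> simp_all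
  set S₁ := (Z.biUnion X.N ∪ D.biUnion fun c => insert c (X.N c)) with hS₁
  set K : Finset (W × V) := univ.filter fun k => k.2 ∈ Z ∧ sW k.1 = sV k.2 with hKdef
  obtain ⟨f, hf, al, hal, hpot⟩ := h.stage1 hZD hm hfar htri Q hQ hQm θ hθ1 hθ hθ0 γ' ρ hρ0 hρ1 hρa hρb hem K
    (fun k hk => by simp [hKdef] at hk; exact hk.1) f₀
  have hS₁Z : S₁ ⊆ univ \ Z := by
    intro x hx
    simp only [mem_sdiff, mem_univ, true_and]
    intro hxZ
    have hxF : x ∈ Z ∪ D := mem_union_left _ hxZ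
    rcases mem_union.1 hx with hx | hx
    · obtain ⟨z, hz, hxz⟩ := mem_biUnion.1 hx
      rw [X.mem_N] at hxz
      exact (hfar z (mem_union_left _ hz) x hxF hxz.ne z x (Or.inl rfl) (Or.inl rfl)).2 hxz
    · obtain ⟨c, hc, hxc⟩ := mem_biUnion.1 hx
      rcases mem_insert.1 hxc with rfl | hxc
      · exact disjoint_left.1 hZD hxZ hc
      · rw [X.mem_N] at hxc
        exact (hfar c (mem_union_right _ hc) x hxF hxc.ne c x (Or.inl rfl) (Or.inl rfl)).2 hxc
  obtain ⟨f', hf', hag⟩ := X.stage2 τ b (univ \ Z) S₁ hold hedge h.old (by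
    intro u hu
    have := hrec u (by simpa using hu)
    convert this) f S₁ (Subset.refl _) hS₁Z hf
    (fun x hx hx1 => absurd hx hx1)
  have hmemM : ∀ v, v ∉ Z → v ∈ univ \ Z := fun v hv => by simp [hv]
  have hinj' : ∀ u v, u ∉ Z → v ∉ Z → f' u = f' v → u = v := fun u v hu hv huv =>
    hf'.inj (mem_coe.2 (hmemM u hu)) (mem_coe.2 (hmemM v hv)) huv
  obtain ⟨π, hπ1, hπ2, hπ3⟩ := leftover sV sW hcard Z f' hinj' (fun v hv => by
    rw [hscl _ _ (hf'.mem v (hmemM v hv)), hsφ])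
  refine finish X.H X.G Z D hZD hfar f' hinj' (fun u v hu hv huv =>
    hf'.adj u (hmemM u hu) v (hmemM v hv) huv) π hπ1 hπ2 ?_
  intro z hz
  have hk : (π z, z) ∈ K := by simp [hKdef, hz, hπ3 z hz]
  have h1 := hpot _ hk
  simp only at h1
  set g₀ := D.filter fun c => (∀ x ∈ X.N c, X.G.Adj (π z) (f x)) ∧
          ∀ x ∈ X.N z, X.G.Adj (f x) (f c) with hg₀
  have hgg : g₀ ⊆ D.filter fun c => (∀ x, X.H.Adj c x → X.G.Adj (π z) (f' x)) ∧
      ∀ x, X.H.Adj z x → X.G.Adj (f' x) (f' c) := by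
    intro c hc
    simp only [hg₀, mem_filter] at hc
    refine mem_filter.2 ⟨hc.1, ?_, ?_⟩
    · intro x hx
      have hx' := (X.mem_N c x).2 hx
      rw [hag x (mem_union_right _ (mem_biUnion.2 ⟨c, hc.1, mem_insert_of_mem hx'⟩))]
      exact hc.2.1 x hx'
    · intro x hx
      have hx' := (X.mem_N z x).2 hx
      rw [hag x (mem_union_left _ (mem_biUnion.2 ⟨z, hz, hx'⟩)),
        hag c (mem_union_right _ (mem_biUnion.2 ⟨c, hc.1, mem_insert_self _ _⟩))]
      exact hc.2.2 x hx'
  refine le_trans ?_ (card_le_card hgg)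
  by_contra hlt
  push Not at hlt
  have h2 := hr (π z) z hz (hπ3 z hz) (al z) (hal z hz).1 (hal z hz).2
  have hρ2 : 0 ≤ 1 - ρ ^ (X.Δ + 1) / 2 := by
    have := pow_le_one₀ hρ0.le hρ1 (n := X.Δ + 1)
    linarith
  have hρ3 : 1 - ρ ^ (X.Δ + 1) / 2 ≤ 1 := by
    have := pow_pos hρ0 (X.Δ + 1)
    linarith
  have hKc : (#K : ℝ) ≤ Fintype.card W * Fintype.card V := by
    have := card_le_univ K
    rw [Fintype.card_prod] at this
    exact_mod_cast this
  have a1 : (2:ℝ) ^ #g₀ ≤ 2 ^ #Z := pow_le_pow_right₀ (by norm_num) hlt.le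
  have a2 := pow_le_pow_of_le_one hρ2 hρ3 h2
  have : (1:ℝ) ≤ (Fintype.card W * Fintype.card V : ℝ) * 2 ^ #Z * (1 - ρ ^ (X.Δ + 1) / 2) ^ r₀ := by
    refine h1.trans ?_
    apply mul_le_mul _ _ (by positivity) (by positivity)
    · exact mul_le_mul hKc a1 (by positivity) (by positivity)
    · exact a2
  linarith

end BW
end

section
namespace BW
open Finset
open scoped Classical

lemma balance_aux {C : Type*} [Fintype C] (k : ℕ) (hk : 0 < k) (U : ℝ) (u : C → ℕ → ℝ)
    (hu0 : ∀ c s, 0 ≤ u c s) (huU : ∀ c s, u c s ≤ U) (S : ℕ) :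
    ∃ σ : ℕ → Fin k, ∑ c, ∑ i, ((∑ s ∈ range S, if σ s = i then u c s else 0)
      - (∑ s ∈ range S, u c s) / k) ^ 2 ≤ Fintype.card C * S * U ^ 2 := by
  have : Nonempty (Fin k) := ⟨⟨0, hk⟩⟩
  have hk' : (0:ℝ) < k := by exact_mod_cast hk
  induction S with
  | zero => exact ⟨fun _ => ⟨0, hk⟩, by simp⟩
  | succ S ih =>
    obtain ⟨σ, hσ⟩ := ih
    set dev : C → Fin k → ℝ := fun c i => (∑ s ∈ range S, if σ s = i then u c s else 0)
      - (∑ s ∈ range S, u c s) / k with hdev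
    have hdev0 : ∀ c, ∑ i, dev c i = 0 := by
      intro c
      simp only [hdev, sum_sub_distrib]
      rw [sum_comm]
      simp only [sum_ite_eq, mem_univ, if_true, sum_const, card_univ, Fintype.card_fin, nsmul_eq_mul]
      field_simp
      ring
    obtain ⟨i0, _, hi0⟩ : ∃ i ∈ (univ : Finset (Fin k)), ∑ c, u c S * dev c i ≤ 0 := by
      apply exists_le_of_sum_le (univ_nonempty)
      rw [sum_comm]
      simp only [← mul_sum, hdev0]
      simp
    refine ⟨Function.update σ S i0, ?_⟩
    have hs : ∀ c i, (∑ s ∈ range (S+1), if Function.update σ S i0 s = i then u c s else 0)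
        - (∑ s ∈ range (S+1), u c s) / k = dev c i + u c S * ((if i0 = i then 1 else 0) - 1 / k) := by
      intro c i
      rw [sum_range_succ, sum_range_succ, Function.update_self]
      have : (∑ s ∈ range S, if Function.update σ S i0 s = i then u c s else 0) =
          ∑ s ∈ range S, if σ s = i then u c s else 0 := by
        apply sum_congr rfl
        intro s hs
        rw [Function.update_of_ne]
        rintro rfl; simp at hs
      rw [this]
      simp only [hdev]
      split_ifs <;> ring
    simp only [hs]
    have hexp : ∀ c, ∑ i, (dev c i + u c S * ((if i0 = i then 1 else 0) - 1 / k)) ^ 2 =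
        ∑ i, dev c i ^ 2 + 2 * (u c S * dev c i0) + u c S ^ 2 * (1 - 1 / k) := by
      intro c
      have e : ∀ i, (dev c i + u c S * ((if i0 = i then 1 else 0) - 1 / k)) ^ 2 =
          dev c i ^ 2 + 2 * u c S * (if i0 = i then dev c i else 0) - 2 * u c S / k * dev c i +
          u c S ^ 2 * (if i0 = i then (1 - 2 / k : ℝ) else 0) + u c S ^ 2 / k ^ 2 := by
        intro i
        split_ifs <;> ring
      simp only [e, sum_add_distrib, sum_sub_distrib, ← mul_sum, hdev0, sum_ite_eq, mem_univ, if_true,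
        sum_const, card_univ, Fintype.card_fin, nsmul_eq_mul]
      field_simp
      ring
    simp only [hexp, sum_add_distrib, ← mul_sum]
    have hlast : ∑ c, u c S ^ 2 * (1 - 1 / k : ℝ) ≤ Fintype.card C * U ^ 2 := by
      calc ∑ c, u c S ^ 2 * (1 - 1 / k : ℝ) ≤ ∑ c : C, U ^ 2 := by
            apply sum_le_sum
            intro c _
            have h1 : u c S ^ 2 ≤ U ^ 2 := pow_le_pow_left₀ (hu0 _ _) (huU _ _) 2
            have h2 : (0:ℝ) ≤ 1 / k := by positivity
            nlinarith [sq_nonneg (u c S)]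
        _ = _ := by simp
    rw [← sum_mul] at hlast
    push_cast
    rw [← sum_mul]
    nlinarith

lemma bal_sets {V C : Type*} [Fintype C] (k : ℕ) (hk : 0 < k) (U : ℕ) (blk : V → ℕ) (S : ℕ)
    (A : C → Finset V) (hS : ∀ c, ∀ v ∈ A c, blk v < S)
    (hU : ∀ c s, #((A c).filter fun v => blk v = s) ≤ U) :
    ∃ σ : ℕ → Fin k, ∀ c i, |(#((A c).filter fun v => σ (blk v) = i) : ℝ) - #(A c) / k| ≤
      U * Real.sqrt (Fintype.card C * S) := by
  obtain ⟨σ, hσ⟩ := balance_aux k hk U (fun c s => (#((A c).filter fun v => blk v = s) : ℝ))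
    (fun _ _ => Nat.cast_nonneg _) (fun c s => by exact_mod_cast hU c s) S
  refine ⟨σ, fun c i => ?_⟩
  have h1 : ∑ s ∈ range S, (#((A c).filter fun v => blk v = s) : ℝ) = #(A c) := by
    rw [card_eq_sum_card_fiberwise (f := blk) (t := range S) (fun v hv => by simpa using hS c v hv)]
    push_cast; rfl
  have h2 : (∑ s ∈ range S, if σ s = i then (#((A c).filter fun v => blk v = s) : ℝ) else 0) =
      #((A c).filter fun v => σ (blk v) = i) := by
    rw [card_eq_sum_card_fiberwise (s := (A c).filter fun v => σ (blk v) = i) (f := blk) (t := range S)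
      (fun v hv => by
        simp only [coe_filter, Set.mem_ofPred_eq] at hv
        simpa using hS c v hv.1)]
    push_cast
    apply sum_congr rfl
    intro s _
    rw [filter_filter]
    split_ifs with hs
    · congr 2
      apply filter_congr
      intro v _
      constructor
      · rintro rfl; exact ⟨hs, rfl⟩
      · exact fun h => h.2
    · symm
      rw [Nat.cast_eq_zero, card_eq_zero]
      apply filter_false_of_mem
      rintro v _ ⟨h1, rfl⟩
      exact hs h1
  have h3 : ((∑ s ∈ range S, if σ s = i then (#((A c).filter fun v => blk v = s) : ℝ) else 0)
      - (∑ s ∈ range S, (#((A c).filter fun v => blk v = s) : ℝ)) / k) ^ 2 ≤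
      Fintype.card C * S * (U:ℝ) ^ 2 := by
    refine le_trans ?_ hσ
    refine le_trans ?_ (single_le_sum (f := fun c => ∑ i, ((∑ s ∈ range S, if σ s = i then (#((A c).filter fun v => blk v = s) : ℝ) else 0)
      - (∑ s ∈ range S, (#((A c).filter fun v => blk v = s) : ℝ)) / k) ^ 2) (fun c _ => by positivity) (mem_univ c))
    exact single_le_sum (f := fun i => ((∑ s ∈ range S, if σ s = i then (#((A c).filter fun v => blk v = s) : ℝ) else 0)
      - (∑ s ∈ range S, (#((A c).filter fun v => blk v = s) : ℝ)) / k) ^ 2) (fun i _ => by positivity) (mem_univ i)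
  rw [h1, h2] at h3
  apply abs_le_of_sq_le_sq _ (by positivity)
  rw [mul_pow, Real.sq_sqrt (by positivity)]
  linarith

/-- The index schedules. -/
noncomputable def alphaT {k : ℕ} (σ : ℕ → Fin k) (ℓ b' t : ℕ) : Fin k :=
  if t % ℓ < b' then σ (t / ℓ - 1) else σ (t / ℓ)

noncomputable def betaT {k : ℕ} (σ : ℕ → Fin k) (conn : Fin k → Fin k → Fin k) (ℓ b' t : ℕ) : Fin k :=
  if t % ℓ < 2 * b' then conn (σ (t / ℓ - 1)) (σ (t / ℓ)) else σ (t / ℓ)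

lemma sched {k : ℕ} (R : Fin k → Fin k → Prop) (hR : ∀ i, R i i) (conn : Fin k → Fin k → Fin k)
    (hconn : ∀ i j, R i (conn i j) ∧ R j (conn i j)) (σ : ℕ → Fin k) (ℓ b' b : ℕ) (hb : b < b')
    (hℓ : 4 * b' ≤ ℓ) (t t' : ℕ) (h1 : t ≤ t' + b) (h2 : t' ≤ t + b) :
    R (alphaT σ ℓ b' t) (betaT σ conn ℓ b' t') := by
  have hℓ0 : 0 < ℓ := by omega
  have e1 := Nat.div_add_mod t ℓ
  have e2 := Nat.div_add_mod t' ℓ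
  have r1 := Nat.mod_lt t hℓ0
  have r2 := Nat.mod_lt t' hℓ0
  unfold alphaT betaT
  generalize t / ℓ = s at *
  generalize t % ℓ = r at *
  generalize t' / ℓ = s' at *
  generalize t' % ℓ = r' at *
  rcases lt_trichotomy s s' with h | h | h
  · have h3 : s' = s + 1 := by
      by_contra hne
      have : s + 2 ≤ s' := by omega
      have := Nat.mul_le_mul_left ℓ this
      rw [mul_add] at this
      omega
    subst h3
    rw [mul_add] at e2
    have a1 : ¬ r < b' := by omega
    have a2 : r' < 2 * b' := by omega
    rw [if_neg a1, if_pos a2]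
    exact (hconn _ _).1
  · subst h
    by_cases a2 : r' < 2 * b'
    · rw [if_pos a2]
      split_ifs
      · exact (hconn _ _).1
      · exact (hconn _ _).2
    · rw [if_neg a2, if_neg (by omega)]
      exact hR _
  · have h3 : s = s' + 1 := by
      by_contra hne
      have : s' + 2 ≤ s := by omega
      have := Nat.mul_le_mul_left ℓ this
      rw [mul_add] at this
      omega
    subst h3
    rw [mul_add] at e1
    rw [if_pos (by omega), if_neg (by omega)]
    exact hR _

/-- greedy choice avoiding conflicts -/
lemma greedy {V : Type*} (cf : V → Finset V) (hself : ∀ v, v ∈ cf v)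
    (hsymm : ∀ u v, u ∈ cf v → v ∈ cf u) (B : ℕ) (hB0 : 0 < B) (hB : ∀ v, #(cf v) ≤ B)
    (F E : Finset V) (N : ℕ) (h : (#F + N) * B ≤ #E) :
    ∃ F' ⊆ E, #F' = N ∧ Disjoint F F' ∧ (∀ u ∈ F', ∀ v ∈ F, u ∉ cf v) ∧
      (∀ u ∈ F', ∀ v ∈ F', u ≠ v → u ∉ cf v) := by
  induction N with
  | zero => exact ⟨∅, by simp, by simp, by simp, by simp, by simp⟩
  | succ N ih =>
    obtain ⟨F', hE, hN, hd, h1, h2⟩ := ih (le_trans (Nat.mul_le_mul_right _ (by omega)) h)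
    have hlt : #((F ∪ F').biUnion cf) < #E := by
      have h3 : #((F ∪ F').biUnion cf) ≤ #(F ∪ F') * B := by
        refine card_biUnion_le.trans ?_
        rw [← smul_eq_mul]
        exact sum_le_card_nsmul _ _ _ (fun v _ => hB v)
      have h4 : #(F ∪ F') = #F + N := by rw [card_union_of_disjoint hd, hN]
      rw [h4] at h3
      have : (#F + N) * B + B ≤ #E := by
        refine le_trans (le_of_eq ?_) h
        ring
      omega
    obtain ⟨x, hxE, hx⟩ := exists_mem_notMem_of_card_lt_card hlt
    simp only [mem_biUnion, mem_union, not_exists, not_and] at hx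
    refine ⟨insert x F', insert_subset hxE hE, ?_, ?_, ?_, ?_⟩
    · rw [card_insert_of_notMem, hN]
      intro hx'
      exact hx x (Or.inr hx') (hself x)
    · rw [disjoint_insert_right]
      exact ⟨fun hx' => hx x (Or.inl hx') (hself x), hd⟩
    · intro u hu v hv
      rcases mem_insert.1 hu with rfl | hu
      · exact hx v (Or.inl hv)
      · exact h1 u hu v hv
    · intro u hu v hv huv
      rcases mem_insert.1 hu with hu' | hu' <;> rcases mem_insert.1 hv with hv' | hv'
      · exact absurd (hu'.trans hv'.symm) huv
      · rw [hu']; exact hx v (Or.inr hv')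
      · rw [hv']; exact fun h' => hx u (Or.inr hu') (hsymm _ _ h')
      · exact h2 u hu' v hv' huv

end BW
end

section
namespace BW
open Finset
open scoped Classical

lemma window {V : Type*} [Fintype V] (pos : V → ℕ) (n L : ℕ) (hL0 : 0 < L) (hL : L ≤ 2 * n)
    (hpos : ∀ v, pos v < 2 * n) (T : Finset V) (hT : #T = n) :
    ∃ p, p < 2 * n ∧ L ≤ 4 * #(T.filter fun v => p ≤ pos v ∧ pos v < p + L) := by
  by_contra hcon
  push Not at hcon
  have hmap : ∀ v ∈ T, pos v / L ∈ range ((2 * n - 1) / L + 1) := by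
    intro v _
    have := hpos v
    rw [mem_range]
    exact Nat.lt_succ_of_le (Nat.div_le_div_right (by omega))
  have h1 := card_eq_sum_card_fiberwise hmap
  have h2 : ∀ j ∈ range ((2 * n - 1) / L + 1),
      4 * #(T.filter fun v => pos v / L = j) + 1 ≤ L := by
    intro j hj
    rw [mem_range] at hj
    have hj' : j * L ≤ 2 * n - 1 := by
      calc j * L ≤ ((2 * n - 1) / L) * L := Nat.mul_le_mul_right _ (by omega)
        _ ≤ _ := Nat.div_mul_le_self _ _
    refine le_trans (Nat.add_le_add_right (Nat.mul_le_mul_left 4 (card_le_card ?_)) 1)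
      (hcon (j * L) (by omega))
    intro v hv
    rw [mem_filter] at hv ⊢
    refine ⟨hv.1, ?_, ?_⟩
    · rw [← hv.2]; exact Nat.div_mul_le_self _ _
    · rw [← hv.2]
      have := Nat.div_add_mod (pos v) L
      have := Nat.mod_lt (pos v) hL0
      rw [mul_comm (pos v / L)]
      omega
  have h3 := sum_le_sum h2
  rw [sum_add_distrib, ← mul_sum, ← h1] at h3
  simp only [sum_const, card_range, smul_eq_mul, mul_one] at h3
  have h4 := Nat.div_mul_le_self (2 * n - 1) L
  rw [add_mul] at h3
  generalize (2 * n - 1) / L = j at *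
  generalize j * L = jl at *
  omega

lemma mod_count {V : Type*} [Fintype V] (τ : V → ℕ) (hfib : ∀ t, #(univ.filter fun v => τ v = t) ≤ 4)
    (ℓ M : ℕ) (P : Finset ℕ) (T : Finset V) (h : ∀ v ∈ T, τ v / ℓ < M ∧ τ v % ℓ ∈ P) :
    #T ≤ 4 * (#P * M) := by
  have h1 : #T ≤ ∑ q ∈ range M ×ˢ P, #(T.filter fun v => (τ v / ℓ, τ v % ℓ) = q) := by
    apply le_of_eq
    apply card_eq_sum_card_fiberwise
    intro v hv
    simp only [coe_product, Set.mem_prod, mem_coe, mem_range]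
    exact h v hv
  refine h1.trans ?_
  have h2 : ∀ q ∈ range M ×ˢ P, #(T.filter fun v => (τ v / ℓ, τ v % ℓ) = q) ≤ 4 := by
    intro q _
    refine le_trans (card_le_card ?_) (hfib (ℓ * q.1 + q.2))
    intro v hv
    rw [mem_filter] at hv
    rw [mem_filter]
    refine ⟨mem_univ _, ?_⟩
    rw [← hv.2]
    exact (Nat.div_add_mod _ _).symm
  refine (sum_le_card_nsmul _ _ _ h2).trans ?_
  rw [card_product, card_range, smul_eq_mul]
  apply le_of_eq; ring

lemma fib4 {V : Type*} [Fintype V] (pos : V → ℕ) (hinj : Function.Injective pos) (p q : ℕ) (t : ℕ) :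
    #(univ.filter fun v => min ((pos v - p) + (p - pos v)) ((pos v - q) + (q - pos v)) = t) ≤ 4 := by
  have : #((univ.filter fun v => min ((pos v - p) + (p - pos v)) ((pos v - q) + (q - pos v)) = t).image pos)
      ≤ 4 := by
    refine le_trans (card_le_card (t := {p + t, p - t, q + t, q - t}) ?_) card_le_four
    intro x hx
    obtain ⟨v, hv, rfl⟩ := mem_image.1 hx
    have h := (mem_filter.1 hv).2
    simp only [mem_insert, mem_singleton]
    omega
  rwa [card_image_of_injective _ hinj] at this

noncomputable def cf3 {V : Type*} [Fintype V] (H : SimpleGraph V) (v : V) : Finset V :=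
  univ.filter fun u => ∃ x y, (x = v ∨ H.Adj v x) ∧ (x = y ∨ H.Adj x y) ∧ (y = u ∨ H.Adj u y)

lemma cf3_card {V : Type*} [Fintype V] (H : SimpleGraph V) (Δ : ℕ)
    (hdeg : ∀ v, #(univ.filter fun u => H.Adj v u) ≤ Δ) (v : V) : #(cf3 H v) ≤ (Δ + 1) ^ 3 := by
  set nb : V → Finset V := fun v => insert v (univ.filter fun u => H.Adj v u) with hnb
  have hc : ∀ v, #(nb v) ≤ Δ + 1 := fun v => (card_insert_le _ _).trans (by have := hdeg v; omega)
  have hsub : cf3 H v ⊆ ((nb v).biUnion nb).biUnion nb := by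
    intro u hu
    obtain ⟨x, y, h1, h2, h3⟩ := (mem_filter.1 hu).2
    simp only [mem_biUnion, hnb, mem_insert, mem_filter, mem_univ, true_and]
    refine ⟨y, ⟨x, ?_, ?_⟩, ?_⟩
    · exact h1
    · rcases h2 with h | h
      · exact Or.inl h.symm
      · exact Or.inr h
    · rcases h3 with h | h
      · exact Or.inl h.symm
      · exact Or.inr h.symm
  have hb : ∀ T : Finset V, #(T.biUnion nb) ≤ #T * (Δ + 1) := fun T =>
    card_biUnion_le_card_mul _ _ _ (fun v _ => hc v)
  calc #(cf3 H v) ≤ _ := card_le_card hsub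
    _ ≤ _ := hb _
    _ ≤ (#(nb v) * (Δ + 1)) * (Δ + 1) := Nat.mul_le_mul_right _ (hb _)
    _ ≤ ((Δ + 1) * (Δ + 1)) * (Δ + 1) := Nat.mul_le_mul_right _ (Nat.mul_le_mul_right _ (hc v))
    _ = _ := by ring

structure Assign {V : Type*} [Fintype V] (H : SimpleGraph V) (sV : V → Bool) (k : ℕ)
    (R : Fin k → Fin k → Prop) (n b Λ NZ ND : ℕ) (err : ℝ) (τ : V → ℕ) (idx : V → Fin k)
    (Z D : Finset V) : Prop where
  edge : ∀ u v, H.Adj u v → τ u ≤ τ v + b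
  fib : ∀ t, #(univ.filter fun v => τ v = t) ≤ 4
  red : ∀ u v, H.Adj u v → sV u = false → sV v = true → R (idx u) (idx v)
  all : ∀ s i, (#((univ.filter fun v => sV v = s ∧ v ∉ Z).filter fun v => idx v = i) : ℝ)
      ≤ ((n : ℝ) - NZ) / k + err
  early : ∀ s i, (#((univ.filter fun v => sV v = s ∧ τ v < Λ).filter fun v => idx v = i) : ℝ)
      ≤ (4 * Λ : ℝ) / k + err
  cen : ∀ c ∈ Z ∪ D, τ c + 3 * (b + 1) < Λ
  far : Ctx.Far H (Z ∪ D)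
  disj : Disjoint Z D
  cZ : ∀ s, #(Z.filter fun v => sV v = s) = NZ
  cD : ∀ s, #(D.filter fun v => sV v = s) = ND
  nbr : ∀ c ∈ Z ∪ D, ∀ x, H.Adj c x → idx x = idx c
  dD : ∀ s i, (ND : ℝ) / k - err ≤ #((D.filter fun v => sV v = s).filter fun v => idx v = i)

theorem assign {V : Type*} [Fintype V] (H : SimpleGraph V) (sV : V → Bool) (Δ : ℕ)
    (hdeg : ∀ v, #(univ.filter fun u => H.Adj v u) ≤ Δ) (pos : V → ℕ)
    (hinj : Function.Injective pos) (n : ℕ) (hpos : ∀ v, pos v < 2 * n) (b : ℕ)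
    (hb : ∀ u v, H.Adj u v → pos u ≤ pos v + b) (hn : ∀ s, #(univ.filter fun v => sV v = s) = n)
    (k : ℕ) (hk : 0 < k) (R : Fin k → Fin k → Prop) (hR : ∀ i, R i i)
    (conn : Fin k → Fin k → Fin k) (hconn : ∀ i j, R i (conn i j) ∧ R j (conn i j))
    (L ℓ NZ ND S : ℕ) (hL0 : 0 < L) (hL : L ≤ 2 * n) (hℓ : 4 * (b + 1) ≤ ℓ) (hS : 2 * n ≤ ℓ * S)
    (hN : 4 * (2 * (NZ + ND) * (Δ + 1) ^ 3 + 16 * (b + 1) * (L / ℓ + 1)) ≤ L) :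
    ∃ τ idx Z D, Assign H sV k R n b (L + 3 * (b + 1)) NZ ND
      ((4 * ℓ : ℕ) * √(6 * S) + 8 * (b + 1) * S) τ idx Z D := by
  have hw : ∀ s, ∃ p, p < 2 * n ∧
      L ≤ 4 * #((univ.filter fun v => sV v = s).filter fun v => p ≤ pos v ∧ pos v < p + L) :=
    fun s => window pos n L hL0 hL hpos _ (hn s)
  choose p hp2 hpL using hw
  set τ : V → ℕ := fun v => min ((pos v - p false) + (p false - pos v))
    ((pos v - p true) + (p true - pos v)) with hτ
  have hfib : ∀ t, #(univ.filter fun v => τ v = t) ≤ 4 := fun t => fib4 pos hinj _ _ t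
  have hedge : ∀ u v, H.Adj u v → τ u ≤ τ v + b := by
    intro u v huv
    have h1 := hb u v huv
    have h2 := hb v u huv.symm
    simp only [hτ]
    omega
  have hτ2 : ∀ v, τ v < 2 * n := by
    intro v
    have := hpos v
    have := hp2 false
    simp only [hτ]
    omega
  have hℓ0 : 0 < ℓ := by omega
  have hτS : ∀ v, τ v / ℓ < S := fun v =>
    Nat.div_lt_of_lt_mul (lt_of_lt_of_le (hτ2 v) hS)
  -- eligible sets
  set El : Bool → Finset V := fun s => univ.filter fun v => sV v = s ∧ τ v < L ∧
    3 * (b + 1) ≤ τ v % ℓ ∧ τ v % ℓ < ℓ - (b + 1) with hEl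
  have hElc : ∀ s, 2 * (NZ + ND) * (Δ + 1) ^ 3 ≤ #(El s) := by
    intro s
    set Wd := (univ.filter fun v => sV v = s).filter fun v => p s ≤ pos v ∧ pos v < p s + L with hWd
    have hbad : #(Wd.filter fun v => v ∉ El s) ≤ 4 * ((4 * (b + 1)) * (L / ℓ + 1)) := by
      have := mod_count τ hfib ℓ (L / ℓ + 1) (range (3 * (b + 1)) ∪ Ico (ℓ - (b + 1)) ℓ)
        (Wd.filter fun v => v ∉ El s) ?_
      · refine this.trans (Nat.mul_le_mul_left _ (Nat.mul_le_mul_right _ ?_))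
        refine (card_union_le _ _).trans ?_
        rw [card_range, Nat.card_Ico]
        omega
      · intro v hv
        rw [mem_filter, hWd, mem_filter, mem_filter] at hv
        obtain ⟨⟨⟨-, hs⟩, h1, h2⟩, h3⟩ := hv
        have hvL : τ v < L := by
          cases s <;> simp only [hτ] <;> omega
        refine ⟨Nat.lt_succ_of_le (Nat.div_le_div_right hvL.le), ?_⟩
        have h4 := Nat.mod_lt (τ v) hℓ0
        simp only [hEl, mem_filter, mem_univ, true_and, not_and] at h3
        have h5 := h3 hs hvL
        rw [mem_union, mem_range, mem_Ico]
        omega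
    have h1 : #Wd ≤ #(El s) + #(Wd.filter fun v => v ∉ El s) := by
      rw [← card_filter_add_card_filter_not (s := Wd) (fun v => v ∈ El s)]
      refine Nat.add_le_add_right (card_le_card ?_) _
      intro v hv
      exact (mem_filter.1 hv).2
    have h2 : L ≤ 4 * #Wd := (hpL s).trans (le_of_eq (by rw [hWd]))
    have h3 : 4 * (b + 1) * (L / ℓ + 1) * 4 = 16 * (b + 1) * (L / ℓ + 1) := by ring
    omega
  have hself : ∀ v, v ∈ cf3 H v := fun v => by
    simp only [cf3, mem_filter, mem_univ, true_and]
    exact ⟨v, v, Or.inl rfl, Or.inl rfl, Or.inl rfl⟩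
  have hsymm : ∀ u v, u ∈ cf3 H v → v ∈ cf3 H u := fun u v h => by
    simp only [cf3, mem_filter, mem_univ, true_and] at h ⊢
    obtain ⟨x, y, h1, h2, h3⟩ := h
    exact ⟨y, x, h3, h2.imp Eq.symm fun h => h.symm, h1⟩
  obtain ⟨F0, hF0, hc0, -, -, hf0⟩ := greedy (cf3 H) hself hsymm ((Δ + 1) ^ 3) (by positivity)
    (cf3_card H Δ hdeg) ∅ (El false) (NZ + ND) (by
      refine le_trans (Nat.mul_le_mul_right _ ?_) (hElc false)
      rw [card_empty]; omega)
  obtain ⟨F1, hF1, hc1, hdF, hf01, hf1⟩ := greedy (cf3 H) hself hsymm ((Δ + 1) ^ 3) (by positivity)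
    (cf3_card H Δ hdeg) F0 (El true) (NZ + ND) (by
      refine le_trans (Nat.mul_le_mul_right _ ?_) (hElc true)
      rw [hc0]; omega)
  obtain ⟨Z0, hZ0, hZ0c⟩ := exists_subset_card_eq (show NZ ≤ #F0 by omega)
  obtain ⟨Z1, hZ1, hZ1c⟩ := exists_subset_card_eq (show NZ ≤ #F1 by omega)
  set Z := Z0 ∪ Z1 with hZ
  set D := (F0 \ Z0) ∪ (F1 \ Z1) with hD
  have hs0 : ∀ v ∈ F0, sV v = false := fun v hv => (mem_filter.1 (hF0 hv)).2.1
  have hs1 : ∀ v ∈ F1, sV v = true := fun v hv => (mem_filter.1 (hF1 hv)).2.1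
  have hZD : Z ∪ D ⊆ F0 ∪ F1 := by
    intro v hv
    simp only [hZ, hD, mem_union, mem_sdiff] at hv ⊢
    rcases hv with (h | h) | (h | h)
    · exact Or.inl (hZ0 h)
    · exact Or.inr (hZ1 h)
    · exact Or.inl h.1
    · exact Or.inr h.1
  have hel : ∀ v ∈ Z ∪ D, τ v < L ∧ 3 * (b + 1) ≤ τ v % ℓ ∧ τ v % ℓ < ℓ - (b + 1) := by
    intro v hv
    rcases mem_union.1 (hZD hv) with h | h
    · exact (mem_filter.1 (hF0 h)).2.2
    · exact (mem_filter.1 (hF1 h)).2.2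
  have hfar0 : ∀ u ∈ F0 ∪ F1, ∀ v ∈ F0 ∪ F1, u ≠ v → u ∉ cf3 H v := by
    intro u hu v hv huv
    rcases mem_union.1 hu with hu | hu <;> rcases mem_union.1 hv with hv | hv
    · exact hf0 u hu v hv huv
    · exact fun h => hf01 v hv u hu (hsymm _ _ h)
    · exact hf01 u hu v hv
    · exact hf1 u hu v hv huv
  have hcZ : ∀ s, #(Z.filter fun v => sV v = s) = NZ := by
    intro s
    cases s
    · rw [← hZ0c]
      congr 1
      ext v
      simp only [hZ, mem_filter, mem_union]
      constructor
      · rintro ⟨h | h, h'⟩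
        · exact h
        · rw [hs1 v (hZ1 h)] at h'; cases h'
      · exact fun h => ⟨Or.inl h, hs0 v (hZ0 h)⟩
    · rw [← hZ1c]
      congr 1
      ext v
      simp only [hZ, mem_filter, mem_union]
      constructor
      · rintro ⟨h | h, h'⟩
        · rw [hs0 v (hZ0 h)] at h'; cases h'
        · exact h
      · exact fun h => ⟨Or.inr h, hs1 v (hZ1 h)⟩
  have hcD : ∀ s, #(D.filter fun v => sV v = s) = ND := by
    intro s
    cases s
    · have : #(F0 \ Z0) = ND := by rw [card_sdiff_of_subset hZ0]; omega
      rw [← this]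
      congr 1
      ext v
      simp only [hD, mem_filter, mem_union]
      constructor
      · rintro ⟨h | h, h'⟩
        · exact h
        · rw [hs1 v (mem_sdiff.1 h).1] at h'; cases h'
      · exact fun h => ⟨Or.inl h, hs0 v (mem_sdiff.1 h).1⟩
    · have : #(F1 \ Z1) = ND := by rw [card_sdiff_of_subset hZ1]; omega
      rw [← this]
      congr 1
      ext v
      simp only [hD, mem_filter, mem_union]
      constructor
      · rintro ⟨h | h, h'⟩
        · rw [hs0 v (mem_sdiff.1 h).1] at h'; cases h'
        · exact h
      · exact fun h => ⟨Or.inr h, hs1 v (mem_sdiff.1 h).1⟩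
  have hdis : Disjoint Z D := by
    rw [disjoint_left]
    intro v hv hv'
    simp only [hZ, hD, mem_union, mem_sdiff] at hv hv'
    rw [disjoint_left] at hdF
    rcases hv with h | h <;> rcases hv' with h' | h'
    · exact h'.2 h
    · exact hdF (hZ0 h) h'.1
    · exact hdF h'.1 (hZ1 h)
    · exact h'.2 h
  -- balancing
  set Λ := L + 3 * (b + 1) with hΛ
  set Ac : Bool × Fin 3 → Finset V := fun c =>
    if c.2 = 0 then univ.filter fun v => sV v = c.1 ∧ v ∉ Z
    else if c.2 = 1 then univ.filter fun v => sV v = c.1 ∧ τ v < Λ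
    else D.filter fun v => sV v = c.1 with hAc
  obtain ⟨σ, hσ⟩ := bal_sets k hk (4 * ℓ) (fun v => τ v / ℓ) S Ac (fun c v _ => hτS v) (by
    intro c s
    have h1 := mod_count (V := V) τ hfib ℓ 1 (range ℓ) ∅ (by simp)
    have h2 : #((Ac c).filter fun v => τ v / ℓ = s) ≤ ∑ r ∈ range ℓ,
        #(((Ac c).filter fun v => τ v / ℓ = s).filter fun v => τ v % ℓ = r) := by
      apply le_of_eq
      apply card_eq_sum_card_fiberwise
      intro v _
      exact mem_coe.2 (mem_range.2 (Nat.mod_lt _ hℓ0))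
    refine h2.trans ((sum_le_card_nsmul _ _ 4 ?_).trans (by rw [card_range, smul_eq_mul, mul_comm]))
    intro r _
    refine le_trans (card_le_card ?_) (hfib (ℓ * s + r))
    intro v hv
    simp only [mem_filter] at hv
    rw [mem_filter]
    refine ⟨mem_univ _, ?_⟩
    rw [← hv.2, ← hv.1.2]
    exact (Nat.div_add_mod _ _).symm)
  set idx : V → Fin k := fun v => if sV v then betaT σ conn ℓ (b + 1) (τ v)
    else alphaT σ ℓ (b + 1) (τ v) with hidx
  have hinter : ∀ v, ¬ τ v % ℓ < 2 * (b + 1) → idx v = σ (τ v / ℓ) := by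
    intro v hv
    simp only [hidx, alphaT, betaT]
    have hv2 : ¬ τ v % ℓ < b + 1 := by omega
    rw [if_neg hv, if_neg hv2]
    split_ifs <;> rfl
  have hdiff : ∀ T : Finset V, #(T.filter fun v => τ v % ℓ < 2 * (b + 1)) ≤ 8 * (b + 1) * S := by
    intro T
    have := mod_count τ hfib ℓ S (range (2 * (b + 1))) (T.filter fun v => τ v % ℓ < 2 * (b + 1)) (by
      intro v hv
      exact ⟨hτS v, mem_range.2 (mem_filter.1 hv).2⟩)
    rw [card_range] at this
    refine this.trans (le_of_eq ?_)
    ring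
  have hcard6 : (Fintype.card (Bool × Fin 3) : ℝ) = 6 := by rw [Fintype.card_prod]; norm_num
  have hup : ∀ c i, (#((Ac c).filter fun v => idx v = i) : ℝ) ≤
      #(Ac c) / k + ((4 * ℓ : ℕ) * √(6 * S) + 8 * (b + 1) * S) := by
    intro c i
    have h1 := (abs_le.1 (hσ c i)).2
    rw [hcard6] at h1
    have h2 : #((Ac c).filter fun v => idx v = i) ≤ #((Ac c).filter fun v => σ (τ v / ℓ) = i) +
        #((Ac c).filter fun v => τ v % ℓ < 2 * (b + 1)) := by
      refine le_trans (card_le_card ?_) (card_union_le _ _)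
      intro v hv
      rw [mem_filter] at hv
      rw [mem_union, mem_filter, mem_filter]
      by_cases h : τ v % ℓ < 2 * (b + 1)
      · exact Or.inr ⟨hv.1, h⟩
      · exact Or.inl ⟨hv.1, by rw [← hinter v h]; exact hv.2⟩
    have h3 := h2.trans (Nat.add_le_add_left (hdiff (Ac c)) _)
    have h4 : (#((Ac c).filter fun v => idx v = i) : ℝ) ≤ #((Ac c).filter fun v => σ (τ v / ℓ) = i)
      + 8 * (b + 1) * S := by exact_mod_cast h3
    linarith
  have hlo : ∀ c i, #(Ac c) / k - ((4 * ℓ : ℕ) * √(6 * S) + 8 * (b + 1) * S) ≤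
      (#((Ac c).filter fun v => idx v = i) : ℝ) := by
    intro c i
    have h1 := (abs_le.1 (hσ c i)).1
    rw [hcard6] at h1
    have h2 : #((Ac c).filter fun v => σ (τ v / ℓ) = i) ≤ #((Ac c).filter fun v => idx v = i) +
        #((Ac c).filter fun v => τ v % ℓ < 2 * (b + 1)) := by
      refine le_trans (card_le_card ?_) (card_union_le _ _)
      intro v hv
      rw [mem_filter] at hv
      rw [mem_union, mem_filter, mem_filter]
      by_cases h : τ v % ℓ < 2 * (b + 1)
      · exact Or.inr ⟨hv.1, h⟩
      · exact Or.inl ⟨hv.1, by rw [hinter v h]; exact hv.2⟩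
    have h3 := h2.trans (Nat.add_le_add_left (hdiff (Ac c)) _)
    have h4 : (#((Ac c).filter fun v => σ (τ v / ℓ) = i) : ℝ) ≤ #((Ac c).filter fun v => idx v = i)
      + 8 * (b + 1) * S := by exact_mod_cast h3
    linarith
  have hk' : (0:ℝ) < k := by exact_mod_cast hk
  refine ⟨τ, idx, Z, D, ⟨hedge, hfib, ?_, ?_, ?_, ?_, ?_, hdis, hcZ, hcD, ?_, ?_⟩⟩
  · intro u v huv hu hv
    simp only [hidx, hu, hv]
    exact sched R hR conn hconn σ ℓ (b + 1) b (by omega) hℓ _ _ (hedge u v huv) (hedge v u huv.symm)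
  · intro s i
    have h := hup (s, 0) i
    have h1 : Ac (s, 0) = univ.filter fun v => sV v = s ∧ v ∉ Z := by simp [hAc]
    rw [h1] at h
    have h2 : (#(univ.filter fun v => sV v = s ∧ v ∉ Z) : ℝ) = n - NZ := by
      have e1 : #(univ.filter fun v => sV v = s ∧ v ∉ Z) + NZ = n := by
        rw [← hcZ s, ← hn s, ← card_filter_add_card_filter_not (s := univ.filter fun v => sV v = s)
          (fun v => v ∈ Z), add_comm, filter_filter, filter_filter]
        congr 2
        ext v
        simp only [mem_filter, mem_univ, true_and]
        tauto
      rw [← e1]; push_cast; ring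
    rw [h2] at h
    exact h
  · intro s i
    have h := hup (s, 1) i
    have h1 : Ac (s, 1) = univ.filter fun v => sV v = s ∧ τ v < Λ := by simp [hAc]
    rw [h1] at h
    refine h.trans (add_le_add_left ?_ _)
    apply div_le_div_of_nonneg_right _ hk'.le
    have h2 : #(univ.filter fun v => sV v = s ∧ τ v < Λ) ≤ 4 * Λ := by
      have h3 : #(univ.filter fun v => sV v = s ∧ τ v < Λ) = ∑ t ∈ range Λ,
          #((univ.filter fun v => sV v = s ∧ τ v < Λ).filter fun v => τ v = t) := by
        apply card_eq_sum_card_fiberwise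
        intro v hv
        simp only [coe_filter, Set.mem_ofPred_eq, mem_univ, true_and] at hv
        exact mem_coe.2 (mem_range.2 hv.2)
      rw [h3]
      refine (sum_le_card_nsmul _ _ 4 ?_).trans (by rw [card_range, smul_eq_mul, mul_comm])
      intro t _
      refine le_trans (card_le_card ?_) (hfib t)
      intro v hv
      rw [mem_filter] at hv ⊢
      exact ⟨mem_univ _, hv.2⟩
    exact_mod_cast h2
  · intro c hc
    have := hel c hc
    omega
  · intro c hc c' hc' hne x y hx hy
    have h1 := hfar0 c' (hZD hc') c (hZD hc) hne.symm
    simp only [cf3, mem_filter, mem_univ, true_and, not_exists, not_and] at h1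
    constructor
    · intro hxy
      exact h1 x y hx (Or.inl hxy) hy
    · intro hxy
      exact h1 x y hx (Or.inr hxy) hy
  · intro c hc x hcx
    obtain ⟨h1, h2, h3⟩ := hel c hc
    have h4 := hedge c x hcx
    have h5 := hedge x c hcx.symm
    have e1 := Nat.div_add_mod (τ c) ℓ
    have hdiv : τ x / ℓ = τ c / ℓ := by
      apply Nat.div_eq_of_lt_le
      · rw [mul_comm]; omega
      · rw [add_mul, mul_comm]; omega
    have e2 := Nat.div_add_mod (τ x) ℓ
    rw [hdiv] at e2
    rw [hinter x (by omega), hinter c (by omega), hdiv]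
  · intro s i
    have h := hlo (s, 2) i
    have h1 : Ac (s, 2) = D.filter fun v => sV v = s := by simp [hAc]
    rw [h1, hcD s] at h
    exact h

end BW
end

section
namespace BW
open Finset
open scoped Classical

lemma chunks {W : Type*} [Fintype W] (P : Finset (Finset W)) (T : Finset W) (m : ℕ) (hm : 0 < m) :
    ∃ C : Finset (Finset W), (∀ c ∈ C, ∀ c' ∈ C, c ≠ c' → Disjoint c c') ∧
      (∀ c ∈ C, #c = m ∧ c ⊆ T ∧ ∃ p ∈ P, c ⊆ p) ∧
      #(T.filter fun v => ∃ p ∈ P, v ∈ p) ≤ m * #C + m * #P := by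
  set good : Finset (Finset (Finset W)) := univ.filter fun C =>
    (∀ c ∈ C, ∀ c' ∈ C, c ≠ c' → Disjoint c c') ∧ (∀ c ∈ C, #c = m ∧ c ⊆ T ∧ ∃ p ∈ P, c ⊆ p)
    with hgood
  have hne : good.Nonempty := ⟨∅, by simp [hgood]⟩
  obtain ⟨C, hC, hmax⟩ := exists_max_image good card hne
  have hC' := (mem_filter.1 hC).2
  refine ⟨C, hC'.1, hC'.2, ?_⟩
  have hleft : ∀ p ∈ P, #((T ∩ p) \ C.biUnion id) ≤ m := by
    intro p hp
    by_contra hcon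
    push Not at hcon
    obtain ⟨c, hc, hcm⟩ := exists_subset_card_eq hcon.le
    have hdis : ∀ c' ∈ C, Disjoint c c' := by
      intro c' hc'
      rw [disjoint_left]
      intro x hx hx'
      exact (mem_sdiff.1 (hc hx)).2 (mem_biUnion.2 ⟨c', hc', hx'⟩)
    have hcC : c ∉ C := by
      intro h
      have := hdis c h
      rw [disjoint_self] at this
      rw [this] at hcm
      simp at hcm
      omega
    have h1 : insert c C ∈ good := by
      rw [hgood, mem_filter]
      refine ⟨mem_univ _, ?_, ?_⟩
      · intro a ha a' ha' hne
        rcases mem_insert.1 ha with h | h <;> rcases mem_insert.1 ha' with h' | h'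
        · exact absurd (h.trans h'.symm) hne
        · rw [h]; exact hdis a' h'
        · rw [h']; exact (hdis a h).symm
        · exact hC'.1 a h a' h' hne
      · intro a ha
        rcases mem_insert.1 ha with h | h
        · rw [h]
          refine ⟨hcm, fun x hx => (mem_inter.1 (mem_sdiff.1 (hc hx)).1).1, p, hp,
            fun x hx => (mem_inter.1 (mem_sdiff.1 (hc hx)).1).2⟩
        · exact hC'.2 a h
    have h2 := hmax _ h1
    rw [card_insert_of_notMem hcC] at h2
    omega
  have hcov : #(C.biUnion id) ≤ m * #C := by
    rw [mul_comm]
    exact card_biUnion_le_card_mul _ _ _ (fun c hc => (hC'.2 c hc).1.le)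
  have hsub : (T.filter fun v => ∃ p ∈ P, v ∈ p) ⊆
      C.biUnion id ∪ P.biUnion fun p => (T ∩ p) \ C.biUnion id := by
    intro v hv
    obtain ⟨hvT, p, hp, hvp⟩ := mem_filter.1 hv
    by_cases h : v ∈ C.biUnion id
    · exact mem_union_left _ h
    · exact mem_union_right _ (mem_biUnion.2 ⟨p, hp, mem_sdiff.2 ⟨mem_inter.2 ⟨hvT, hvp⟩, h⟩⟩)
  have h3 : #(P.biUnion fun p => (T ∩ p) \ C.biUnion id) ≤ m * #P := by
    rw [mul_comm]
    exact card_biUnion_le_card_mul _ _ _ hleft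
  calc _ ≤ _ := card_le_card hsub
    _ ≤ _ := card_union_le _ _
    _ ≤ _ := by omega

lemma hallmatch (k : ℕ) (R : Fin k → Fin k → Prop)
    (h1 : ∀ i, k ≤ 2 * #(univ.filter fun j => R i j)) (h2 : ∀ j, k ≤ 2 * #(univ.filter fun i => R i j)) :
    ∃ f : Fin k → Fin k, Function.Bijective f ∧ ∀ i, R i (f i) := by
  have h := (Finset.all_card_le_biUnion_card_iff_exists_injective
    (fun i : Fin k => univ.filter fun j => R i j)).1 (by
    intro s
    rcases s.eq_empty_or_nonempty with rfl | ⟨i, hi⟩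
    · simp
    by_cases hs : 2 * #s ≤ k
    · have h3 : #(univ.filter fun j => R i j) ≤ #(s.biUnion fun i => univ.filter fun j => R i j) :=
        card_le_card (subset_biUnion_of_mem (fun i => univ.filter fun j => R i j) hi)
      have := h1 i
      omega
    · have h3 : (s.biUnion fun i => univ.filter fun j => R i j) = univ := by
        rw [eq_univ_iff_forall]
        intro j
        rw [mem_biUnion]
        by_contra hcon
        push Not at hcon
        have h4 : Disjoint s (univ.filter fun i => R i j) := by
          rw [disjoint_left]
          intro x hx hx'
          exact hcon x hx (by simpa using hx')
        have h5 := card_le_univ (s ∪ univ.filter fun i => R i j)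
        rw [card_union_of_disjoint h4, Fintype.card_fin] at h5
        have := h2 j
        omega
      rw [h3]
      exact card_le_univ s)
  obtain ⟨f, hf, hf'⟩ := h
  exact ⟨f, hf.bijective_of_finite, fun i => by simpa using hf' i⟩

lemma dens_sum {W : Type*} [Fintype W] (G : SimpleGraph W) (p q : Finset W) :
    (G.edgeDensity p q : ℝ) * (#p * #q) = ∑ w ∈ p, (#(q.filter fun x => G.Adj w x) : ℝ) := by
  have h1 : (#(G.interedges p q) : ℝ) = ∑ w ∈ p, (#(q.filter fun x => G.Adj w x) : ℝ) := by
    have : #(G.interedges p q) = ∑ w ∈ p, #(q.filter fun x => G.Adj w x) := by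
      rw [SimpleGraph.interedges, Rel.interedges, card_filter, sum_product]
      refine sum_congr rfl fun w _ => ?_
      rw [card_filter]
    rw [this]; push_cast; rfl
  rw [← h1, SimpleGraph.edgeDensity_def]
  push_cast
  rcases eq_or_ne (#p * #q : ℝ) 0 with h | h
  · rw [h]
    have h2 : #(G.interedges p q) ≤ #p * #q := G.card_interedges_le_mul p q
    have h3 : (#(G.interedges p q) : ℝ) ≤ #p * #q := by exact_mod_cast h2
    rw [h] at h3
    have : (0:ℝ) ≤ #(G.interedges p q) := by positivity
    rw [mul_zero]; linarith
  · rw [div_mul_cancel₀ _ h]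

lemma dns_of_uniform {W : Type*} [Fintype W] (G : SimpleGraph W) (P P' p q : Finset W)
    (hp : p ⊆ P) (hq : q ⊆ P') (ε0 e d d0 : ℝ) (hu : G.IsUniform ε0 P P')
    (hd : d0 ≤ G.edgeDensity P P') (hdd : d ≤ d0 - ε0) (he : 0 < e)
    (heP : (#P : ℝ) * ε0 ≤ e) (heP' : (#P' : ℝ) * ε0 ≤ e) : Dns G e d p q := by
  intro C hC hCe
  by_contra hcon
  push Not at hcon
  set T := p.filter fun w => (#(C.filter fun x => G.Adj w x) : ℝ) < d * #C with hT
  have h1 := hu (s' := T) ((filter_subset _ _).trans hp) (t' := C) (hC.trans hq)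
    (heP.trans hcon.le) (heP'.trans hCe)
  have h2 := (abs_lt.1 h1).1
  have h3 := dens_sum G T C
  have hTpos : (0:ℝ) < #T := he.trans hcon
  have hCpos : (0:ℝ) < #C := lt_of_lt_of_le he hCe
  have h4 : ∑ w ∈ T, (#(C.filter fun x => G.Adj w x) : ℝ) ≤ ∑ w ∈ T, d * #C :=
    sum_le_sum fun w hw => (mem_filter.1 hw).2.le
  rw [sum_const, nsmul_eq_mul, ← h3] at h4
  have h5 : d * (#T * #C) < G.edgeDensity T C * (#T * #C) := by
    apply mul_lt_mul_of_pos_right _ (by positivity)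
    linarith
  nlinarith

end BW
end

section
namespace BW
open Finset
open scoped Classical

lemma card_fam {W : Type*} [Fintype W] {k : ℕ} (q : Fin k → Finset W) (m : ℕ) (hq : ∀ j, #(q j) = m)
    (hdis : ∀ i j, i ≠ j → Disjoint (q i) (q j)) (J : Finset (Fin k)) : #(J.biUnion q) = #J * m := by
  rw [card_biUnion (fun i _ j _ h => hdis i j h), sum_congr rfl (fun j _ => hq j), sum_const,
    smul_eq_mul]

lemma nbr_cover {W : Type*} [Fintype W] (G : SimpleGraph W) {k : ℕ} (q : Fin k → Finset W) (m n : ℕ)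
    (hq : ∀ j, #(q j) = m) (hdis : ∀ i j, i ≠ j → Disjoint (q i) (q j)) (T : Finset W) (hT : #T = n)
    (hqT : ∀ j, q j ⊆ T) (w : W) (hw : ∀ x, G.Adj w x → x ∈ T) :
    #(univ.filter fun x => G.Adj w x) + k * m ≤ n + ∑ j, #((q j).filter fun x => G.Adj w x) := by
  have h1 : #((univ : Finset (Fin k)).biUnion q) = k * m := by
    rw [card_fam q m hq hdis, card_univ, Fintype.card_fin]
  have h2 : ∑ j, #((q j).filter fun x => G.Adj w x) =
      #((univ.biUnion q).filter fun x => G.Adj w x) := by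
    rw [filter_biUnion, card_biUnion]
    intro i _ j _ hij
    exact disjoint_filter_filter (hdis i j hij)
  have h3 : univ.biUnion q ⊆ T := by
    intro x hx
    obtain ⟨j, -, hj⟩ := mem_biUnion.1 hx
    exact hqT j hj
  have h4 : #(univ.filter fun x => G.Adj w x) ≤
      #((univ.biUnion q).filter fun x => G.Adj w x) + #(T \ univ.biUnion q) := by
    refine le_trans (card_le_card ?_) (card_union_le _ _)
    intro x hx
    have hx' := (mem_filter.1 hx).2
    rw [mem_union, mem_filter, mem_sdiff]
    by_cases h : x ∈ univ.biUnion q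
    · exact Or.inl ⟨h, hx'⟩
    · exact Or.inr ⟨hw x hx', h⟩
  rw [card_sdiff_of_subset h3, h1, hT] at h4
  have h5 := card_le_card h3
  rw [h1, hT] at h5
  rw [h2]
  omega

/-- few bad parts -/
lemma bad_parts {W : Type*} [Fintype W] (G : SimpleGraph W) (P : Finpartition (univ : Finset W))
    (δ : ℝ) (hδ : 0 < δ) (hP : P.IsUniform G (δ ^ 2)) :
    (#(P.parts.filter fun p => ¬ (#(P.parts.filter fun p' => p ≠ p' ∧ ¬ G.IsUniform (δ ^ 2) p p') : ℝ)
      ≤ δ * #P.parts) : ℝ) ≤ δ * #P.parts := by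
  set K : ℝ := (#P.parts : ℝ) with hK
  set bad := P.parts.filter fun p => ¬ (#(P.parts.filter fun p' => p ≠ p' ∧ ¬ G.IsUniform (δ ^ 2) p p') : ℝ)
      ≤ δ * K with hbad
  have h1 : (#(P.nonUniforms G (δ ^ 2)) : ℝ) ≤ K * K * δ ^ 2 := by
    refine le_trans hP ?_
    apply mul_le_mul_of_nonneg_right _ (by positivity)
    push_cast
    rw [← hK]
    apply mul_le_mul_of_nonneg_left _ (by positivity)
    rw [hK]
    exact_mod_cast Nat.sub_le _ _
  have h2 : ∑ p ∈ bad, #(P.parts.filter fun p' => p ≠ p' ∧ ¬ G.IsUniform (δ ^ 2) p p') ≤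
      #(P.nonUniforms G (δ ^ 2)) := by
    rw [← card_sigma]
    refine card_le_card_of_injOn (fun x => (x.1, x.2)) ?_ ?_
    · rintro ⟨p, p'⟩ hx
      simp only [coe_sigma, Set.mem_sigma_iff, mem_coe, hbad, mem_filter] at hx
      exact mem_coe.2 ((Finpartition.mk_mem_nonUniforms ..).2 ⟨hx.1.1, hx.2.1, hx.2.2.1, hx.2.2.2⟩)
    · rintro ⟨a, b⟩ _ ⟨c, d⟩ _ h
      simp only [Prod.mk.injEq] at h
      rw [h.1, h.2]
  have h3 : (#bad : ℝ) * (δ * K) ≤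
      ∑ p ∈ bad, (#(P.parts.filter fun p' => p ≠ p' ∧ ¬ G.IsUniform (δ ^ 2) p p') : ℝ) := by
    rw [← nsmul_eq_mul]
    apply card_nsmul_le_sum
    intro p hp
    exact (not_le.1 (mem_filter.1 hp).2).le
  have h4 : (#bad : ℝ) * (δ * K) ≤ (δ * K) * (δ * K) := by
    have : ((∑ p ∈ bad, #(P.parts.filter fun p' => p ≠ p' ∧ ¬ G.IsUniform (δ ^ 2) p p') : ℕ) : ℝ) ≤
      #(P.nonUniforms G (δ ^ 2)) := by exact_mod_cast h2
    push_cast at this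
    nlinarith
  rcases eq_or_lt_of_le (show 0 ≤ K by positivity) with h | h
  · have h5 : #bad ≤ #P.parts := card_filter_le _ _
    have : #P.parts = 0 := by
      have : (#P.parts : ℝ) = 0 := by rw [← hK, ← h]
      exact_mod_cast this
    rw [← h]
    have : #bad = 0 := by omega
    rw [this]; simp
  · exact le_of_mul_le_mul_right h4 (by positivity)

/-- degree estimate in the reduced graph -/
lemma red_deg {W : Type*} [Fintype W] (G : SimpleGraph W) (parts : Finset (Finset W)) {k : ℕ}
    (q : Fin k → Finset W) (π : Fin k → Finset W) (m n : ℕ) (hm : 0 < m)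
    (hq : ∀ j, #(q j) = m) (hdis : ∀ i j, i ≠ j → Disjoint (q i) (q j)) (T : Finset W) (hT : #T = n)
    (hqT : ∀ j, q j ⊆ T) (hqπ : ∀ j, q j ⊆ π j) (hπ : ∀ j, π j ∈ parts)
    (p P : Finset W) (hpP : p ⊆ P) (hPp : P ∈ parts) (hpm : #p = m)
    (hadj : ∀ w ∈ p, ∀ x, G.Adj w x → x ∈ T)
    (γ η δ d0 M : ℝ) (hγ : 0 ≤ γ) (hδ0 : 0 < δ) (hdeg : ∀ w, (1 / 2 + γ) * n ≤ #(univ.filter fun x => G.Adj w x))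
    (hM0 : 0 ≤ M) (hM : ∀ P ∈ parts, (#P : ℝ) ≤ M) (hMm : M * δ ^ 2 ≤ m)
    (hP : (#(parts.filter fun P' => P ≠ P' ∧ ¬ G.IsUniform (δ ^ 2) P P') : ℝ) ≤ δ * #parts)
    (hMn : M * #parts ≤ 4 * n) (hMδ : M ≤ 4 * δ * n) (hkm : (1 - η) * n ≤ k * m) (hd0 : 0 ≤ d0)
    (hnum : η + 8 * δ + d0 + δ ^ 2 ≤ γ / 2) :
    (1 / 2 + γ / 2) * k ≤ #(univ.filter fun j => P ≠ π j ∧ G.IsUniform (δ ^ 2) P (π j) ∧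
      d0 ≤ G.edgeDensity P (π j)) := by
  set Rl := univ.filter fun j => P ≠ π j ∧ G.IsUniform (δ ^ 2) P (π j) ∧
      d0 ≤ G.edgeDensity P (π j) with hRl
  set Bd := univ.filter fun j => P = π j ∨ (P ≠ π j ∧ ¬ G.IsUniform (δ ^ 2) P (π j)) with hBd
  have hmR : (0:ℝ) < m := by exact_mod_cast hm
  have hkm' : (k:ℝ) * m ≤ n := by
    have h1 : #((univ : Finset (Fin k)).biUnion q) = k * m := by
      rw [card_fam q m hq hdis, card_univ, Fintype.card_fin]
    have h2 := card_le_card (show univ.biUnion q ⊆ T from fun x hx => by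
      obtain ⟨j, -, hj⟩ := mem_biUnion.1 hx
      exact hqT j hj)
    rw [h1, hT] at h2
    exact_mod_cast h2
  -- bad chunks
  have hBdm : (#Bd : ℝ) * m ≤ 8 * δ * n := by
    have h1 : #(Bd.biUnion q) = #Bd * m := card_fam q m hq hdis Bd
    set Q := insert P (parts.filter fun P' => P ≠ P' ∧ ¬ G.IsUniform (δ ^ 2) P P') with hQ
    have h2 : Bd.biUnion q ⊆ Q.biUnion id := by
      intro x hx
      obtain ⟨j, hj, hxj⟩ := mem_biUnion.1 hx
      refine mem_biUnion.2 ⟨π j, ?_, hqπ j hxj⟩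
      rcases (mem_filter.1 hj).2 with h | h
      · rw [← h]; exact mem_insert_self _ _
      · exact mem_insert_of_mem (mem_filter.2 ⟨hπ j, h⟩)
    have h3 : (#(Q.biUnion id) : ℝ) ≤ ∑ P' ∈ Q, (#P' : ℝ) := by
      exact_mod_cast card_biUnion_le
    have h4 : ∑ P' ∈ Q, (#P' : ℝ) ≤ #Q * M := by
      rw [← nsmul_eq_mul]
      apply sum_le_card_nsmul
      intro P' hP'
      rcases mem_insert.1 hP' with h | h
      · rw [h]; exact hM _ hPp
      · exact hM _ (mem_filter.1 h).1
    have h5 : (#Q : ℝ) ≤ 1 + δ * #parts := by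
      have : #Q ≤ #(parts.filter fun P' => P ≠ P' ∧ ¬ G.IsUniform (δ ^ 2) P P') + 1 := card_insert_le _ _
      have : (#Q : ℝ) ≤ #(parts.filter fun P' => P ≠ P' ∧ ¬ G.IsUniform (δ ^ 2) P P') + 1 := by
        exact_mod_cast this
      linarith
    have h6 : ((#Bd * m : ℕ) : ℝ) ≤ #(Q.biUnion id) := by
      rw [← h1]; exact_mod_cast card_le_card h2
    push_cast at h6
    have h7 : (#Q : ℝ) * M ≤ (1 + δ * #parts) * M := mul_le_mul_of_nonneg_right h5 hM0
    have h8 : (1 + δ * #parts) * M = M + δ * (M * #parts) := by ring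
    have h9 : δ * (M * #parts) ≤ δ * (4 * n) := mul_le_mul_of_nonneg_left hMn hδ0.le
    linarith
  set E : Fin k → ℝ := fun j => ∑ w ∈ p, (#((q j).filter fun x => G.Adj w x) : ℝ) with hE
  have hE1 : ∀ j, E j ≤ m * m := by
    intro j
    have : E j ≤ ∑ w ∈ p, (m : ℝ) := sum_le_sum fun w _ => by
      rw [← hq j]; exact_mod_cast card_filter_le _ _
    rwa [sum_const, nsmul_eq_mul, hpm] at this
  have hE2 : ∀ j, j ∉ Rl → j ∉ Bd → E j ≤ (d0 + δ ^ 2) * (m * m) := by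
    intro j h1 h2
    simp only [hRl, hBd, mem_filter, mem_univ, true_and, not_or, not_and, not_not] at h1 h2
    have hu := h2.2 h2.1
    have hlow := h1 h2.1 hu
    rw [not_le] at hlow
    have h3 := hu (s' := p) hpP (t' := q j) (hqπ j) (by
      rw [hpm]; exact le_trans (mul_le_mul_of_nonneg_right (hM P hPp) (by positivity)) hMm) (by
      rw [hq j]; exact le_trans (mul_le_mul_of_nonneg_right (hM _ (hπ j)) (by positivity)) hMm)
    have h4 := (abs_lt.1 h3).2
    have h5 := dens_sum G p (q j)
    rw [hpm, hq j] at h5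
    simp only [hE]
    rw [← h5]
    apply mul_le_mul_of_nonneg_right _ (by positivity)
    linarith
  have hup : ∑ j, E j ≤ (#Rl + #Bd) * (m * m) + k * ((d0 + δ ^ 2) * (m * m)) := by
    have : ∀ j ∈ (univ : Finset (Fin k)), E j ≤ (if j ∈ Rl then (m * m : ℝ) else 0) +
        (if j ∈ Bd then (m * m : ℝ) else 0) + (d0 + δ ^ 2) * (m * m) := by
      intro j _
      have hnn : (0:ℝ) ≤ (d0 + δ ^ 2) * (m * m) := by positivity
      have hmm : (0:ℝ) ≤ m * m := by positivity
      have := hE1 j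
      by_cases h1 : j ∈ Rl
      · rw [if_pos h1]; split_ifs <;> linarith
      · by_cases h2 : j ∈ Bd
        · rw [if_neg h1, if_pos h2]; linarith
        · rw [if_neg h1, if_neg h2]; have := hE2 j h1 h2; linarith
    refine (sum_le_sum this).trans (le_of_eq ?_)
    rw [sum_add_distrib, sum_add_distrib, ← sum_filter, ← sum_filter, sum_const, sum_const, sum_const]
    simp only [nsmul_eq_mul, card_univ, Fintype.card_fin, filter_mem_eq_inter, univ_inter]
    ring
  have hlo : (m:ℝ) * ((1 / 2 + γ) * n + k * m - n) ≤ ∑ j, E j := by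
    simp only [hE]
    rw [sum_comm, ← hpm, ← nsmul_eq_mul]
    apply card_nsmul_le_sum
    intro w hw
    have h1 := nbr_cover G q m n hq hdis T hT hqT w (hadj w hw)
    have h2 : (#(univ.filter fun x => G.Adj w x) : ℝ) + k * m ≤ n +
      ∑ j, (#((q j).filter fun x => G.Adj w x) : ℝ) := by exact_mod_cast h1
    have h3 := hdeg w
    rw [hpm]
    linarith
  have h1 : (m:ℝ) * ((1 / 2 + γ) * n + k * m - n) ≤ m * (#Rl * m + #Bd * m + (d0 + δ ^ 2) * (k * m)) := by
    refine hlo.trans (hup.trans (le_of_eq (by ring)))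
  have h2 := le_of_mul_le_mul_left h1 hmR
  have h3 : (d0 + δ ^ 2) * (k * m) ≤ (d0 + δ ^ 2) * n := mul_le_mul_of_nonneg_left hkm' (by positivity)
  have h4 : (η + 8 * δ + d0 + δ ^ 2) * n ≤ γ / 2 * n := mul_le_mul_of_nonneg_right hnum (by positivity)
  have h5 : (1 / 2 + γ / 2) * k * m ≤ #Rl * m := by
    have h6 : (1 / 2 + γ / 2) * (k * m) ≤ (1 / 2 + γ / 2) * n :=
      mul_le_mul_of_nonneg_left hkm' (by positivity)
    linarith
  exact le_of_mul_le_mul_right h5 hmR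

end BW
end

section
namespace BW
open Finset
open scoped Classical

structure Clus {W : Type*} [Fintype W] (G : SimpleGraph W) (sW : W → Bool) (n : ℕ) (γ ε η : ℝ)
    (k m : ℕ) (cl : Bool × Fin k → Finset W) (R : Fin k → Fin k → Prop) : Prop where
  k0 : 0 < k
  card : ∀ i, #(cl i) = m
  disj : ∀ i j, i ≠ j → Disjoint (cl i) (cl j)
  side : ∀ i, ∀ w ∈ cl i, sW w = i.1
  big : (1 - η) * n ≤ k * m
  refl : ∀ i, R i i
  dns1 : ∀ i j, R i j → Dns G (ε * m) (γ / 16) (cl (false, i)) (cl (true, j))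
  dns2 : ∀ i j, R i j → Dns G (ε * m) (γ / 16) (cl (true, j)) (cl (false, i))
  deg1 : ∀ i, (1 / 2 + γ / 2) * k ≤ #(univ.filter fun j => R i j)
  deg2 : ∀ j, (1 / 2 + γ / 2) * k ≤ #(univ.filter fun i => R i j)

lemma pickchunks {W : Type*} (C : Finset (Finset W)) (k : ℕ) (hk : k ≤ #C) :
    ∃ ch : Fin k → Finset W, Function.Injective ch ∧ ∀ i, ch i ∈ C := by
  refine ⟨fun i => (C.equivFin.symm (Fin.castLE hk i) : Finset W), ?_, fun i => ?_⟩
  · intro i j h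
    have := C.equivFin.symm.injective (Subtype.ext h)
    exact Fin.castLE_injective hk this
  · exact (C.equivFin.symm (Fin.castLE hk i)).2

set_option maxHeartbeats 1000000 in
lemma clusters_aux {W : Type*} [Fintype W] (G : SimpleGraph W) (sW : W → Bool) (n : ℕ)
    (hn : ∀ s, #(univ.filter fun w => sW w = s) = n) (hbip : ∀ u v, G.Adj u v → sW u ≠ sW v)
    (γ ε η μ δ : ℝ) (hγ : 0 < γ) (hγ1 : γ ≤ 1) (hε : 0 < ε) (hη : η ≤ 1 / 2) (hμ : 0 < μ) (hδ : 0 < δ) (hδ1 : δ ≤ 1)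
    (hμδ : μ + 4 * δ ≤ η) (hδε : 8 * δ ^ 2 ≤ ε * μ) (hδμ : 8 * δ ^ 2 ≤ μ)
    (hnum : η + 8 * δ + γ / 8 + δ ^ 2 ≤ γ / 2) (hδγ : δ ^ 2 ≤ γ / 16)
    (hdeg : ∀ w, (1 / 2 + γ) * n ≤ #(univ.filter fun x => G.Adj w x))
    (P : Finpartition (univ : Finset W)) (hPe : P.IsEquipartition) (hPu : P.IsUniform G (δ ^ 2))
    (hK1 : 1 ≤ δ * #P.parts) (hKn : #P.parts ≤ 2 * n) (hKμ : 2 * #P.parts ≤ μ * n) :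
    ∃ k m cl R, Clus G sW n γ ε η k m cl R ∧ (k : ℝ) * μ ≤ 2 * #P.parts := by
  set K : ℝ := (#P.parts : ℝ) with hK
  have hK0 : 0 < K := by
    by_contra h
    push Not at h
    nlinarith
  have hK0' : 0 < #P.parts := by
    have : (0:ℝ) < #P.parts := hK0
    exact_mod_cast this
  have hn0 : (0:ℝ) < n := by
    by_contra h
    push Not at h
    nlinarith
  set m := ⌊μ * n / K⌋₊ with hm
  have hx2 : 2 ≤ μ * n / K := by rw [le_div_iff₀ hK0]; linarith
  have hm2 : (m:ℝ) ≤ μ * n / K := Nat.floor_le (by linarith)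
  have hm1 : μ * n / K ≤ 2 * m := by
    have := Nat.lt_floor_add_one (μ * n / K)
    rw [← hm] at this
    linarith
  have hmR : (0:ℝ) < m := by linarith
  have hm0 : 0 < m := by exact_mod_cast hmR
  have hcardW : #(univ : Finset W) = 2 * n := by
    rw [← card_filter_add_card_filter_not (s := (univ : Finset W)) (fun w => sW w = true), hn true]
    have : (univ.filter fun w => ¬ sW w = true) = univ.filter fun w => sW w = false := by
      ext w; simp
    rw [this, hn false]; ring
  set M : ℝ := 4 * n / K with hM
  have hMK : M * K = 4 * n := by rw [hM]; field_simp
  have hM0 : 0 ≤ M := by positivity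
  have hpart : ∀ p ∈ P.parts, (#p : ℝ) ≤ M := by
    intro p hp
    have h1 := hPe.card_part_le_average_add_one hp
    rw [hcardW] at h1
    have h2 : (#p : ℝ) ≤ ((2 * n / #P.parts : ℕ) : ℝ) + 1 := by exact_mod_cast h1
    have h3 : ((2 * n / #P.parts : ℕ) : ℝ) ≤ (2 * n : ℕ) / (#P.parts : ℕ) := Nat.cast_div_le
    push_cast at h3
    rw [← hK] at h3
    have h4 : (1:ℝ) ≤ 2 * n / K := by
      rw [le_div_iff₀ hK0, one_mul, hK]
      exact_mod_cast hKn
    have h5 : M = 2 * n / K + 2 * n / K := by rw [hM]; ring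
    linarith
  set gd : Finset (Finset W) := P.parts.filter fun p =>
    (#(P.parts.filter fun p' => p ≠ p' ∧ ¬ G.IsUniform (δ ^ 2) p p') : ℝ) ≤ δ * K with hgd
  have hbadc := bad_parts G P δ hδ hPu
  rw [← hK] at hbadc
  have hCex := fun s => chunks gd (univ.filter fun w => sW w = s) m hm0
  choose C hCd hCp hCc using hCex
  have hsize : ∀ s, (1 - η) * n ≤ m * (#(C s) : ℝ) := by
    intro s
    have h1 : n ≤ #((univ.filter fun w => sW w = s).filter fun v => ∃ p ∈ gd, v ∈ p) +
        #((P.parts.filter fun p => ¬ (#(P.parts.filter fun p' => p ≠ p' ∧ ¬ G.IsUniform (δ ^ 2) p p') : ℝ) ≤ δ * K).biUnion id) := by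
      rw [← hn s]
      refine le_trans (card_le_card ?_) (card_union_le _ _)
      intro v hv
      rw [mem_union, mem_filter, mem_biUnion]
      have hvu : v ∈ P.parts.biUnion id := by rw [P.biUnion_parts]; exact mem_univ v
      obtain ⟨p, hp, hvp⟩ := mem_biUnion.1 hvu
      by_cases h : p ∈ gd
      · exact Or.inl ⟨hv, p, h, hvp⟩
      · right
        refine ⟨p, mem_filter.2 ⟨hp, fun h' => h (mem_filter.2 ⟨hp, h'⟩)⟩, hvp⟩
    have h2 : (#((P.parts.filter fun p => ¬ (#(P.parts.filter fun p' => p ≠ p' ∧ ¬ G.IsUniform (δ ^ 2) p p') : ℝ) ≤ δ * K).biUnion id) : ℝ) ≤ δ * K * M := by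
      refine le_trans (by exact_mod_cast card_biUnion_le) (?_ : ∑ p ∈ _, (#p : ℝ) ≤ _)
      refine le_trans (sum_le_card_nsmul _ _ M fun p hp => hpart p (mem_filter.1 hp).1) ?_
      rw [nsmul_eq_mul]
      exact mul_le_mul_of_nonneg_right hbadc hM0
    have h3 : (#((univ.filter fun w => sW w = s).filter fun v => ∃ p ∈ gd, v ∈ p) : ℝ) ≤
      m * #(C s) + m * #gd := by exact_mod_cast hCc s
    have h4 : (m:ℝ) * #gd ≤ μ * n := by
      have : (#gd : ℝ) ≤ K := by rw [hK]; exact_mod_cast card_filter_le _ _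
      calc (m:ℝ) * #gd ≤ (μ * n / K) * K := mul_le_mul hm2 this (by positivity) (by positivity)
        _ = μ * n := by field_simp
    have h1' : (n:ℝ) ≤ #((univ.filter fun w => sW w = s).filter fun v => ∃ p ∈ gd, v ∈ p) +
        #((P.parts.filter fun p => ¬ (#(P.parts.filter fun p' => p ≠ p' ∧ ¬ G.IsUniform (δ ^ 2) p p') : ℝ) ≤ δ * K).biUnion id) := by
      exact_mod_cast h1
    have h5 : δ * K * M = 4 * δ * n := by rw [mul_assoc, mul_comm K M, hMK]; ring
    have h6 : (μ + 4 * δ) * n ≤ η * n := mul_le_mul_of_nonneg_right hμδ hn0.le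
    linarith
  set k := min #(C false) #(C true) with hk
  have hkC : ∀ s, k ≤ #(C s) := by
    intro s; cases s
    · exact min_le_left _ _
    · exact min_le_right _ _
  choose ch hchi hchC using fun s => pickchunks (C s) k (hkC s)
  have hkm : (1 - η) * n ≤ k * m := by
    rw [mul_comm (k:ℝ)]
    rcases min_choice #(C false) #(C true) with h | h
    · rw [hk, h]; exact hsize false
    · rw [hk, h]; exact hsize true
  have hk0 : 0 < k := by
    by_contra h
    have : k = 0 := by omega
    rw [this] at hkm
    simp at hkm
    nlinarith
  have hcm : ∀ s i, #(ch s i) = m := fun s i => (hCp s _ (hchC s i)).1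
  have hcs : ∀ s i, ch s i ⊆ univ.filter fun w => sW w = s := fun s i => (hCp s _ (hchC s i)).2.1
  have hcp : ∀ s i, ∃ p ∈ gd, ch s i ⊆ p := fun s i => (hCp s _ (hchC s i)).2.2
  choose π hπ hcπ using hcp
  have hπ' : ∀ s i, π s i ∈ P.parts := fun s i => (mem_filter.1 (hπ s i)).1
  have hcd : ∀ s i j, i ≠ j → Disjoint (ch s i) (ch s j) := fun s i j h =>
    hCd s _ (hchC s i) _ (hchC s j) (fun h' => h (hchi s h'))
  have hkmn : (k:ℝ) * m ≤ n := by
    have h1 : #((univ : Finset (Fin k)).biUnion (ch true)) = k * m := by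
      rw [card_fam (ch true) m (hcm true) (hcd true), card_univ, Fintype.card_fin]
    have h2 := card_le_card (show univ.biUnion (ch true) ⊆ univ.filter fun w => sW w = true from fun x hx => by
      obtain ⟨j, -, hj⟩ := mem_biUnion.1 hx
      exact hcs true j hj)
    rw [h1, hn] at h2
    exact_mod_cast h2
  have hMδ : M * δ ^ 2 ≤ m := by
    have : M * δ ^ 2 = (8 * δ ^ 2) * n / K / 2 := by rw [hM]; ring
    rw [this]
    have : (8 * δ ^ 2) * n / K ≤ μ * n / K := by gcongr
    linarith
  have hMε : M * δ ^ 2 ≤ ε * m := by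
    have : M * δ ^ 2 = (8 * δ ^ 2) * n / K / 2 := by rw [hM]; ring
    rw [this]
    have h1 : (8 * δ ^ 2) * n / K ≤ (ε * μ) * n / K := by gcongr
    have h2 : (ε * μ) * n / K = ε * (μ * n / K) := by ring
    have h3 : ε * (μ * n / K) ≤ ε * (2 * m) := by gcongr
    linarith
  have hMδn : M ≤ 4 * δ * n := by
    rw [hM, div_le_iff₀ hK0]
    nlinarith
  have hrd : ∀ s i, (1 / 2 + γ / 2) * k ≤ #(univ.filter fun j => π s i ≠ π (!s) j ∧
      G.IsUniform (δ ^ 2) (π s i) (π (!s) j) ∧ γ / 8 ≤ G.edgeDensity (π s i) (π (!s) j)) := by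
    intro s i
    have := red_deg G P.parts (ch (!s)) (π (!s)) m n hm0 (hcm _) (hcd _)
      (univ.filter fun w => sW w = !s) (hn _) (hcs _) (hcπ _) (hπ' _) (ch s i) (π s i) (hcπ s i)
      (hπ' s i) (hcm s i) (by
        intro w hw x hwx
        have h1 := (mem_filter.1 (hcs s i hw)).2
        have h2 := hbip w x hwx
        rw [h1] at h2
        exact mem_filter.2 ⟨mem_univ _, Bool.eq_not_of_ne h2.symm⟩) γ η δ (γ / 8) M hγ.le hδ hdeg hM0 hpart hMδ
      (mem_filter.1 (hπ s i)).2 hMK.le hMδn hkm (by positivity) hnum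
    convert this using 2
  obtain ⟨Rr, hRr⟩ : ∃ Rr : Finset W → Finset W → Prop, ∀ p p', Rr p p' ↔
      (p ≠ p' ∧ G.IsUniform (δ ^ 2) p p' ∧ γ / 8 ≤ G.edgeDensity p p') := ⟨_, fun _ _ => Iff.rfl⟩
  have hRs : ∀ p p', Rr p p' → Rr p' p := by
    intro p p' h
    rw [hRr] at h ⊢
    refine ⟨h.1.symm, h.2.1.symm, ?_⟩
    rw [G.edgeDensity_comm]; exact h.2.2
  have hdeg1 : ∀ i, (1 / 2 + γ / 2) * k ≤ #(univ.filter fun j => Rr (π false i) (π true j)) := by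
    intro i
    refine (hrd false i).trans (le_of_eq ?_)
    congr 2
    ext j
    rw [mem_filter, mem_filter, hRr]
    rfl
  have hdeg2 : ∀ j, (1 / 2 + γ / 2) * k ≤ #(univ.filter fun i => Rr (π false i) (π true j)) := by
    intro j
    refine (hrd true j).trans (le_of_eq ?_)
    congr 2
    ext i
    rw [mem_filter, mem_filter, show Rr (π false i) (π true j) ↔ Rr (π true j) (π false i) from
      ⟨hRs _ _, hRs _ _⟩, hRr]
    rfl
  have hhalf : ∀ x : ℕ, (1 / 2 + γ / 2) * k ≤ x → k ≤ 2 * x := by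
    intro x hx
    have : (0:ℝ) ≤ γ / 2 * k := by positivity
    have : (k:ℝ) ≤ 2 * x := by linarith
    exact_mod_cast this
  obtain ⟨f, hf, hfR⟩ := hallmatch k (fun i j => Rr (π false i) (π true j))
    (fun i => hhalf _ (hdeg1 i)) (fun j => hhalf _ (hdeg2 j))
  have hdns : ∀ s i j, Rr (π s i) (π (!s) j) → Dns G (ε * m) (γ / 16) (ch s i) (ch (!s) j) := by
    intro s i j h
    rw [hRr] at h
    exact dns_of_uniform G (π s i) (π (!s) j) _ _ (hcπ _ _) (hcπ _ _) (δ ^ 2) (ε * m) (γ / 16) (γ / 8)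
      h.2.1 h.2.2 (by linarith) (by positivity)
      ((mul_le_mul_of_nonneg_right (hpart _ (hπ' _ _)) (by positivity)).trans hMε)
      ((mul_le_mul_of_nonneg_right (hpart _ (hπ' _ _)) (by positivity)).trans hMε)
  set cl : Bool × Fin k → Finset W := fun x => if x.1 then ch true (f x.2) else ch false x.2 with hcl
  refine ⟨k, m, cl, fun i j => Rr (π false i) (π true (f j)),
    ⟨hk0, ?_, ?_, ?_, hkm, hfR, ?_, ?_, fun i => ?_, fun j => hdeg2 (f j)⟩, ?_⟩
  · rintro ⟨s, i⟩
    cases s <;> simp [hcl, hcm]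
  · rintro ⟨s, i⟩ ⟨t, j⟩ hij
    by_cases hst : s = t
    · subst hst
      have hij' : i ≠ j := fun h => hij (by rw [h])
      cases s
      · simpa [hcl] using hcd false i j hij'
      · simpa [hcl] using hcd true (f i) (f j) (fun h => hij' (hf.1 h))
    · rw [disjoint_left]
      intro x hx hx'
      apply hst
      cases s <;> cases t <;> simp only [hcl] at hx hx'
      · rfl
      · have h1 := (mem_filter.1 (hcs _ _ hx)).2
        have h2 := (mem_filter.1 (hcs _ _ hx')).2
        rw [← h1, ← h2]
      · have h1 := (mem_filter.1 (hcs _ _ hx)).2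
        have h2 := (mem_filter.1 (hcs _ _ hx')).2
        rw [← h1, ← h2]
      · rfl
  · rintro ⟨s, i⟩ w hw
    cases s
    · exact (mem_filter.1 (hcs false i (by simpa [hcl] using hw))).2
    · exact (mem_filter.1 (hcs true (f i) (by simpa [hcl] using hw))).2
  · intro i j h
    exact hdns false i (f j) h
  · intro i j h
    exact hdns true (f j) i (hRs _ _ h)
  · refine (hdeg1 i).trans ?_
    have : #(univ.filter fun j => Rr (π false i) (π true j)) ≤
        #(univ.filter fun j => Rr (π false i) (π true (f j))) := by
      rw [← card_image_of_injective (univ.filter fun j => Rr (π false i) (π true (f j))) hf.1]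
      apply card_le_card
      intro x hx
      obtain ⟨y, rfl⟩ := hf.2 x
      exact mem_image.2 ⟨y, mem_filter.2 ⟨mem_univ _, (mem_filter.1 hx).2⟩, rfl⟩
    exact_mod_cast this
  · have h1 : (k:ℝ) * (μ * n / K) ≤ 2 * n := by
      calc (k:ℝ) * (μ * n / K) ≤ k * (2 * m) := by gcongr
        _ ≤ 2 * n := by linarith
    have h2 : (k:ℝ) * (μ * n / K) = (k * μ) * n / K := by ring
    rw [h2, div_le_iff₀ hK0] at h1
    have : (k * μ) * n ≤ (2 * K) * n := by linarith
    exact le_of_mul_le_mul_right this hn0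

theorem clusters (γ ε η : ℝ) (hγ : 0 < γ) (hγ1 : γ ≤ 1) (hε : 0 < ε) (hη : 0 < η) :
    ∃ Kmax n1 : ℕ, ∀ n, n1 ≤ n → ∀ (W : Type) [Fintype W] (G : SimpleGraph W) (sW : W → Bool),
      (∀ s, #(univ.filter fun w => sW w = s) = n) → (∀ u v, G.Adj u v → sW u ≠ sW v) →
      (∀ w, (1 / 2 + γ) * n ≤ #(univ.filter fun x => G.Adj w x)) →
      ∃ k m cl R, Clus G sW n γ ε η k m cl R ∧ k ≤ Kmax := by
  obtain ⟨η1, hη1, h1, h2, h3⟩ : ∃ η1 : ℝ, 0 < η1 ∧ η1 ≤ η ∧ η1 ≤ γ / 8 ∧ η1 ≤ 1 / 2 :=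
    ⟨min η (min (γ / 8) (1 / 2)), by positivity, min_le_left _ _,
      (min_le_right _ _).trans (min_le_left _ _), (min_le_right _ _).trans (min_le_right _ _)⟩
  obtain ⟨δ, hδ, hd1, hd2, hd3, hd4⟩ : ∃ δ : ℝ, 0 < δ ∧ δ ≤ η1 / 16 ∧ δ ≤ γ / 100 ∧
      δ ≤ ε * (η1 / 2) / 8 ∧ δ ≤ 1 :=
    ⟨min (η1 / 16) (min (γ / 100) (min (ε * (η1 / 2) / 8) 1)), by positivity, min_le_left _ _,
      (min_le_right _ _).trans (min_le_left _ _),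
      (min_le_right _ _).trans ((min_le_right _ _).trans (min_le_left _ _)),
      (min_le_right _ _).trans ((min_le_right _ _).trans (min_le_right _ _))⟩
  have hδ2 : δ ^ 2 ≤ δ := by nlinarith
  set μ := η1 / 2 with hμ
  have hμ0 : 0 < μ := by positivity
  set l := ⌈1 / δ⌉₊ with hl
  set bd := SzemerediRegularity.bound (δ ^ 2) l with hbd
  refine ⟨⌈2 * bd / μ⌉₊, ⌈2 * bd / μ⌉₊ + bd + l, ?_⟩
  intro n hn W _ G sW hsn hbip hdeg
  have hcardW : Fintype.card W = 2 * n := by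
    rw [← card_univ, ← card_filter_add_card_filter_not (s := (univ : Finset W)) (fun w => sW w = true), hsn true]
    have : (univ.filter fun w => ¬ sW w = true) = univ.filter fun w => sW w = false := by
      ext w; simp
    rw [this, hsn false]; ring
  obtain ⟨P, hPe, hPl, hPb, hPu⟩ := szemeredi_regularity G (ε := δ ^ 2) (l := l) (by positivity)
    (by rw [hcardW]; omega)
  have hb1 : 2 * bd / μ ≤ n := by
    refine (Nat.le_ceil _).trans ?_
    exact_mod_cast (show ⌈2 * bd / μ⌉₊ ≤ n by omega)
  rw [div_le_iff₀ hμ0] at hb1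
  have hPb' : (#P.parts : ℝ) ≤ bd := by exact_mod_cast hPb
  obtain ⟨k, m, cl, R, hC, hkμ⟩ := clusters_aux G sW n hsn hbip γ ε η1 μ δ hγ hγ1 hε h3 hμ0 hδ hd4
    (by linarith) (by linarith) (by linarith) (by linarith) (by linarith) hdeg P hPe hPu
    (by
      have h5 : 1 / δ ≤ #P.parts := (Nat.le_ceil _).trans (by exact_mod_cast hPl)
      rw [div_le_iff₀ hδ] at h5
      linarith) (by omega) (by linarith)
  refine ⟨k, m, cl, R, ?_, ?_⟩
  · exact ⟨hC.k0, hC.card, hC.disj, hC.side, le_trans (mul_le_mul_of_nonneg_right (by linarith)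
      (by positivity)) hC.big, hC.refl, hC.dns1, hC.dns2, hC.deg1, hC.deg2⟩
  · have : (k:ℝ) ≤ 2 * bd / μ := by rw [le_div_iff₀ hμ0]; linarith
    exact_mod_cast this.trans (Nat.le_ceil _)

end BW
end

section
namespace BW
open Finset
open scoped Classical

lemma card_two {W : Type*} [Fintype W] (sW : W → Bool) (n : ℕ)
    (hn : ∀ s, #(univ.filter fun w => sW w = s) = n) : Fintype.card W = 2 * n := by
  rw [← card_univ, ← card_filter_add_card_filter_not (s := (univ : Finset W)) (fun w => sW w = true), hn true]
  have : (univ.filter fun w => ¬ sW w = true) = univ.filter fun w => sW w = false := by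
    ext w; simp
  rw [this, hn false]; ring

/-- every vertex is dense to many clusters -/
lemma many_dense {W : Type*} [Fintype W] {G : SimpleGraph W} {sW : W → Bool} {n : ℕ} {γ ε η : ℝ}
    {k m : ℕ} {cl : Bool × Fin k → Finset W} {R : Fin k → Fin k → Prop} (hC : Clus G sW n γ ε η k m cl R)
    (hm : 0 < m) (hγ : 0 < γ) (hη : η ≤ γ / 4) (hn : ∀ s, #(univ.filter fun w => sW w = s) = n)
    (hbip : ∀ u v, G.Adj u v → sW u ≠ sW v)
    (hdeg : ∀ w, (1 / 2 + γ) * n ≤ #(univ.filter fun x => G.Adj w x)) (h : W) :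
    (1 / 2 + γ / 2) * k ≤ #(univ.filter fun i : Fin k =>
      γ / 4 * m ≤ #((cl (!(sW h), i)).filter fun x => G.Adj h x)) := by
  set A := univ.filter fun i : Fin k =>
      γ / 4 * m ≤ #((cl (!(sW h), i)).filter fun x => G.Adj h x) with hA
  have hdis : ∀ i j, i ≠ j → Disjoint (cl (!(sW h), i)) (cl (!(sW h), j)) := fun i j hij =>
    hC.disj _ _ (fun h' => hij (Prod.ext_iff.1 h').2)
  have h1 := nbr_cover G (fun i => cl (!(sW h), i)) m n (fun i => hC.card _) hdis
    (univ.filter fun w => sW w = !(sW h)) (hn _)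
    (fun j w hw => mem_filter.2 ⟨mem_univ _, hC.side _ w hw⟩) h
    (fun x hx => mem_filter.2 ⟨mem_univ _, Bool.eq_not_of_ne (hbip _ _ hx).symm⟩)
  have h1' : (#(univ.filter fun x => G.Adj h x) : ℝ) + k * m ≤ n +
      ∑ j, (#((cl (!(sW h), j)).filter fun x => G.Adj h x) : ℝ) := by exact_mod_cast h1
  have h2 : ∑ j, (#((cl (!(sW h), j)).filter fun x => G.Adj h x) : ℝ) ≤ #A * m + k * (γ / 4 * m) := by
    have : ∀ j ∈ (univ : Finset (Fin k)), (#((cl (!(sW h), j)).filter fun x => G.Adj h x) : ℝ) ≤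
        (if j ∈ A then (m:ℝ) else 0) + γ / 4 * m := by
      intro j _
      by_cases hj : j ∈ A
      · rw [if_pos hj]
        have h3 : (#((cl (!(sW h), j)).filter fun x => G.Adj h x) : ℝ) ≤ m := by
          rw [← hC.card (!(sW h), j)]; exact_mod_cast card_filter_le _ _
        have : 0 ≤ γ / 4 * m := by positivity
        linarith
      · rw [if_neg hj, zero_add]
        simp only [hA, mem_filter, mem_univ, true_and, not_le] at hj
        exact hj.le
    refine (sum_le_sum this).trans (le_of_eq ?_)
    rw [sum_add_distrib, ← sum_filter, sum_const, sum_const]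
    simp only [nsmul_eq_mul, card_univ, Fintype.card_fin, filter_mem_eq_inter, univ_inter]
  have hkm' : (k:ℝ) * m ≤ n := by
    have e1 : #((univ : Finset (Fin k)).biUnion fun i => cl (true, i)) = k * m := by
      rw [card_fam (fun i => cl (true, i)) m (fun i => hC.card _) (fun i j hij =>
        hC.disj _ _ (fun h' => hij (Prod.ext_iff.1 h').2)), card_univ, Fintype.card_fin]
    have e2 := card_le_card (show (univ.biUnion fun i => cl (true, i)) ⊆ univ.filter fun w => sW w = true from fun x hx => by
      obtain ⟨j, -, hj⟩ := mem_biUnion.1 hx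
      exact mem_filter.2 ⟨mem_univ _, hC.side _ x hj⟩)
    rw [e1, hn] at e2
    exact_mod_cast e2
  have h3 := hdeg h
  have h4 := hC.big
  have hmR : (0:ℝ) < m := by exact_mod_cast hm
  have h5 : (1 / 2 + γ / 2) * k * m ≤ #A * m := by
    have h6 : (1 / 2 + γ / 2 + γ / 4) * (k * m) ≤ (1 / 2 + γ / 2 + γ / 4) * n :=
      mul_le_mul_of_nonneg_left hkm' (by positivity)
    have h7 : η * n ≤ γ / 4 * n := mul_le_mul_of_nonneg_right hη (by positivity)
    linarith
  exact le_of_mul_le_mul_right h5 hmR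

lemma window_count {V : Type*} [Fintype V] (τ : V → ℕ) (hf : ∀ t, #(univ.filter fun v => τ v = t) ≤ 4)
    (T : Finset V) (t b : ℕ) (hT : ∀ v ∈ T, t ≤ τ v + b ∧ τ v ≤ t) : #T ≤ 4 * (b + 1) := by
  have h := card_le_mul_card_image_of_maps_to (f := τ) (s := T) (t := Icc (t - b) t) (fun v hv => by
    have := hT v hv
    rw [mem_Icc]; omega) 4 (fun a _ => (card_le_card (fun v hv => by
      simp only [mem_filter, mem_univ, true_and] at hv ⊢
      exact hv.2)).trans (hf a))
  refine h.trans ?_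
  rw [Nat.card_Icc]
  omega

set_option maxHeartbeats 2000000 in
theorem assemble {V W : Type} [Fintype V] [Fintype W] (H : SimpleGraph V) (G : SimpleGraph W)
    (sV : V → Bool) (sW : W → Bool) (n : ℕ) (hn0 : 0 < n)
    (hnV : ∀ s, #(univ.filter fun v => sV v = s) = n) (hnW : ∀ s, #(univ.filter fun w => sW w = s) = n)
    (hbipH : ∀ u v, H.Adj u v → sV u ≠ sV v) (hbipG : ∀ u v, G.Adj u v → sW u ≠ sW v)
    (Δ : ℕ) (hdegH : ∀ v, #(univ.filter fun u => H.Adj v u) ≤ Δ)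
    {γ ε η : ℝ} (hdegG : ∀ w, (1 / 2 + γ) * n ≤ #(univ.filter fun x => G.Adj w x))
    {k m : ℕ} {cl : Bool × Fin k → Finset W} {R : Fin k → Fin k → Prop} (hC : Clus G sW n γ ε η k m cl R)
    {b Λ NZ ND : ℕ} {err : ℝ} {τ : V → ℕ} {idx : V → Fin k} {Z D : Finset V}
    (hA : Assign H sV k R n b Λ NZ ND err τ idx Z D)
    (hγ : 0 < γ) (hγ1 : γ ≤ 1) (hε : 0 < ε) (hη : η ≤ γ / 4) (hm : 0 < m) (κ ηb θ ρ : ℝ)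
    (hE : (4 * Λ : ℝ) / k + err ≤ κ * m) (hall : ηb * m + (((n:ℝ) - NZ) / k + err) ≤ m)
    (hηb0 : 0 ≤ ηb) (hηb1 : ηb ≤ 1) (h1 : ε ≤ (γ / 16) ^ Δ * ηb)
    (h2 : ε ≤ θ * ((γ / 16) ^ Δ - κ - Δ * ε)) (hθ0 : 0 ≤ θ) (hθ1 : θ ≤ 1)
    (hpos : 0 < (γ / 16) ^ Δ - κ - Δ * ε) (hΔθ : Δ * θ ≤ γ / 2)
    (h3 : ρ ≤ γ / 4 - κ - Δ * ε - ε) (h4 : ρ ≤ (γ / 16) ^ Δ * (γ / 16) ^ Δ - κ - Δ * ε)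
    (hem : ε ≤ (γ / 16) ^ Δ * (γ / 16) ^ Δ) (hρ0 : 0 < ρ) (hρ1 : ρ ≤ 1)
    (h5 : Δ * (ε * m) + 4 * (b + 1) < (γ / 16) ^ Δ * (ηb * m))
    (h6 : err ≤ ND / k / 2) (r₀ : ℕ) (h7 : (r₀ : ℝ) ≤ γ * ND / 4)
    (hnum : (2 * n : ℝ) * (2 * n) * 2 ^ (2 * NZ) * (1 - ρ ^ (Δ + 1) / 2) ^ r₀ < 1) :
    ∃ g : H →g G, Function.Injective g := by
  have hmR : (0:ℝ) < m := by exact_mod_cast hm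
  have hk0 := hC.k0
  have hkR : (0:ℝ) < k := by exact_mod_cast hk0
  set dΔ := (γ / 16) ^ Δ with hdΔ
  have hdΔ0 : 0 < dΔ := by positivity
  have hdΔ1 : dΔ ≤ 1 := pow_le_one₀ (by positivity) (by linarith)
  have hηm : ηb * m ≤ m := by nlinarith
  set φ : V → Bool × Fin k := fun v => (sV v, idx v) with hφ
  set old : V → Finset V := fun u => if τ u < Λ then ∅ else
    univ.filter fun v => v ∉ Z ∧ τ v + b < τ u with hold
  set base : V → ℝ := fun u => if τ u < Λ then (m:ℝ) else ηb * m with hbase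
  have hDns : ∀ s i j, (if s then R j i else R i j) → Dns G (ε * m) (γ / 16) (cl (s, i)) (cl (!s, j)) := by
    intro s i j h
    cases s
    · exact hC.dns1 i j h
    · exact hC.dns2 j i h
  set X : Ctx V W (Bool × Fin k) :=
    { H := H, G := G, φ := φ, cl := cl, old := old, base := base, d := γ / 16, e := ε * m, Δ := Δ
      hd0 := by positivity
      hd1 := by linarith
      he := by positivity
      hdeg := hdegH
      hdns := by
        intro u v huv
        have hs := hbipH u v huv
        have hsv : sV v = !(sV u) := Bool.eq_not_of_ne hs.symm
        have := hDns (sV u) (idx u) (idx v) (by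
          cases hu : sV u
          · rw [hu] at hsv
            exact hA.red u v huv hu hsv
          · rw [hu] at hsv
            exact hA.red v u huv.symm hsv hu)
        simp only [hφ, hsv]
        exact this
      hcl := hC.disj
      hbase0 := by
        intro u
        simp only [hbase]
        split_ifs <;> positivity
      hbase := by
        intro u
        simp only [hbase]
        rw [← hdΔ]
        split_ifs
        · nlinarith
        · nlinarith
      hold := by
        intro u
        rw [hC.card]
        simp only [hbase, hold]
        split_ifs with hu
        · simp
        · have h8 := hA.all (sV u) (idx u)
          have h9 : #((univ.filter fun v => v ∉ Z ∧ τ v + b < τ u).filter fun v => φ v = φ u) ≤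
              #((univ.filter fun v => sV v = sV u ∧ v ∉ Z).filter fun v => idx v = idx u) := by
            apply card_le_card
            intro v hv
            simp only [mem_filter, mem_univ, true_and, hφ, Prod.mk.injEq] at hv ⊢
            exact ⟨⟨hv.2.1, hv.1.1⟩, hv.2.2⟩
          have h9' : (#((univ.filter fun v => v ∉ Z ∧ τ v + b < τ u).filter fun v => φ v = φ u) : ℝ) ≤
              #((univ.filter fun v => sV v = sV u ∧ v ∉ Z).filter fun v => idx v = idx u) := by
            exact_mod_cast h9
          linarith } with hX
  have hS1 : ∀ x ∈ (Z.biUnion X.N ∪ D.biUnion fun c => insert c (X.N c)), τ x + 2 * (b + 1) < Λ := by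
    intro x hx
    rcases mem_union.1 hx with hx | hx
    · obtain ⟨c, hc, hxc⟩ := mem_biUnion.1 hx
      have := hA.cen c (mem_union_left _ hc)
      have := hA.edge x c ((X.mem_N c x).1 hxc).symm
      omega
    · obtain ⟨c, hc, hxc⟩ := mem_biUnion.1 hx
      have := hA.cen c (mem_union_right _ hc)
      rcases mem_insert.1 hxc with rfl | hxc
      · omega
      · have := hA.edge x c ((X.mem_N c x).1 hxc).symm
        omega
  have hload : ∀ (T : Finset V) i, (∀ v ∈ T, τ v < Λ ∧ φ v = i) → (#T : ℝ) ≤ κ * m := by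
    rintro T ⟨s, i⟩ hT
    refine le_trans ?_ ((hA.early s i).trans hE)
    have : #T ≤ #((univ.filter fun v => sV v = s ∧ τ v < Λ).filter fun v => idx v = i) := by
      apply card_le_card
      intro v hv
      have := hT v hv
      simp only [mem_filter, mem_univ, true_and, hφ, Prod.mk.injEq] at this ⊢
      exact ⟨⟨this.2.1, this.1⟩, this.2.2⟩
    exact_mod_cast this
  have hst1 : X.St1 (Z.biUnion X.N ∪ D.biUnion fun c => insert c (X.N c)) (m:ℝ) (κ * m) := by
    refine ⟨?_, ?_, ?_, ?_, ?_⟩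
    · intro u x hx hux
      have := hS1 x hx
      have := hA.edge u x hux
      exact if_pos (by omega)
    · intro i
      apply hload _ i
      intro v hv
      have := hS1 v (mem_filter.1 hv).1
      exact ⟨by omega, (mem_filter.1 hv).2⟩
    · intro x hx
      have := hS1 x hx
      have h8 : X.base x = m := if_pos (by omega)
      rw [h8]
    · intro i
      exact (congrArg _ (hC.card i)).le
    · have : dΔ * m - κ * m - Δ * (ε * m) = (dΔ - κ - Δ * ε) * m := by ring
      change 0 < dΔ * m - κ * m - Δ * (ε * m)
      rw [this]
      positivity
  set Q : V → Finset (Bool × Fin k) := fun z =>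
    (univ.filter fun j : Fin k => if sV z then R (idx z) j else R j (idx z)).image fun j => (sV z, j) with hQ
  have hφx : ∀ c ∈ Z ∪ D, ∀ x ∈ X.N c, X.φ x = (!(sV c), idx c) := by
    intro c hc x hx
    have hcx := (X.mem_N c x).1 hx
    have h8 : sV x = !(sV c) := Bool.eq_not_of_ne (hbipH c x hcx).symm
    have h9 := hA.nbr c hc x hcx
    exact Prod.ext h8 h9
  have hQcard : ∀ z, (1 / 2 + γ / 2) * k ≤ #(Q z) := by
    intro z
    simp only [hQ]
    rw [card_image_of_injective _ (fun i j hij => (Prod.ext_iff.1 hij).2)]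
    cases hz : sV z
    · simpa using hC.deg2 (idx z)
    · simpa using hC.deg1 (idx z)
  have hWcard := card_two sW n hnW
  have hVcard := card_two sV n hnV
  have hWne : Nonempty W := by
    rw [← Fintype.card_pos_iff, hWcard]; omega
  obtain ⟨w₀⟩ := hWne
  refine core X sV sW Prod.fst (fun s => by rw [hnV, hnW]) (fun v => rfl) hC.side hbipH hA.disj hst1 hmR.le
    hA.far Q ?_ (fun i => (congrArg _ (hC.card i)).ge) θ hθ1 ?_ hθ0 (γ / 4) ρ hρ0 hρ1 ?_ ?_ ?_ (fun _ => w₀) τ b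
    ?_ hA.edge ?_ r₀ ?_ ?_
  · intro z hz q hq x hx
    rw [hφx z (mem_union_left _ hz) x hx]
    obtain ⟨j, hj, rfl⟩ := mem_image.1 hq
    have hj' := (mem_filter.1 hj).2
    have := hDns (!(sV z)) (idx z) j (by
      cases hz : sV z <;> simpa [hz] using hj')
    rw [Bool.not_not] at this
    exact this
  · change ε * m ≤ θ * (dΔ * m - κ * m - Δ * (ε * m))
    have : θ * (dΔ * m - κ * m - Δ * (ε * m)) = (θ * (dΔ - κ - Δ * ε)) * m := by ring
    rw [this]
    exact mul_le_mul_of_nonneg_right h2 hmR.le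
  · change ρ * m ≤ γ / 4 * m - κ * m - Δ * (ε * m) - ε * m
    have : γ / 4 * m - κ * m - Δ * (ε * m) - ε * m = (γ / 4 - κ - Δ * ε - ε) * m := by ring
    rw [this]
    exact mul_le_mul_of_nonneg_right h3 hmR.le
  · change ρ * m ≤ dΔ * (dΔ * m) - κ * m - Δ * (ε * m)
    have : dΔ * (dΔ * m) - κ * m - Δ * (ε * m) = (dΔ * dΔ - κ - Δ * ε) * m := by ring
    rw [this]
    exact mul_le_mul_of_nonneg_right h4 hmR.le
  · change ε * m ≤ dΔ * (dΔ * m)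
    rw [← mul_assoc]
    exact mul_le_mul_of_nonneg_right hem hmR.le
  · intro u v hv
    change v ∈ (if τ u < Λ then ∅ else univ.filter fun v => v ∉ Z ∧ τ v + b < τ u) at hv
    split_ifs at hv with hu
    · simp at hv
    · exact (mem_filter.1 hv).2.2
  · intro u huZ
    set T := (univ \ Z).filter fun v => v ∉ X.old u ∧ X.φ v = X.φ u ∧ v ≠ u ∧
        (v ∈ (Z.biUnion X.N ∪ D.biUnion fun c => insert c (X.N c)) ∨ τ v ≤ τ u) with hT
    change (Δ:ℝ) * (ε * m) + #T < dΔ * base u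
    by_cases hu : τ u < Λ
    · have hb : base u = m := if_pos hu
      rw [hb]
      have h8 : (#T : ℝ) ≤ κ * m := by
        apply hload T (φ u)
        intro v hv
        have hv := (mem_filter.1 hv).2
        refine ⟨?_, hv.2.1⟩
        rcases hv.2.2.2 with h9 | h9
        · have := hS1 v h9; omega
        · omega
      have h9 : 0 < (dΔ - κ - Δ * ε) * m := by positivity
      linarith
    · have hb : base u = ηb * m := if_neg hu
      have ho : X.old u = univ.filter fun v => v ∉ Z ∧ τ v + b < τ u := if_neg hu
      rw [hb]
      have h8 : #T ≤ 4 * (b + 1) := by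
        apply window_count τ hA.fib T (τ u) b
        intro v hv
        have hvZ : v ∉ Z := (mem_sdiff.1 (mem_filter.1 hv).1).2
        have hv := (mem_filter.1 hv).2
        rw [ho] at hv
        have h10 : τ u ≤ τ v + b := by
          by_contra h11
          exact hv.1 (mem_filter.2 ⟨mem_univ _, hvZ, by omega⟩)
        refine ⟨h10, ?_⟩
        rcases hv.2.2.2 with h9 | h9
        · have := hS1 v h9; omega
        · exact h9
      have h8' : (#T : ℝ) ≤ 4 * (b + 1) := by exact_mod_cast h8
      linarith
  · intro hh z hz hs al hal halc
    change (1 - θ) ^ Δ * #(Q z) ≤ #al at halc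
    have hM := many_dense hC hm hγ hη hnW hbipG hdegG hh
    set M := univ.filter fun i : Fin k =>
      γ / 4 * m ≤ #((cl (!(sW hh), i)).filter fun x => G.Adj hh x) with hMdef
    set I := al.image Prod.snd with hI
    have halI : ∀ i ∈ I, (sV z, i) ∈ al := by
      intro i hi
      obtain ⟨q, hq, rfl⟩ := mem_image.1 hi
      obtain ⟨j, -, hj⟩ := mem_image.1 (hal hq)
      rw [← hj] at hq ⊢
      exact hq
    have hIc : #I = #al := by
      apply card_image_of_injOn
      intro p hp q hq hpq
      obtain ⟨j, -, hj⟩ := mem_image.1 (hal hp)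
      obtain ⟨j', -, hj'⟩ := mem_image.1 (hal hq)
      rw [← hj, ← hj'] at hpq ⊢
      exact Prod.ext rfl hpq
    have hbern : 1 - Δ * θ ≤ (1 - θ) ^ Δ := by
      have := one_add_mul_le_pow (a := -θ) (by linarith only [hθ1]) Δ
      rw [← sub_eq_add_neg] at this
      linarith
    have hQle : (#(Q z) : ℝ) ≤ k := by
      have : #(Q z) ≤ k := by
        simp only [hQ]
        exact card_image_le.trans ((card_filter_le _ _).trans (by simp))
      exact_mod_cast this
    have hIR : (1 / 2 + γ / 2) * k - γ / 2 * k ≤ #I := by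
      rw [hIc]
      have a1 : (1 - Δ * θ) * #(Q z) ≤ (1 - θ) ^ Δ * #(Q z) :=
        mul_le_mul_of_nonneg_right hbern (Nat.cast_nonneg _)
      have a2 : Δ * θ * #(Q z) ≤ γ / 2 * k := by
        exact mul_le_mul hΔθ hQle (Nat.cast_nonneg _) (by linarith only [hγ])
      have := hQcard z
      linarith
    have hinter : γ / 2 * k ≤ #(I ∩ M) := by
      have a1 := card_union_add_card_inter I M
      have a2 : #(I ∪ M) ≤ k := (card_le_univ _).trans (by simp)
      have a3 : (#I : ℝ) + #M ≤ k + #(I ∩ M) := by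
        have : #I + #M ≤ k + #(I ∩ M) := by omega
        exact_mod_cast this
      linarith
    set T := D.filter fun c => X.φ c ∈ al ∧
          ∀ x ∈ X.N c, γ / 4 * m ≤ #((X.cl (X.φ x)).filter fun w => X.G.Adj hh w) with hT
    have hsub : ((I ∩ M).biUnion fun i => (D.filter fun v => sV v = sV z).filter fun v => idx v = i) ⊆ T := by
      intro c hc
      obtain ⟨i, hi, hci⟩ := mem_biUnion.1 hc
      obtain ⟨hiI, hiM⟩ := mem_inter.1 hi
      obtain ⟨hci1, hci2⟩ := mem_filter.1 hci
      obtain ⟨hcD, hcs⟩ := mem_filter.1 hci1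
      refine mem_filter.2 ⟨hcD, ?_, ?_⟩
      · have := halI i hiI
        change (sV c, idx c) ∈ al
        rw [hcs, hci2]; exact this
      · intro x hx
        rw [hφx c (mem_union_right _ hcD) x hx, hcs, hci2, ← hs]
        exact (mem_filter.1 hiM).2
    have hcc := card_le_card hsub
    rw [card_biUnion (by
      intro i _ j _ hij
      rw [Function.onFun, disjoint_left]
      intro c hc hc'
      exact hij ((mem_filter.1 hc).2.symm.trans (mem_filter.1 hc').2))] at hcc
    have hcc' : (∑ i ∈ I ∩ M, (#((D.filter fun v => sV v = sV z).filter fun v => idx v = i) : ℝ)) ≤ #T := by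
      exact_mod_cast hcc
    have hlow : #(I ∩ M) * ((ND:ℝ) / k / 2) ≤
        ∑ i ∈ I ∩ M, (#((D.filter fun v => sV v = sV z).filter fun v => idx v = i) : ℝ) := by
      rw [← nsmul_eq_mul, ← sum_const]
      apply sum_le_sum
      intro i _
      have := hA.dD (sV z) i
      linarith
    have hfin : γ / 2 * k * ((ND:ℝ) / k / 2) ≤ #(I ∩ M) * ((ND:ℝ) / k / 2) :=
      mul_le_mul_of_nonneg_right hinter (by positivity)
    have heq : γ / 2 * k * ((ND:ℝ) / k / 2) = γ * ND / 4 := by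
      field_simp
      ring
    have : (r₀ : ℝ) ≤ #T := by linarith
    exact_mod_cast this
  · have hZc : #Z = 2 * NZ := by
      rw [← card_filter_add_card_filter_not (s := Z) (fun w => sV w = true), hA.cZ true]
      have : (Z.filter fun w => ¬ sV w = true) = Z.filter fun w => sV w = false := by
        ext w; simp
      rw [this, hA.cZ false]; ring
    rw [hWcard, hVcard, hZc]
    push_cast
    exact hnum

end BW
end

section
namespace BW
open Finset
open scoped Classical

lemma hnum_ev (q γ ν ζ : ℝ) (hq0 : 0 < q) (hq1 : q ≤ 1) (hγ : 0 < γ) (hγ1 : γ ≤ 1) (hν : 0 < ν)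
    (hζ0 : 0 < ζ) (hζ : ζ ≤ q * γ * ν / 16) : ∃ n2 : ℕ, ∀ n : ℕ, n2 ≤ n →
    (2 * n : ℝ) * (2 * n) * 2 ^ (2 * ⌊ζ * n⌋₊) * (1 - q) ^ ⌊γ * (⌊ν * n⌋₊ : ℝ) / 4⌋₊ < 1 := by
  set c := q * γ * ν / 8 with hc
  have hc0 : 0 < c := by positivity
  have ht := (Real.tendsto_pow_mul_exp_neg_atTop_nhds_zero 2)
  have ht2 : Filter.Tendsto (fun n : ℕ => c * (n:ℝ)) Filter.atTop Filter.atTop :=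
    Filter.Tendsto.const_mul_atTop hc0 tendsto_natCast_atTop_atTop
  have ht3 := ht.comp ht2
  have hpos : 0 < c ^ 2 / (4 * Real.exp 2) := by positivity
  have hev := ht3.eventually (gt_mem_nhds hpos)
  obtain ⟨n2, hn2⟩ := Filter.eventually_atTop.1 hev
  refine ⟨n2, fun n hn => ?_⟩
  have h1 := hn2 n hn
  simp only [Function.comp] at h1
  set NZ := ⌊ζ * n⌋₊ with hNZ
  set ND := ⌊ν * n⌋₊ with hND
  set r := ⌊γ * (ND : ℝ) / 4⌋₊ with hr
  have hnR : (0:ℝ) ≤ n := Nat.cast_nonneg n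
  have a1 : (NZ:ℝ) ≤ ζ * n := Nat.floor_le (by positivity)
  have a2 : ν * n < ND + 1 := Nat.lt_floor_add_one _
  have a3 : γ * (ND : ℝ) / 4 < r + 1 := Nat.lt_floor_add_one _
  have a4 : (2:ℝ) ^ (2 * NZ) ≤ Real.exp (2 * NZ) := by
    have h2e : (2:ℝ) ≤ Real.exp 1 := by
      have := Real.add_one_le_exp (1:ℝ); linarith
    have : Real.exp (2 * NZ) = Real.exp 1 ^ (2 * NZ) := by
      rw [← Real.exp_nat_mul]; push_cast; ring_nf
    rw [this]
    exact pow_le_pow_left₀ (by norm_num) h2e _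
  have a5 : (1 - q) ^ r ≤ Real.exp (-(q * r)) := by
    have h5 : 1 - q ≤ Real.exp (-q) := by
      have := Real.add_one_le_exp (-q); linarith
    have : Real.exp (-(q * r)) = Real.exp (-q) ^ r := by
      rw [← Real.exp_nat_mul]; ring_nf
    rw [this]
    exact pow_le_pow_left₀ (by linarith) h5 _
  have a6 : (2 * NZ : ℝ) + -(q * r) ≤ 2 + -(c * n) := by
    have b1 : γ * (ν * n) ≤ γ * (ND + 1) := mul_le_mul_of_nonneg_left a2.le hγ.le
    have b2 : γ * (ν * n) / 4 - 2 ≤ r := by linarith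
    have b3 : q * (γ * (ν * n) / 4 - 2) ≤ q * r := mul_le_mul_of_nonneg_left b2 hq0.le
    have b4 : ζ * n ≤ q * γ * ν / 16 * n := mul_le_mul_of_nonneg_right hζ hnR
    have b5 : c * n = q * γ * ν / 8 * n := by rw [hc]
    nlinarith
  have a7 : (2:ℝ) ^ (2 * NZ) * (1 - q) ^ r ≤ Real.exp 2 * Real.exp (-(c * n)) := by
    calc (2:ℝ) ^ (2 * NZ) * (1 - q) ^ r ≤ Real.exp (2 * NZ) * Real.exp (-(q * r)) :=
          mul_le_mul a4 a5 (pow_nonneg (by linarith) _) (Real.exp_pos _).le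
      _ = Real.exp ((2 * NZ : ℝ) + -(q * r)) := (Real.exp_add _ _).symm
      _ ≤ Real.exp (2 + -(c * n)) := Real.exp_le_exp.2 a6
      _ = _ := Real.exp_add _ _
  calc (2 * n : ℝ) * (2 * n) * 2 ^ (2 * NZ) * (1 - q) ^ r
      = (4 * n ^ 2) * ((2:ℝ) ^ (2 * NZ) * (1 - q) ^ r) := by ring
    _ ≤ (4 * n ^ 2) * (Real.exp 2 * Real.exp (-(c * n))) := mul_le_mul_of_nonneg_left a7 (by positivity)
    _ = (4 * Real.exp 2 / c ^ 2) * ((c * n) ^ 2 * Real.exp (-(c * n))) := by field_simp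
    _ < (4 * Real.exp 2 / c ^ 2) * (c ^ 2 / (4 * Real.exp 2)) := mul_lt_mul_of_pos_left h1 (by positivity)
    _ = 1 := by field_simp

set_option maxHeartbeats 4000000 in
theorem main_bw (γ : ℝ) (hγ : 0 < γ) (hγ1 : γ ≤ 1) (Δ : ℕ) : ∃ β : ℝ, 0 < β ∧ ∃ n₀ : ℕ, ∀ n : ℕ, n₀ ≤ n →
    ∀ (V W : Type) [Fintype V] [Fintype W] (H : SimpleGraph V) (G : SimpleGraph W)
    (sV : V → Bool) (sW : W → Bool),
    (∀ s, #(univ.filter fun v => sV v = s) = n) → (∀ s, #(univ.filter fun w => sW w = s) = n) →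
    (∀ u v, H.Adj u v → sV u ≠ sV v) → (∀ u v, G.Adj u v → sW u ≠ sW v) →
    (∀ v, #(univ.filter fun u => H.Adj v u) ≤ Δ) →
    (∀ w, (1 / 2 + γ) * n ≤ #(univ.filter fun x => G.Adj w x)) →
    ∀ pos : V → ℕ, Function.Injective pos → (∀ v, pos v < 2 * n) → ∀ b : ℕ, (b:ℝ) ≤ β * n →
    (∀ u v, H.Adj u v → pos u ≤ pos v + b) → ∃ g : H →g G, Function.Injective g := by
  obtain ⟨dΔ, hdΔ⟩ : ∃ x, x = (γ / 16) ^ Δ := ⟨_, rfl⟩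
  have hd0 : 0 < dΔ := by rw [hdΔ]; positivity
  have hd1 : dΔ ≤ 1 := by rw [hdΔ]; exact pow_le_one₀ (by positivity) (by linarith)
  have hdd0 : 0 < dΔ * dΔ := by positivity
  have hdd1 : dΔ * dΔ ≤ dΔ := by nlinarith
  obtain ⟨κ, hκ0, hκ1, hκ2⟩ : ∃ κ : ℝ, 0 < κ ∧ κ ≤ dΔ * dΔ / 8 ∧ κ ≤ γ / 16 :=
    ⟨min (dΔ * dΔ / 8) (γ / 16), by positivity, min_le_left _ _, min_le_right _ _⟩
  obtain ⟨ρ, hρ0, hρ1, hρ2⟩ : ∃ ρ : ℝ, 0 < ρ ∧ ρ ≤ dΔ * dΔ / 2 ∧ ρ ≤ γ / 8 :=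
    ⟨min (dΔ * dΔ / 2) (γ / 8), by positivity, min_le_left _ _, min_le_right _ _⟩
  have hρ3 : ρ ≤ 1 := by linarith
  obtain ⟨q, hq⟩ : ∃ q, q = ρ ^ (Δ + 1) / 2 := ⟨_, rfl⟩
  have hq0 : 0 < q := by rw [hq]; positivity
  have hq1 : q ≤ 1 := by
    have : ρ ^ (Δ + 1) ≤ 1 := pow_le_one₀ hρ0.le hρ3
    rw [hq]; linarith
  have hΔR : (0:ℝ) ≤ Δ := Nat.cast_nonneg _
  obtain ⟨θ, hθ0, hθ1, hθ2⟩ : ∃ θ : ℝ, 0 < θ ∧ θ ≤ 1 ∧ Δ * θ ≤ γ / 2 := by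
    refine ⟨γ / (2 * (Δ + 1)), by positivity, ?_, ?_⟩
    · rw [div_le_one (by positivity)]; nlinarith
    · rw [mul_div_assoc', div_le_div_iff₀ (by positivity) (by norm_num)]; nlinarith
  obtain ⟨lam, hlam⟩ : ∃ x, x = κ / 16 := ⟨_, rfl⟩
  have hlam0 : 0 < lam := by rw [hlam]; positivity
  obtain ⟨ν, hν0, hν1, hν2⟩ : ∃ ν : ℝ, 0 < ν ∧ 64 * (Δ + 1) ^ 3 * ν = lam ∧ ν ≤ lam := by
    refine ⟨lam / (64 * (Δ + 1) ^ 3), by positivity, by field_simp, ?_⟩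
    apply div_le_self hlam0.le
    have : (1:ℝ) ≤ ((Δ:ℝ) + 1) ^ 3 := one_le_pow₀ (by linarith)
    linarith
  obtain ⟨ζ, hζ⟩ : ∃ x, x = q * γ * ν / 16 := ⟨_, rfl⟩
  have hζ0 : 0 < ζ := by rw [hζ]; positivity
  have hqγ : q * γ ≤ 1 := by nlinarith
  have hqγ0 : 0 < q * γ := by positivity
  have hζ1 : ζ ≤ ν / 16 := by rw [hζ]; nlinarith
  obtain ⟨η, hη⟩ : ∃ x, x = ζ / 4 := ⟨_, rfl⟩
  have hη0 : 0 < η := by rw [hη]; positivity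
  obtain ⟨σ, hσ⟩ : ∃ x, x = dΔ * η := ⟨_, rfl⟩
  have hσ0 : 0 < σ := by rw [hσ]; positivity
  have hση : σ ≤ η := by rw [hσ]; nlinarith
  obtain ⟨ε, hε0, hε1, hε2, hε3⟩ : ∃ ε : ℝ, 0 < ε ∧ (Δ + 1) * ε ≤ κ ∧ (Δ + 1) * ε ≤ θ * (dΔ / 2) ∧
      (Δ + 1) * ε ≤ σ / 2 := by
    have h0 : (0:ℝ) < Δ + 1 := by positivity
    refine ⟨min κ (min (θ * (dΔ / 2)) (σ / 2)) / (Δ + 1), by positivity, ?_, ?_, ?_⟩ <;>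
    rw [mul_div_cancel₀ _ h0.ne']
    · exact min_le_left _ _
    · exact (min_le_right _ _).trans (min_le_left _ _)
    · exact (min_le_right _ _).trans (min_le_right _ _)
  have hΔε : 0 ≤ Δ * ε := by positivity
  obtain ⟨K, n1, hclus⟩ := clusters γ ε η hγ hγ1 hε0 hη0
  obtain ⟨n2, hn2⟩ := hnum_ev q γ ν ζ hq0 hq1 hγ hγ1 hν0 hζ0 hζ.le
  have hKR : (0:ℝ) ≤ K := Nat.cast_nonneg _
  obtain ⟨s, hs0, hs⟩ : ∃ s : ℕ, 0 < s ∧ 8 * (K:ℝ) ≤ σ / 16 * s := by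
    obtain ⟨s, hs⟩ := exists_nat_gt (8 * (K:ℝ) / (σ / 16))
    rw [div_lt_iff₀ (by positivity)] at hs
    refine ⟨s + 1, by omega, ?_⟩
    push_cast
    nlinarith
  have hsR : (0:ℝ) < s := by exact_mod_cast hs0
  obtain ⟨M, hM⟩ : ∃ M : ℝ, M = 64 * (K + 1) * (6 * s ^ 2 + 1) := ⟨_, rfl⟩
  have hM0 : 0 < M := by rw [hM]; positivity
  have hM64 : 64 ≤ M := by
    have : 0 ≤ (K:ℝ) * s ^ 2 := by positivity
    have : 0 ≤ (s:ℝ) ^ 2 := by positivity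
    rw [hM]; nlinarith
  obtain ⟨n3, hn3⟩ := exists_nat_gt ((32 * M + 400 * s * (K + 1) + 64) / σ)
  rw [div_lt_iff₀ hσ0] at hn3
  refine ⟨σ / (32 * M), by positivity, max n1 (max n2 (max n3 1)), ?_⟩
  intro n hn V W _ _ H G sV sW hnV hnW hbipH hbipG hdegH hdegG pos hinj hpos b hbn hb
  have hnn1 : n1 ≤ n := by omega
  have hnn2 : n2 ≤ n := by omega
  have hnn3 : n3 ≤ n := by omega
  have hn0 : 0 < n := by omega
  have hnR : (0:ℝ) < n := by exact_mod_cast hn0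
  obtain ⟨k, m, cl, R, hC, hkK⟩ := hclus n hnn1 W G sW hnW hbipG hdegG
  have hk0 := hC.k0
  have hkR : (0:ℝ) < k := by exact_mod_cast hk0
  have hkK' : (k:ℝ) ≤ K := by exact_mod_cast hkK
  have hσn : 32 * M + 400 * s * (K + 1) + 64 ≤ σ * n := by
    have h1 : (n3:ℝ) ≤ n := by exact_mod_cast hnn3
    have h2 := mul_le_mul_of_nonneg_left h1 hσ0.le
    linarith
  have hζν : ζ ≤ 1 := by linarith
  have hη1 : η ≤ 1 / 4 := by linarith
  have hbig := hC.big
  have hnkm : (n:ℝ) ≤ 2 * (k * m) := by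
    have := mul_le_mul_of_nonneg_right hη1 hnR.le
    linarith
  have hm : 0 < m := by
    rcases Nat.eq_zero_or_pos m with h | h
    · subst h; simp at hnkm; omega
    · exact h
  have hmR : (0:ℝ) < m := by exact_mod_cast hm
  obtain ⟨B, hB⟩ : ∃ B : ℝ, B = b + 1 := ⟨_, rfl⟩
  have hB0 : 0 < B := by rw [hB]; positivity
  have hMB : M * B ≤ σ * n / 16 := by
    have h1 : M * b ≤ M * (σ / (32 * M) * n) := mul_le_mul_of_nonneg_left hbn hM0.le
    have h2 : M * (σ / (32 * M) * n) = σ * n / 32 := by field_simp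
    have h3 : 0 ≤ 400 * (s:ℝ) * (K + 1) := by positivity
    rw [hB]; linarith
  have hsK : 0 ≤ (K:ℝ) * s ^ 2 := by positivity
  have hs2 : 0 ≤ (s:ℝ) ^ 2 := by positivity
  have hMB1 : 8 * (6 * s ^ 2) * K * B ≤ M * B := by
    apply mul_le_mul_of_nonneg_right _ hB0.le
    rw [hM]; linarith only [hsK, hs2, hKR]
  have hMB2 : 64 * (6 * s ^ 2 + 1) * B ≤ M * B := by
    apply mul_le_mul_of_nonneg_right _ hB0.le
    rw [hM]; linarith only [hsK, hs2, hKR]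
  have hMB3 : 64 * K * B ≤ M * B := by
    apply mul_le_mul_of_nonneg_right _ hB0.le
    rw [hM]; linarith only [hsK, hs2, hKR]
  have hMB4 : 64 * B ≤ M * B := mul_le_mul_of_nonneg_right hM64 hB0.le
  obtain ⟨S, hS⟩ : ∃ S : ℕ, S = 6 * s ^ 2 := ⟨_, rfl⟩
  have hS0 : 0 < S := by rw [hS]; positivity
  have hSR : (S:ℝ) = 6 * s ^ 2 := by rw [hS]; push_cast; ring
  obtain ⟨ℓ, hℓ⟩ : ∃ ℓ : ℕ, ℓ = 2 * n / S + 1 := ⟨_, rfl⟩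
  have hℓS : 2 * n ≤ ℓ * S := by
    have h1 := Nat.div_add_mod (2 * n) S
    have h2 := Nat.mod_lt (2 * n) hS0
    rw [hℓ, add_mul, one_mul, mul_comm (2 * n / S) S]; omega
  have hℓR : (ℓ:ℝ) ≤ 2 * n / S + 1 := by
    rw [hℓ]; push_cast
    have := Nat.cast_div_le (α := ℝ) (m := 2 * n) (n := S)
    push_cast at this
    linarith
  have hσ1 : σ ≤ 1 := by linarith
  have hbℓ : 4 * (b + 1) ≤ ℓ := by
    have h1 : (2 * n : ℝ) ≤ ℓ * S := by exact_mod_cast hℓS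
    have h2 : (4 * B) * S ≤ ℓ * S := by
      rw [hSR] at h1 ⊢
      have : σ * n ≤ 1 * n := mul_le_mul_of_nonneg_right hσ1 hnR.le
      have h5 : 0 ≤ (6 * (s:ℝ) ^ 2) * B := by positivity
      linarith
    have h3 : 4 * B ≤ ℓ := le_of_mul_le_mul_right h2 (by exact_mod_cast hS0)
    rw [hB] at h3
    exact_mod_cast h3
  have hsqrt : √(6 * (S:ℝ)) = 6 * s := by
    rw [hSR, show (6:ℝ) * (6 * s ^ 2) = (6 * s) ^ 2 by ring]
    exact Real.sqrt_sq (by positivity)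
  obtain ⟨err, herr⟩ : ∃ err : ℝ, err = (4 * ℓ : ℕ) * √(6 * (S:ℝ)) + 8 * (b + 1) * S := ⟨_, rfl⟩
  have herr0 : 0 ≤ err := by rw [herr]; positivity
  have hKerr : K * err ≤ σ * n / 4 := by
    have h1 : err ≤ 8 * n / s + 24 * s + 8 * (6 * s ^ 2) * B := by
      rw [herr, hsqrt]
      push_cast
      have h2 : 4 * (ℓ:ℝ) * (6 * s) ≤ 4 * (2 * n / S + 1) * (6 * s) := by gcongr
      have h3 : 4 * (2 * n / S + 1) * (6 * s) = 8 * (n:ℝ) / s + 24 * s := by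
        rw [hSR]; field_simp; ring
      rw [hSR, hB]; linarith
    have h4 : K * err ≤ K * (8 * n / s + 24 * s + 8 * (6 * s ^ 2) * B) := mul_le_mul_of_nonneg_left h1 hKR
    have h5 : (K:ℝ) * (8 * n / s) ≤ σ * n / 16 := by
      rw [show (K:ℝ) * (8 * n / s) = 8 * K * n / s by ring, div_le_iff₀ hsR]
      have := mul_le_mul_of_nonneg_right hs hnR.le
      linarith
    have h6 : (K:ℝ) * (24 * s) ≤ σ * n / 16 := by
      have h7 : 0 ≤ (s:ℝ) * K := by positivity
      linarith
    linarith
  have hkerr : k * err ≤ σ * n / 4 := (mul_le_mul_of_nonneg_right hkK' herr0).trans hKerr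
  have hηn : σ * n ≤ η * n := mul_le_mul_of_nonneg_right hση hnR.le
  have hηζ : η * n = ζ * n / 4 := by rw [hη]; ring
  have hζn : ζ * n ≤ ν / 16 * n := mul_le_mul_of_nonneg_right hζ1 hnR.le
  have hνn : ν * n ≤ lam * n := mul_le_mul_of_nonneg_right hν2 hnR.le
  have hlamn : lam * n = κ * n / 16 := by rw [hlam]; ring
  have h64 : 64 ≤ σ * n := by
    have h3 : 0 ≤ 400 * (s:ℝ) * (K + 1) := by positivity
    linarith
  obtain ⟨L, hL⟩ : ∃ L : ℕ, L = ⌊lam * n⌋₊ := ⟨_, rfl⟩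
  have hL1 : (L:ℝ) ≤ lam * n := by rw [hL]; exact Nat.floor_le (by positivity)
  have hL2 : lam * n < L + 1 := by rw [hL]; exact Nat.lt_floor_add_one _
  obtain ⟨ND, hND⟩ : ∃ L : ℕ, L = ⌊ν * n⌋₊ := ⟨_, rfl⟩
  have hND1 : (ND:ℝ) ≤ ν * n := by rw [hND]; exact Nat.floor_le (by positivity)
  have hND2 : ν * n < ND + 1 := by rw [hND]; exact Nat.lt_floor_add_one _
  obtain ⟨NZ, hNZ⟩ : ∃ L : ℕ, L = ⌊ζ * n⌋₊ := ⟨_, rfl⟩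
  have hNZ1 : (NZ:ℝ) ≤ ζ * n := by rw [hNZ]; exact Nat.floor_le (by positivity)
  have hNZ2 : ζ * n < NZ + 1 := by rw [hNZ]; exact Nat.lt_floor_add_one _
  have hL0 : 0 < L := by
    have : (0:ℝ) < L := by linarith
    exact_mod_cast this
  have hLn : L ≤ 2 * n := by
    have h1 : lam * n ≤ 1 * n := mul_le_mul_of_nonneg_right (by linarith) hnR.le
    have : (L:ℝ) ≤ 2 * n := by linarith
    exact_mod_cast this
  have hN : 4 * (2 * (NZ + ND) * (Δ + 1) ^ 3 + 16 * (b + 1) * (L / ℓ + 1)) ≤ L := by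
    have hLℓ : L / ℓ ≤ S := by
      apply Nat.div_le_of_le_mul
      omega
    have h1 : 4 * (2 * (NZ + ND) * (Δ + 1) ^ 3 + 16 * (b + 1) * (L / ℓ + 1)) ≤
        4 * (2 * (NZ + ND) * (Δ + 1) ^ 3 + 16 * (b + 1) * (S + 1)) := by gcongr
    refine h1.trans ?_
    have h2 : (4 * (2 * (NZ + ND) * (Δ + 1) ^ 3 + 16 * (b + 1) * (S + 1)) : ℝ) ≤ L := by
      have h3 : ((NZ:ℝ) + ND) * (Δ + 1) ^ 3 ≤ (2 * (ν * n)) * (Δ + 1) ^ 3 :=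
        mul_le_mul_of_nonneg_right (by linarith) (by positivity)
      have h4 : (2 * (ν * n)) * ((Δ:ℝ) + 1) ^ 3 = lam * n / 32 := by rw [← hν1]; ring
      rw [hSR, ← hB]
      linarith
    exact_mod_cast h2
  have hconn : ∀ i j : Fin k, ∃ c, R i c ∧ R j c := by
    intro i j
    by_contra hno
    push Not at hno
    have hd : Disjoint (univ.filter fun c => R i c) (univ.filter fun c => R j c) := by
      rw [disjoint_left]
      intro c h1 h2
      exact hno c (mem_filter.1 h1).2 (mem_filter.1 h2).2
    have h1 := card_le_univ ((univ.filter fun c => R i c) ∪ (univ.filter fun c => R j c))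
    rw [card_union_of_disjoint hd, Fintype.card_fin] at h1
    have h2 : (#(univ.filter fun c => R i c) : ℝ) + #(univ.filter fun c => R j c) ≤ k := by exact_mod_cast h1
    have h3 := hC.deg1 i
    have h4 := hC.deg1 j
    have h5 : 0 < γ * k := by positivity
    linarith
  choose conn hconn using hconn
  obtain ⟨τ, idx, Z, D, hA⟩ := assign H sV Δ hdegH pos hinj n hpos b hb hnV k hk0 R hC.refl conn hconn
    L ℓ NZ ND S hL0 hLn hbℓ hℓS hN
  rw [← herr] at hA
  have hdη : dΔ * η = σ := hσ.symm
  have hΛ : ((L + 3 * (b + 1) : ℕ) : ℝ) = L + 3 * B := by rw [hB]; push_cast; ring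
  have hε4 : ε ≤ (Δ + 1) * ε := by linarith
  refine assemble H G sV sW n hn0 hnV hnW hbipH hbipG Δ hdegH hdegG hC hA hγ hγ1 hε0 (by linarith) hm κ η θ ρ
    ?_ ?_ hη0.le (by linarith) (by rw [← hdΔ]; linarith) ?_ hθ0.le hθ1 (by rw [← hdΔ]; linarith) hθ2
    (by linarith) (by rw [← hdΔ]; linarith) (by rw [← hdΔ]; linarith) hρ0 hρ3 ?_ ?_
    ⌊γ * (ND : ℝ) / 4⌋₊ (Nat.floor_le (by positivity)) ?_
  · rw [hΛ, div_add' _ _ _ hkR.ne', div_le_iff₀ hkR]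
    have : κ * n ≤ κ * (2 * (k * m)) := mul_le_mul_of_nonneg_left hnkm hκ0.le
    linarith
  · have h1 : k * (η * m + (((n:ℝ) - NZ) / k + err)) ≤ k * m := by
      have h2 : k * (η * m + (((n:ℝ) - NZ) / k + err)) = η * (k * m) + (n - NZ) + k * err := by
        field_simp
        ring
      rw [h2]
      have h3 : (1 - η) * ((1 - η) * n) ≤ (1 - η) * (k * m) := mul_le_mul_of_nonneg_left hbig (by linarith)
      have h4 : 0 ≤ η * η * n := by positivity
      linarith
    exact le_of_mul_le_mul_left h1 hkR
  · rw [← hdΔ]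
    have h1 : θ * (dΔ / 2) ≤ θ * (dΔ - κ - Δ * ε) := mul_le_mul_of_nonneg_left (by linarith) hθ0.le
    linarith
  · rw [← hdΔ, ← hB]
    have h1 : k * B ≤ K * B := mul_le_mul_of_nonneg_right hkK' hB0.le
    have h2 : k * (Δ * (ε * m) + 4 * B) < k * (dΔ * (η * m)) := by
      have h3 : k * (dΔ * (η * m)) = σ * (k * m) := by rw [hσ]; ring
      have h4 : ((Δ + 1) * ε) * (k * m) ≤ (σ / 2) * (k * m) := mul_le_mul_of_nonneg_right hε3 (by positivity)
      have h5 : σ * n ≤ σ * (2 * (k * m)) := mul_le_mul_of_nonneg_left hnkm hσ0.le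
      have h6 : 0 < ε * (k * m) := by positivity
      rw [h3]
      linarith
    exact lt_of_mul_lt_mul_left h2 hkR.le
  · rw [div_div, le_div_iff₀ (by positivity)]
    linarith
  · have := hn2 n hnn2
    rw [← hNZ, ← hND, hq] at this
    exact this

end BW
end

theorem stmt_9 (γ : ℝ) (hγ : 0 < γ) (Δ : ℕ) :
    ∃ β : ℝ, 0 < β ∧ ∃ n₀ : ℕ, ∀ n : ℕ, n₀ ≤ n →
      ∀ (G H : SimpleGraph (Fin (2 * n))) (A B X Y : Finset (Fin (2 * n))),
        Disjoint A B → A ∪ B = Finset.univ → A.card = n → B.card = n →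
        (∀ u v, G.Adj u v → (u ∈ A ↔ v ∈ B)) →
        Disjoint X Y → X ∪ Y = Finset.univ → X.card = n → Y.card = n →
        (∀ u v, H.Adj u v → (u ∈ X ↔ v ∈ Y)) →
        (∀ v, (1 / 2 + γ) * n ≤ ((G.neighborSet v).ncard : ℝ)) →
        (∀ v, (H.neighborSet v).ncard ≤ Δ) →
        (∃ e : Fin (2 * n) ≃ Fin (2 * n), ∀ u v, H.Adj u v →
          |((e u : ℕ) : ℝ) - ((e v : ℕ) : ℝ)| ≤ β * n) →
        ∃ f : H →g G, Function.Injective f := by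
  classical
  obtain ⟨β, hβ, n₀, hmain⟩ := BW.main_bw (min γ 1) (by positivity) (min_le_right _ _) Δ
  refine ⟨β, hβ, n₀, ?_⟩
  intro n hn G H A B X Y hAB hABu hA hB hG hXY hXYu hX hY hH hdG hdH ⟨e, he⟩
  have side : ∀ P Q : Finset (Fin (2 * n)), Disjoint P Q → P ∪ Q = Finset.univ → P.card = n → Q.card = n →
      ∀ s : Bool, #(univ.filter fun v => decide (v ∈ Q) = s) = n := by
    intro P Q hPQ hu hP hQ s
    cases s
    · have : (univ.filter fun v => decide (v ∈ Q) = false) = P := by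
        ext v
        have h1 : v ∈ P ∪ Q := by rw [hu]; exact mem_univ _
        have h2 : v ∈ P → v ∉ Q := fun hp => disjoint_left.1 hPQ hp
        simp only [mem_filter, mem_univ, true_and, decide_eq_false_iff_not]
        rw [mem_union] at h1
        tauto
      rw [this, hP]
    · have : (univ.filter fun v => decide (v ∈ Q) = true) = Q := by
        ext v
        simp
      rw [this, hQ]
  have bip : ∀ (K : SimpleGraph (Fin (2 * n))) (P Q : Finset (Fin (2 * n))), Disjoint P Q → P ∪ Q = Finset.univ →
      (∀ u v, K.Adj u v → (u ∈ P ↔ v ∈ Q)) → ∀ u v, K.Adj u v → decide (u ∈ Q) ≠ decide (v ∈ Q) := by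
    intro K P Q hPQ hu hK u v huv heq
    have h1 := hK u v huv
    have h2 : u ∈ P ∪ Q := by rw [hu]; exact mem_univ _
    have h3 : u ∈ P → u ∉ Q := fun hp => disjoint_left.1 hPQ hp
    rw [decide_eq_decide] at heq
    rw [mem_union] at h2
    tauto
  have nc : ∀ (K : SimpleGraph (Fin (2 * n))) v, (K.neighborSet v).ncard = #(univ.filter fun x => K.Adj v x) := by
    intro K v
    rw [← Set.ncard_coe_finset]
    congr 1
    ext x
    simp
  have key := hmain n hn (Fin (2 * n)) (Fin (2 * n)) H G (fun v => decide (v ∈ Y)) (fun v => decide (v ∈ B))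
    (fun s => by convert side X Y hXY hXYu hX hY s) (fun s => by convert side A B hAB hABu hA hB s)
    (bip H X Y hXY hXYu hH) (bip G A B hAB hABu hG)
    (fun v => by
      have := hdH v
      rw [nc] at this
      convert this)
    (fun v => by
      have h1 := hdG v
      rw [nc] at h1
      have h2 : (1 / 2 + min γ 1) * (n:ℝ) ≤ (1 / 2 + γ) * n :=
        mul_le_mul_of_nonneg_right (by linarith [min_le_left γ 1]) (Nat.cast_nonneg _)
      have h3 := h2.trans h1
      convert h3)
    (fun v => (e v : ℕ)) (fun u v huv => e.injective (Fin.ext huv)) (fun v => (e v).2)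
    ⌊β * n⌋₊ (Nat.floor_le (by positivity)) (by
      intro u v huv
      have h1 := he u v huv
      have h2 := (abs_le.1 h1).2
      have h3 : (((e u : ℕ) - (e v : ℕ) : ℕ) : ℝ) ≤ β * n := by
        rcases le_total (e v : ℕ) (e u : ℕ) with h | h
        · rw [Nat.cast_sub h]; exact h2
        · rw [Nat.sub_eq_zero_of_le h]; simp; positivity
      have h4 := Nat.le_floor h3
      omega)
  exact key
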